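/- Let (X,𝓑,μ,T) be an invertible probability measure-preserving system, let ℓ, k ∈ ℕ, and let f : ℕ → ℝ with f ∈ 𝓕_ℓ and lim_{n→∞} n·Δ^ℓ f(n) = ∞ (as holds when f is the restriction of a tempered function). Then for any A ∈ 𝓑 with μ(A) > 0, the limit lim_{N→∞} (1/N) Σ_{n=1}^N μ(A ∩ T^{−⌊f(n)⌋}A ∩ T^{−⌊f(n+1)⌋}A ∩ ⋯ ∩ T^{−⌊f(n+k)⌋}A) exists and is positive. -/

import Mathlib

open Filter Finset MeasureTheory

/-- Discrete derivative: `Δg(n) = g(n) - g(n-1)` for `n ≥ 2`, and `Δg(1) = g(1)`. -/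
noncomputable def dd (g : ℕ → ℝ) (n : ℕ) : ℝ := if n = 1 then g 1 else g n - g (n - 1)

/-- Iterated discrete derivative `Δ^k`. -/
noncomputable def ddIter (f : ℕ → ℝ) : ℕ → ℕ → ℝ
  | 0 => f
  | k + 1 => dd (ddIter f k)

/-- `N`-th `W`-weighted average `𝔼^W_{n ≤ N} x_n`. -/
noncomputable def wavg {Y : Type*} [AddCommGroup Y] [Module ℝ Y]
    (W : ℕ → ℝ) (x : ℕ → Y) (N : ℕ) : Y :=
  (W N)⁻¹ • ∑ n ∈ Finset.Icc 1 N, dd W n • x n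

/-- `W`-weighted average over the interval `[M, N]`. -/
noncomputable def wavgI {Y : Type*} [AddCommGroup Y] [Module ℝ Y]
    (W : ℕ → ℝ) (x : ℕ → Y) (M N : ℕ) : Y :=
  (W N - W M)⁻¹ • ∑ n ∈ Finset.Icc M N, dd W n • x n

/-- Cesàro average over the interval `[M, N]`. -/
noncomputable def cesaroI {Y : Type*} [AddCommGroup Y] [Module ℝ Y]
    (x : ℕ → Y) (M N : ℕ) : Y :=
  ((N : ℝ) - (M : ℝ))⁻¹ • ∑ n ∈ Finset.Icc M N, x n

/-- Iterated `W`-weighted averages: `iterAvg W x k N = 𝔼(k)^W_{n ≤ N} x_n`,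
with the convention `iterAvg W x 0 = x`. -/
noncomputable def iterAvg {Y : Type*} [AddCommGroup Y] [Module ℝ Y]
    (W : ℕ → ℝ) (x : ℕ → Y) : ℕ → ℕ → Y
  | 0, N => x N
  | k + 1, N => (W N)⁻¹ • ∑ n ∈ Finset.Icc 1 N, dd W n • iterAvg W x k n

/-- The uniform `W`-weighted average of `x` equals `L`: `𝔼^W_unif x_n = L`. -/
def unifAvg {Y : Type*} [NormedAddCommGroup Y] [NormedSpace ℝ Y]
    (W : ℕ → ℝ) (x : ℕ → Y) (L : Y) : Prop :=
  ∀ ε > (0 : ℝ), ∃ K > (0 : ℝ), ∀ M N : ℕ, 1 ≤ M → M ≤ N → K ≤ W N - W M →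
    ‖wavgI W x M N - L‖ < ε

/-- `𝔼(∞)^W x_n = L`: `lim_{k → ∞} limsup_{N → ∞} ‖𝔼(k)^W_{n ≤ N}(x_n - L)‖ = 0`. -/
def iterInfty {Y : Type*} [NormedAddCommGroup Y] [NormedSpace ℝ Y]
    (W : ℕ → ℝ) (x : ℕ → Y) (L : Y) : Prop :=
  Tendsto (fun k => Filter.limsup (fun N => ‖iterAvg W (fun n => x n - L) (k + 1) N‖) atTop)
    atTop (nhds 0)

/-- Membership in the class `𝓕₁`. -/
def inF1 (f : ℕ → ℝ) : Prop :=
  Tendsto f atTop atTop ∧ Tendsto (fun n => dd f n) atTop (nhds 0) ∧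
    ∃ n₀ : ℕ, ∀ m n : ℕ, n₀ ≤ m → m ≤ n → dd f n ≤ dd f m

/-- `memF ℓ f` means `f ∈ 𝓕_{ℓ+1}`. -/
def memF : ℕ → (ℕ → ℝ) → Prop
  | 0, f => inF1 f
  | ℓ + 1, f => memF ℓ (dd f)

/-- Integer powers `T^m` of an invertible map `T` with inverse `e`. -/
def zpowIter {X : Type*} (T e : X → X) (m : ℤ) : X → X :=
  if 0 ≤ m then T^[m.toNat] else e^[(-m).toNat]

/-- `p(Δ)f(n)` for an integer polynomial `p`. -/
noncomputable def polyDD (p : Polynomial ℤ) (f : ℕ → ℝ) (n : ℕ) : ℝ :=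
  ∑ j ∈ Finset.range (p.natDegree + 1), (p.coeff j : ℝ) * ddIter f j n

/-- `E ⊆ ℕ = {1, 2, ...}` has positive upper Banach density. -/
def posUBD (E : Set ℕ) : Prop :=
  ∃ δ : ℝ, 0 < δ ∧ ∃ M N : ℕ → ℕ, (∀ j, 1 ≤ M j ∧ M j ≤ N j) ∧
    Tendsto (fun j => N j - M j) atTop atTop ∧
    ∀ j, δ * ((N j : ℝ) - (M j : ℝ)) ≤ (Nat.card ↥(E ∩ Set.Icc (M j) (N j)) : ℝ)


namespace P13

/-- bounded real functions -/
def Bdd {α : Type*} (f : α → ℝ) : Prop := ∃ C, ∀ x, |f x| ≤ C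

namespace Bdd
variable {α β : Type*} {f g : α → ℝ}

theorem of_le {C : ℝ} (h : ∀ x, |f x| ≤ C) : Bdd f := ⟨C, h⟩

theorem const (c : ℝ) : Bdd (fun _ : α => c) := ⟨|c|, fun _ => le_rfl⟩

theorem exists_pos (hf : Bdd f) : ∃ C, 0 < C ∧ ∀ x, |f x| ≤ C := by
  obtain ⟨C, hC⟩ := hf
  exact ⟨max C 1, lt_max_of_lt_right one_pos, fun x => (hC x).trans (le_max_left _ _)⟩

theorem add (hf : Bdd f) (hg : Bdd g) : Bdd (fun x => f x + g x) := by
  obtain ⟨C, hC⟩ := hf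
  obtain ⟨D, hD⟩ := hg
  exact ⟨C + D, fun x => (abs_add_le _ _).trans (add_le_add (hC x) (hD x))⟩

theorem neg (hf : Bdd f) : Bdd (fun x => - f x) := by
  obtain ⟨C, hC⟩ := hf
  exact ⟨C, fun x => by rw [abs_neg]; exact hC x⟩

theorem sub (hf : Bdd f) (hg : Bdd g) : Bdd (fun x => f x - g x) := by
  simpa only [sub_eq_add_neg] using hf.add hg.neg

theorem mul (hf : Bdd f) (hg : Bdd g) : Bdd (fun x => f x * g x) := by
  obtain ⟨C, hC⟩ := hf
  obtain ⟨D, hD⟩ := hg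
  refine ⟨C * D, fun x => ?_⟩
  rw [abs_mul]
  exact mul_le_mul (hC x) (hD x) (abs_nonneg _) ((abs_nonneg _).trans (hC x))

theorem cmul (c : ℝ) (hf : Bdd f) : Bdd (fun x => c * f x) := (const c).mul hf

theorem div_const (hf : Bdd f) (c : ℝ) : Bdd (fun x => f x / c) := by
  simpa only [div_eq_mul_inv] using hf.mul (const c⁻¹)

theorem sq (hf : Bdd f) : Bdd (fun x => f x ^ 2) := by
  simpa only [pow_two] using hf.mul hf

theorem abs (hf : Bdd f) : Bdd (fun x => |f x|) := by
  obtain ⟨C, hC⟩ := hf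
  exact ⟨C, fun x => by rw [abs_abs]; exact hC x⟩

theorem comp (hf : Bdd f) (g : β → α) : Bdd (fun x => f (g x)) := by
  obtain ⟨C, hC⟩ := hf
  exact ⟨C, fun x => hC _⟩

theorem sum {ι : Type*} {s : Finset ι} {F : ι → α → ℝ} (h : ∀ i ∈ s, Bdd (F i)) :
    Bdd (fun x => ∑ i ∈ s, F i x) := by
  classical
  induction s using Finset.induction_on with
  | empty => simpa using const 0
  | insert a s ha ih =>
    simp only [Finset.sum_insert ha]
    exact (h a (by simp)).add (ih fun i hi => h i (by simp [hi]))

theorem prod {ι : Type*} {s : Finset ι} {F : ι → α → ℝ} (h : ∀ i ∈ s, Bdd (F i)) :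
    Bdd (fun x => ∏ i ∈ s, F i x) := by
  classical
  induction s using Finset.induction_on with
  | empty => simpa using const 1
  | insert a s ha ih =>
    simp only [Finset.prod_insert ha]
    exact (h a (by simp)).mul (ih fun i hi => h i (by simp [hi]))

end Bdd

/-- finitely additive means on all bounded functions -/
structure IsMean {α : Type*} (m : (α → ℝ) → ℝ) : Prop where
  add : ∀ {f g : α → ℝ}, Bdd f → Bdd g → m (fun x => f x + g x) = m f + m g
  smul : ∀ (c : ℝ) {f : α → ℝ}, Bdd f → m (fun x => c * f x) = c * m f
  nonneg : ∀ {f : α → ℝ}, Bdd f → (∀ x, 0 ≤ f x) → 0 ≤ m f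
  one : m (fun _ => 1) = 1

namespace IsMean
variable {α β : Type*} {m : (α → ℝ) → ℝ} {f g : α → ℝ}

theorem const (hm : IsMean m) (c : ℝ) : m (fun _ => c) = c := by
  have := hm.smul c (Bdd.const (α := α) 1)
  simpa [hm.one] using this

theorem neg (hm : IsMean m) (hf : Bdd f) : m (fun x => - f x) = - m f := by
  have := hm.smul (-1) hf
  simpa using this

theorem sub (hm : IsMean m) (hf : Bdd f) (hg : Bdd g) :
    m (fun x => f x - g x) = m f - m g := by
  simp only [sub_eq_add_neg]
  rw [hm.add hf hg.neg, hm.neg hg]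

theorem div (hm : IsMean m) (hf : Bdd f) (c : ℝ) : m (fun x => f x / c) = m f / c := by
  have := hm.smul c⁻¹ hf
  simp only [div_eq_inv_mul]; exact this

theorem mono (hm : IsMean m) (hf : Bdd f) (hg : Bdd g) (h : ∀ x, f x ≤ g x) : m f ≤ m g := by
  have := hm.nonneg (hg.sub hf) (fun x => sub_nonneg.2 (h x))
  rw [hm.sub hg hf] at this
  linarith

theorem le_const (hm : IsMean m) (hf : Bdd f) {C : ℝ} (h : ∀ x, f x ≤ C) : m f ≤ C := by
  have := hm.mono hf (Bdd.const C) h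
  rwa [hm.const] at this

theorem const_le (hm : IsMean m) (hf : Bdd f) {C : ℝ} (h : ∀ x, C ≤ f x) : C ≤ m f := by
  have := hm.mono (Bdd.const C) hf h
  rwa [hm.const] at this

theorem abs_le (hm : IsMean m) {C : ℝ} (h : ∀ x, |f x| ≤ C) : |m f| ≤ C := by
  have hf : Bdd f := ⟨C, h⟩
  rw [_root_.abs_le]
  exact ⟨hm.const_le hf fun x => (_root_.abs_le.1 (h x)).1,
    hm.le_const hf fun x => (_root_.abs_le.1 (h x)).2⟩

theorem abs_le_abs (hm : IsMean m) (hf : Bdd f) : |m f| ≤ m (fun x => |f x|) := by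
  rw [_root_.abs_le]
  constructor
  · rw [neg_le, ← hm.neg hf]
    exact hm.mono hf.neg hf.abs fun x => neg_le_abs _
  · exact hm.mono hf hf.abs fun x => le_abs_self _

theorem sum (hm : IsMean m) {ι : Type*} {s : Finset ι} {F : ι → α → ℝ}
    (h : ∀ i ∈ s, Bdd (F i)) : m (fun x => ∑ i ∈ s, F i x) = ∑ i ∈ s, m (F i) := by
  classical
  induction s using Finset.induction_on with
  | empty => simpa using hm.const 0
  | insert a s ha ih =>
    simp only [Finset.sum_insert ha]
    rw [hm.add (h a (by simp)) (Bdd.sum fun i hi => h i (by simp [hi])),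
      ih fun i hi => h i (by simp [hi])]

theorem sub_abs_le (hm : IsMean m) (hf : Bdd f) (hg : Bdd g) {C : ℝ}
    (h : ∀ x, |f x - g x| ≤ C) : |m f - m g| ≤ C := by
  rw [← hm.sub hf hg]; exact hm.abs_le h

theorem sub_abs_le_mean (hm : IsMean m) (hf : Bdd f) (hg : Bdd g) {e : α → ℝ} (he : Bdd e)
    (h : ∀ x, |f x - g x| ≤ e x) : |m f - m g| ≤ m e := by
  rw [← hm.sub hf hg]
  exact (hm.abs_le_abs (hf.sub hg)).trans (hm.mono (hf.sub hg).abs he h)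

theorem cauchy (hm : IsMean m) (hf : Bdd f) (hg : Bdd g) :
    m (fun x => f x * g x) ^ 2 ≤ m (fun x => f x ^ 2) * m (fun x => g x ^ 2) := by
  have key : ∀ t : ℝ, 0 ≤ m (fun x => f x ^ 2) * (t * t) + (2 * m (fun x => f x * g x)) * t
      + m (fun x => g x ^ 2) := by
    intro t
    have h0 := hm.nonneg (((hf.cmul t).add hg).sq) (fun x => sq_nonneg _)
    have e : (fun x => (t * f x + g x) ^ 2)
        = fun x => (t * t) * f x ^ 2 + ((2 * t) * (f x * g x) + g x ^ 2) := by
      funext x; ring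
    rw [e, hm.add (hf.sq.cmul _) (((hf.mul hg).cmul _).add hg.sq), hm.smul _ hf.sq,
      hm.add ((hf.mul hg).cmul _) hg.sq, hm.smul _ (hf.mul hg)] at h0
    linarith
  have := discrim_le_zero key
  unfold discrim at this
  nlinarith

theorem bind {k : α → (β → ℝ) → ℝ} (hm : IsMean m) (hk : ∀ a, IsMean (k a)) :
    IsMean (fun G => m (fun a => k a G)) where
  add {f g} hf hg := by
    have hb : ∀ {f : β → ℝ}, Bdd f → Bdd (fun a => k a f) := by
      rintro f ⟨C, hC⟩; exact ⟨C, fun a => (hk a).abs_le hC⟩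
    rw [← hm.add (hb hf) (hb hg)]
    congr 1; funext a; exact (hk a).add hf hg
  smul c f hf := by
    have hb : ∀ {f : β → ℝ}, Bdd f → Bdd (fun a => k a f) := by
      rintro f ⟨C, hC⟩; exact ⟨C, fun a => (hk a).abs_le hC⟩
    rw [← hm.smul c (hb hf)]
    congr 1; funext a; exact (hk a).smul c hf
  nonneg {f} hf h := by
    refine hm.nonneg ?_ fun a => (hk a).nonneg hf h
    obtain ⟨C, hC⟩ := hf; exact ⟨C, fun a => (hk a).abs_le hC⟩
  one := by
    have : (fun a => k a (fun _ => 1)) = fun _ => 1 := by funext a; exact (hk a).one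
    show m (fun a => k a (fun _ => 1)) = 1
    rw [this, hm.one]

theorem map (hm : IsMean m) (p : α → β) : IsMean (fun G : β → ℝ => m (fun a => G (p a))) where
  add hf hg := hm.add (hf.comp p) (hg.comp p)
  smul c _ hf := hm.smul c (hf.comp p)
  nonneg hf h := hm.nonneg (hf.comp p) fun _ => h _
  one := hm.one

theorem _root_.P13.Bdd.bindr {γ : Type*} {k : α → (β → ℝ) → ℝ} (hk : ∀ a, IsMean (k a))
    {F : γ → β → ℝ} (p : γ → α)
    (hF : Bdd (fun q : γ × β => F q.1 q.2)) : Bdd (fun a => k (p a) (F a)) := by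
  obtain ⟨C, hC⟩ := hF
  exact ⟨C, fun a => (hk _).abs_le fun b => hC (a, b)⟩

/-- fibrewise version of `bind` -/
theorem bind_pair {k : α → (β → ℝ) → ℝ} (hm : IsMean m) (hk : ∀ a, IsMean (k a)) :
    IsMean (fun G : α × β → ℝ => m (fun a => k a (fun b => G (a, b)))) := by
  have := hm.bind (k := fun a (G : α × β → ℝ) => k a (fun b => G (a, b)))
    (fun a => (hk a).map (fun b => (a, b)))
  exact this

end IsMean

/-! ultrafilter limits -/

/-- limit along an ultrafilter -/
noncomputable def ulim {ι : Type*} (U : Ultrafilter ι) (a : ι → ℝ) : ℝ :=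
  limUnder (U : Filter ι) a

theorem ulim_tendsto {ι : Type*} (U : Ultrafilter ι) {a : ι → ℝ} (ha : Bdd a) :
    Tendsto a U (nhds (ulim U a)) := by
  obtain ⟨C, hC⟩ := ha
  have h : ((U.map a : Ultrafilter ℝ) : Filter ℝ) ≤ 𝓟 (Set.Icc (-C) C) := by
    rw [Ultrafilter.coe_map, le_principal_iff, Filter.mem_map]
    exact Filter.univ_mem' fun x => abs_le.1 (hC x)
  obtain ⟨x, _, hx⟩ := isCompact_Icc.ultrafilter_le_nhds _ h
  exact tendsto_nhds_limUnder ⟨x, hx⟩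

theorem ulim_eq {ι : Type*} (U : Ultrafilter ι) {a : ι → ℝ} {L : ℝ}
    (h : Tendsto a U (nhds L)) : ulim U a = L := h.limUnder_eq

theorem ulim_isMean {ι : Type*} (U : Ultrafilter ι) : IsMean (ulim U) where
  add hf hg := ulim_eq U ((ulim_tendsto U hf).add (ulim_tendsto U hg))
  smul c _ hf := ulim_eq U ((ulim_tendsto U hf).const_mul c)
  nonneg hf h := ge_of_tendsto' (ulim_tendsto U hf) h
  one := ulim_eq U tendsto_const_nhds

/-- if all ultrafilter limits coincide, a bounded function converges -/
theorem tendsto_of_ulim {ι : Type*} {l : Filter ι} {a : ι → ℝ} {L : ℝ}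
    (ha : Bdd a) (h : ∀ U : Ultrafilter ι, (U : Filter ι) ≤ l → ulim U a = L) :
    Tendsto a l (nhds L) := by
  rw [tendsto_iff_ultrafilter]
  intro U hU
  have := ulim_tendsto U ha
  rwa [h U hU] at this

/-! weights -/

/-- finite nonempty weights -/
def Wt (E : Type*) := {l : List E // l ≠ []}

/-- average over a weight -/
noncomputable def avg {E : Type*} (w : Wt E) (g : E → ℝ) : ℝ := (w.1.map g).sum / w.1.length

theorem Wt.len_pos {E : Type*} (w : Wt E) : (0 : ℝ) < w.1.length := by
  have := List.length_pos_iff.2 w.2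
  exact_mod_cast this

theorem list_sum_add {E : Type*} (l : List E) (f g : E → ℝ) :
    (l.map (fun x => f x + g x)).sum = (l.map f).sum + (l.map g).sum := by
  induction l with
  | nil => simp
  | cons a l ih => simp only [List.map_cons, List.sum_cons, ih]; ring

theorem list_sum_mul {E : Type*} (l : List E) (c : ℝ) (f : E → ℝ) :
    (l.map (fun x => c * f x)).sum = c * (l.map f).sum := by
  induction l with
  | nil => simp
  | cons a l ih => simp only [List.map_cons, List.sum_cons, ih]; ring

theorem avg_isMean {E : Type*} (w : Wt E) : IsMean (avg w) where
  add {f g} _ _ := by unfold avg; rw [list_sum_add, add_div]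
  smul c f _ := by unfold avg; rw [list_sum_mul, mul_div_assoc]
  nonneg {f} _ h := by
    refine div_nonneg (List.sum_nonneg ?_) w.len_pos.le
    intro x hx
    obtain ⟨a, _, rfl⟩ := List.mem_map.1 hx
    exact h a
  one := by
    unfold avg
    simp only [List.map_const', List.sum_replicate, nsmul_eq_mul, mul_one]
    exact div_self w.len_pos.ne'

theorem avg_add {E : Type*} (w : Wt E) (f g : E → ℝ) :
    avg w (fun x => f x + g x) = avg w f + avg w g := by
  unfold avg; rw [list_sum_add, add_div]

theorem avg_smul {E : Type*} (w : Wt E) (c : ℝ) (f : E → ℝ) :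
    avg w (fun x => c * f x) = c * avg w f := by
  unfold avg; rw [list_sum_mul, mul_div_assoc]

theorem avg_smul_right {E : Type*} (w : Wt E) (c : ℝ) (f : E → ℝ) :
    avg w (fun x => f x * c) = avg w f * c := by
  simp only [mul_comm _ c]; exact avg_smul w c f

theorem avg_sub {E : Type*} (w : Wt E) (f g : E → ℝ) :
    avg w (fun x => f x - g x) = avg w f - avg w g := by
  have h1 := avg_add w f (fun x => (-1) * g x)
  rw [avg_smul] at h1
  simp only [sub_eq_add_neg]
  convert h1 using 3 <;> ring

theorem list_comm_mean {E α : Type*} {m : (α → ℝ) → ℝ} (hm : IsMean m) (l : List E)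
    {F : E → α → ℝ} (hF : ∀ u, Bdd (F u)) :
    Bdd (fun a => (l.map (fun u => F u a)).sum) ∧
    m (fun a => (l.map (fun u => F u a)).sum) = (l.map (fun u => m (F u))).sum := by
  induction l with
  | nil => simpa using ⟨Bdd.const 0, hm.const 0⟩
  | cons b l ih =>
    simp only [List.map_cons, List.sum_cons]
    exact ⟨(hF b).add ih.1, by rw [hm.add (hF b) ih.1, ih.2]⟩

theorem Bdd.avg {E α : Type*} (w : Wt E) {F : E → α → ℝ} (hF : ∀ u, Bdd (F u)) :
    Bdd (fun a => avg w (fun u => F u a)) := by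
  unfold P13.avg
  refine Bdd.div_const ?_ _
  induction w.1 with
  | nil => simpa using Bdd.const 0
  | cons b l ih =>
    simp only [List.map_cons, List.sum_cons]
    exact (hF b).add ih

theorem avg_comm_mean {E α : Type*} {m : (α → ℝ) → ℝ} (hm : IsMean m) (w : Wt E)
    {F : E → α → ℝ} (hF : ∀ u, Bdd (F u)) :
    m (fun a => avg w (fun u => F u a)) = avg w (fun u => m (F u)) := by
  have := list_comm_mean hm w.1 hF
  unfold avg
  rw [hm.div this.1, this.2]

theorem avg_abs_le {E : Type*} (w : Wt E) {g : E → ℝ} {C : ℝ} (h : ∀ x, |g x| ≤ C) :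
    |avg w g| ≤ C := (avg_isMean w).abs_le h

/-- convolution of weights (general form) -/
def Wt.pairMap {E E' F : Type*} (w : Wt E) (w' : Wt E') (p : E → E' → F) : Wt F :=
  ⟨w.1.flatMap (fun x => w'.1.map (fun y => p x y)), by
    obtain ⟨l, hl⟩ := w
    obtain ⟨l', hl'⟩ := w'
    cases l with
    | nil => exact absurd rfl hl
    | cons a l => cases l' with
      | nil => exact absurd rfl hl'
      | cons b l' => simp⟩

theorem avg_pairMap {E E' F : Type*} (w : Wt E) (w' : Wt E') (p : E → E' → F) (g : F → ℝ) :
    avg (w.pairMap w' p) g = avg w (fun x => avg w' (fun y => g (p x y))) := by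
  unfold avg Wt.pairMap
  have hlen : ∀ l : List E, (l.flatMap (fun x => w'.1.map (fun y => p x y))).length
      = l.length * w'.1.length := by
    intro l; simp [List.length_flatMap]
  have hsum : ∀ l : List E, ((l.flatMap (fun x => w'.1.map (fun y => p x y))).map g).sum
      = (l.map (fun x => (w'.1.map (fun y => g (p x y))).sum)).sum := by
    intro l
    induction l with
    | nil => simp
    | cons a l ih =>
      simp only [List.flatMap_cons, List.map_append, List.sum_append, ih, List.map_cons,
        List.sum_cons, List.map_map]
      rfl
  have hdiv : ∀ l : List E, (l.map (fun x => (w'.1.map (fun y => g (p x y))).sum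
      / (w'.1.length : ℝ))).sum
      = (l.map (fun x => (w'.1.map (fun y => g (p x y))).sum)).sum / (w'.1.length : ℝ) := by
    intro l
    simp only [div_eq_inv_mul]
    rw [list_sum_mul]
  simp only
  rw [hlen, hsum, hdiv]
  push_cast
  rw [div_div, mul_comm]

/-- pushforward of a weight -/
def Wt.map {E F : Type*} (w : Wt E) (p : E → F) : Wt F :=
  ⟨w.1.map p, by simpa using w.2⟩

theorem avg_map {E F : Type*} (w : Wt E) (p : E → F) (g : F → ℝ) :
    avg (w.map p) g = avg w (fun x => g (p x)) := by
  unfold avg Wt.map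
  simp [List.map_map, Function.comp_def]

/-- a canonical invariant mean -/
noncomputable def invMean {E : Type*} (U : Ultrafilter (Wt E)) : (E → ℝ) → ℝ := fun g =>
  ulim U (fun w => avg w g)

theorem invMean_isMean {E : Type*} (U : Ultrafilter (Wt E)) : IsMean (invMean U) :=
  (ulim_isMean U).bind fun w => avg_isMean w

theorem Bdd.avgw {E : Type*} {g : E → ℝ} (hg : Bdd g) : Bdd (fun w : Wt E => P13.avg w g) := by
  obtain ⟨C, hC⟩ := hg
  exact ⟨C, fun w => avg_abs_le w hC⟩

/-! Folner filter -/
section folner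
variable {E : Type*} [AddCommGroup E]

/-- `w` is `ε`-invariant under translation by `a` -/
def Inv (w : Wt E) (a : E) (ε : ℝ) : Prop :=
  ∀ g : E → ℝ, (∀ x, |g x| ≤ 1) → |avg w (fun x => g (x + a)) - avg w g| ≤ ε

/-- optimal invariance error -/
noncomputable def invErr (w : Wt E) (a : E) : ℝ :=
  ⨆ g : {g : E → ℝ // ∀ x, |g x| ≤ 1}, |avg w (fun x => g.1 (x + a)) - avg w g.1|

theorem invErr_bddAbove (w : Wt E) (a : E) : BddAbove (Set.range
    fun g : {g : E → ℝ // ∀ x, |g x| ≤ 1} => |avg w (fun x => g.1 (x + a)) - avg w g.1|) := by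
  refine ⟨1 + 1, ?_⟩
  rintro _ ⟨g, rfl⟩
  exact (abs_sub _ _).trans (add_le_add (avg_abs_le w fun x => g.2 _) (avg_abs_le w fun x => g.2 _))

theorem inv_invErr (w : Wt E) (a : E) : Inv w a (invErr w a) := fun g hg =>
  le_ciSup (invErr_bddAbove w a) ⟨g, hg⟩

theorem invErr_le {w : Wt E} {a : E} {ε : ℝ} (h : Inv w a ε) : invErr w a ≤ ε := by
  have : Nonempty {g : E → ℝ // ∀ x, |g x| ≤ 1} := ⟨⟨fun _ => 0, by simp⟩⟩
  exact ciSup_le fun g => h g.1 g.2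

theorem invErr_nonneg (w : Wt E) (a : E) : 0 ≤ invErr w a :=
  (abs_nonneg _).trans (inv_invErr w a (fun _ => 0) (by simp))

theorem invErr_le_two (w : Wt E) (a : E) : invErr w a ≤ 1 + 1 := invErr_le fun _ hg =>
  (abs_sub _ _).trans (add_le_add (avg_abs_le w fun _ => hg _) (avg_abs_le w fun _ => hg _))

theorem invErr_bdd (a : E) : Bdd (fun w : Wt E => invErr w a) :=
  ⟨1 + 1, fun w => by rw [abs_of_nonneg (invErr_nonneg w a)]; exact invErr_le_two w a⟩

theorem invErr_bound (w : Wt E) (a : E) {g : E → ℝ} {C : ℝ} (hC : 0 < C) (hg : ∀ x, |g x| ≤ C) :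
    |avg w (fun x => g (x + a)) - avg w g| ≤ C * invErr w a := by
  have h := inv_invErr w a (fun x => C⁻¹ * g x) (fun x => by
    rw [abs_mul, abs_of_pos (inv_pos.2 hC), inv_mul_le_iff₀ hC]; simpa using hg x)
  rw [avg_smul, avg_smul, ← mul_sub, abs_mul, abs_of_pos (inv_pos.2 hC), inv_mul_le_iff₀ hC] at h
  exact h

theorem Inv.pair_left {w : Wt E} {a : E} {ε : ℝ} (h : Inv w a ε) (w' : Wt E) :
    Inv (w.pairMap w' (· + ·)) a ε := by
  intro g hg
  rw [avg_pairMap, avg_pairMap]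
  have := h (fun x => avg w' (fun y => g (x + y))) (fun x => avg_abs_le _ fun _ => hg _)
  simpa only [add_right_comm _ a] using this

theorem Inv.pair_right {w : Wt E} {a : E} {ε : ℝ} (h : Inv w a ε) (w' : Wt E) :
    Inv (w'.pairMap w (· + ·)) a ε := by
  intro g hg
  rw [avg_pairMap, avg_pairMap, ← avg_sub]
  refine avg_abs_le _ fun x => ?_
  have := h (fun y => g (x + y)) (fun y => hg _)
  simpa only [← add_assoc] using this

theorem Inv.mono {w : Wt E} {a : E} {ε ε' : ℝ} (h : Inv w a ε) (h' : ε ≤ ε') : Inv w a ε' :=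
  fun g hg => (h g hg).trans h'

/-- progression weight -/
def prog (a : E) (N : ℕ) : Wt E := ⟨(List.range (N + 1)).map (fun n => n • a), by simp⟩

theorem inv_prog (a : E) (N : ℕ) : Inv (prog a N) a (2 / (N + 1)) := by
  intro g hg
  have hs : ∀ M : ℕ, ((List.range M).map (fun n => g (n • a + a))).sum
      - ((List.range M).map (fun n => g (n • a))).sum = g (M • a) - g 0 := by
    intro M
    induction M with
    | zero => simp
    | succ M ih =>
      rw [List.range_succ]
      simp only [List.map_append, List.sum_append, List.map_cons, List.map_nil, List.sum_cons,
        List.sum_nil, succ_nsmul]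
      linarith
  have e : avg (prog a N) (fun x => g (x + a)) - avg (prog a N) g
      = (g ((N + 1) • a) - g 0) / (N + 1) := by
    unfold avg prog
    simp only [List.map_map, Function.comp_def, List.length_map, List.length_range]
    rw [← sub_div, hs]; push_cast; rfl
  rw [e, abs_div, abs_of_pos (by positivity : (0 : ℝ) < N + 1)]
  gcongr
  exact (abs_sub _ _).trans (by linarith [hg ((N + 1) • a), hg 0])

theorem exists_inv (F : Finset E) {ε : ℝ} (hε : 0 < ε) : ∃ w : Wt E, ∀ a ∈ F, Inv w a ε := by
  classical
  obtain ⟨N, hN⟩ := exists_nat_gt (2 / ε)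
  have hN' : 2 / ((N : ℝ) + 1) ≤ ε := by
    rw [div_le_iff₀ (by positivity)]
    rw [div_lt_iff₀ hε] at hN
    nlinarith
  induction F using Finset.induction_on with
  | empty => exact ⟨prog 0 0, by simp⟩
  | insert a s ha ih =>
    obtain ⟨w, hw⟩ := ih
    refine ⟨w.pairMap (prog a N) (· + ·), fun b hb => ?_⟩
    rcases Finset.mem_insert.1 hb with rfl | hb
    · exact ((inv_prog b N).pair_right w).mono hN'
    · exact (hw b hb).pair_left _

/-- Folner filter -/
def FF (E : Type*) [AddCommGroup E] : Filter (Wt E) :=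
  ⨅ p : Finset E × {ε : ℝ // 0 < ε}, 𝓟 {w | ∀ a ∈ p.1, Inv w a p.2.1}

theorem FF_basis : (FF E).HasBasis (fun _ : Finset E × {ε : ℝ // 0 < ε} => True)
    (fun p => {w | ∀ a ∈ p.1, Inv w a p.2.1}) := by
  classical
  have : Nonempty {ε : ℝ // 0 < ε} := ⟨⟨1, one_pos⟩⟩
  refine hasBasis_iInf_principal ?_
  intro p q
  refine ⟨(p.1 ∪ q.1, ⟨min p.2.1 q.2.1, lt_min p.2.2 q.2.2⟩), ?_, ?_⟩
  · intro w hw a ha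
    exact (hw a (Finset.mem_union_left _ ha)).mono (min_le_left _ _)
  · intro w hw a ha
    exact (hw a (Finset.mem_union_right _ ha)).mono (min_le_right _ _)

instance FF_neBot : (FF E).NeBot := by
  rw [FF_basis.neBot_iff]
  rintro ⟨F, ε⟩ _
  exact exists_inv F ε.2

theorem FF_invErr (a : E) : Tendsto (fun w : Wt E => invErr w a) (FF E) (nhds 0) := by
  rw [Metric.tendsto_nhds]
  intro ε hε
  refine FF_basis.eventually_iff.2 ⟨({a}, ⟨ε / 2, half_pos hε⟩), trivial, ?_⟩
  intro w hw
  have := invErr_le (hw a (by simp))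
  simp only [Real.dist_eq, sub_zero, abs_of_nonneg (invErr_nonneg w a)]
  simp only at this
  linarith

/-- translation-invariant functional -/
def TInv (m : (E → ℝ) → ℝ) : Prop := ∀ f, Bdd f → ∀ a, m (fun x => f (x + a)) = m f

theorem invMean_inv (U : Ultrafilter (Wt E)) (hU : (U : Filter (Wt E)) ≤ FF E) :
    TInv (invMean U) := by
  intro f hf a
  obtain ⟨C, hC0, hC⟩ := hf.exists_pos
  have h1 : Tendsto (fun w => avg w (fun x => f (x + a)) - avg w f) U (nhds 0) := by
    have h2 : Tendsto (fun w : Wt E => C * invErr w a) U (nhds 0) := by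
      simpa using ((FF_invErr a).mono_left hU).const_mul C
    exact squeeze_zero_norm (fun w => by
      rw [Real.norm_eq_abs]; exact invErr_bound w a hC0 hC) h2
  have h3 := (ulim_isMean U).sub (hf.comp (· + a)).avgw hf.avgw
  rw [ulim_eq U h1] at h3
  show ulim U _ = ulim U _
  linarith

theorem exists_invMean (E : Type*) [AddCommGroup E] :
    ∃ m : (E → ℝ) → ℝ, IsMean m ∧ TInv m :=
  ⟨invMean (Ultrafilter.of (FF E)), invMean_isMean _, invMean_inv _ (Ultrafilter.of_le _)⟩

/-- uniform mean value -/
def MU (Ψ : E → ℝ) (L : ℝ) : Prop :=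
  ∀ ε > 0, ∃ w : Wt E, ∀ s, |avg w (fun u => Ψ (s + u)) - L| ≤ ε

theorem MU_of_tendsto {Ψ : E → ℝ} {L : ℝ}
    (h : Tendsto (fun w => avg w Ψ) (FF E) (nhds L)) : MU Ψ L := by
  intro ε hε
  by_contra hcon
  push Not at hcon
  choose s hs using hcon
  have ht : Tendsto (fun w : Wt E => w.map (fun u => s w + u)) (FF E) (FF E) := by
    refine FF_basis.tendsto_iff FF_basis |>.2 fun p _ => ⟨p, trivial, fun w hw a ha => ?_⟩
    intro g hg
    rw [avg_map, avg_map]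
    have := hw a ha (fun x => g (s w + x)) (fun x => hg _)
    simpa only [add_assoc] using this
  have h2 := h.comp ht
  rw [Metric.tendsto_nhds] at h2
  obtain ⟨w, hw⟩ := (h2 ε hε).exists
  have := hs w
  simp only [Function.comp, avg_map, Real.dist_eq] at hw
  linarith

theorem MU.mean {Ψ : E → ℝ} {L : ℝ} (h : MU Ψ L) (hb : Bdd Ψ) {m : (E → ℝ) → ℝ}
    (hm : IsMean m) (hi : ∀ a, m (fun x => Ψ (x + a)) = m Ψ) : m Ψ = L := by
  refine eq_of_forall_dist_le fun ε hε => ?_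
  obtain ⟨w, hw⟩ := h ε hε
  have h1 : m (fun s => avg w (fun u => Ψ (s + u))) = m Ψ := by
    rw [avg_comm_mean hm w (F := fun u s => Ψ (s + u)) (fun u => hb.comp (· + u))]
    simp only [hi]
    exact (avg_isMean w).const _
  rw [Real.dist_eq, ← h1]
  have := hm.sub_abs_le (Bdd.avg w (F := fun u s => Ψ (s + u)) (fun u => hb.comp (· + u)))
    (Bdd.const L) hw
  rwa [hm.const] at this

end folner

end P13


set_option linter.unusedVariables false
set_option linter.unusedSectionVars false

namespace P13

universe u

/-- an abelian group action preserving a mean -/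
structure Sys (G : Type) [AddCommGroup G] (Ω : Type u) where
  φ : (Ω → ℝ) → ℝ
  mean : IsMean φ
  S : G → Ω → Ω
  S_zero : ∀ ω, S 0 ω = ω
  S_add : ∀ a b ω, S (a + b) ω = S a (S b ω)
  inv : ∀ F, Bdd F → ∀ g, φ (fun ω => F (S g ω)) = φ F

section B
variable {G : Type} [AddCommGroup G] {E : Type} [AddCommGroup E] {ι : Type} (γ : ι → E →+ G)

/-- extension of systems -/
structure IsExt {Ω' Ω : Type u} (Y' : Sys G Ω') (Y : Sys G Ω) (π : Ω' → Ω) : Prop where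
  mean : ∀ F, Bdd F → Y'.φ (fun ω => F (π ω)) = Y.φ F
  equiv : ∀ g ω, π (Y'.S g ω) = Y.S g (π ω)

theorem IsExt.comp {Ω'' Ω' Ω : Type u} {Y'' : Sys G Ω''} {Y' : Sys G Ω'} {Y : Sys G Ω}
    {π' : Ω'' → Ω'} {π : Ω' → Ω} (h' : IsExt Y'' Y' π') (h : IsExt Y' Y π) :
    IsExt Y'' Y (fun ω => π (π' ω)) where
  mean F hF := by rw [h'.mean (fun ω => F (π ω)) (hF.comp π), h.mean F hF]
  equiv g ω := by rw [h'.equiv, h.equiv]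

/-- correlation integrand -/
def pr {Ω : Type u} (Y : Sys G Ω) (I : Finset ι) (f : ι → Ω → ℝ) (s : E) (ω : Ω) : ℝ :=
  ∏ i ∈ I, f i (Y.S (γ i s) ω)

theorem pr_bdd {Ω : Type u} (Y : Sys G Ω) (I : Finset ι) {f : ι → Ω → ℝ} (hf : ∀ i, Bdd (f i)) :
    ∃ C, 0 < C ∧ ∀ s ω, |pr γ Y I f s ω| ≤ C := by
  choose C hC0 hC using fun i => (hf i).exists_pos
  refine ⟨∏ i ∈ I, C i, Finset.prod_pos fun i _ => hC0 i, fun s ω => ?_⟩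
  unfold pr
  rw [Finset.abs_prod]
  exact Finset.prod_le_prod (fun _ _ => abs_nonneg _) fun i _ => hC i _

theorem pr_Bdd {Ω : Type u} (Y : Sys G Ω) (I : Finset ι) {f : ι → Ω → ℝ} (hf : ∀ i, Bdd (f i))
    (s : E) : Bdd (pr γ Y I f s) := by
  obtain ⟨C, _, hC⟩ := pr_bdd γ Y I hf
  exact ⟨C, hC s⟩

/-- correlation function -/
def corr {Ω : Type u} (Y : Sys G Ω) (I : Finset ι) (f0 : Ω → ℝ) (f : ι → Ω → ℝ) (s : E) : ℝ :=
  Y.φ (fun ω => f0 ω * pr γ Y I f s ω)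

theorem corr_Bdd {Ω : Type u} (Y : Sys G Ω) (I : Finset ι) {f0 : Ω → ℝ} {f : ι → Ω → ℝ}
    (h0 : Bdd f0) (hf : ∀ i, Bdd (f i)) : Bdd (corr γ Y I f0 f) := by
  obtain ⟨C, hC0, hC⟩ := pr_bdd γ Y I hf
  obtain ⟨D, hD0, hD⟩ := h0.exists_pos
  refine ⟨D * C, fun s => Y.mean.abs_le fun ω => ?_⟩
  rw [abs_mul]
  exact mul_le_mul (hD _) (hC _ _) (abs_nonneg _) hD0.le

/-- convergence of averages of the correlation with a distinguished function -/
def corr1 {Ω : Type u} (Y : Sys G Ω) (I : Finset ι) (a : ι) (f0 : Ω → ℝ) (f : ι → Ω → ℝ)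
    (D : Ω → ℝ) (s : E) : ℝ :=
  Y.φ (fun ω => f0 ω * pr γ Y I f s ω * D (Y.S (γ a s) ω))

theorem corr1_bound {Ω : Type u} (Y : Sys G Ω) (I : Finset ι) (a : ι) {f0 : Ω → ℝ}
    {f : ι → Ω → ℝ} {D : Ω → ℝ} (h0 : Bdd f0) (hf : ∀ i, Bdd (f i)) (hD : Bdd D) :
    Bdd (corr1 γ Y I a f0 f D) := by
  obtain ⟨C, hC0, hC⟩ := pr_bdd γ Y I hf
  obtain ⟨D0, hD0, hD0'⟩ := h0.exists_pos
  obtain ⟨D1, hD1, hD1'⟩ := hD.exists_pos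
  refine ⟨D0 * C * D1, fun s => Y.mean.abs_le fun ω => ?_⟩
  rw [abs_mul, abs_mul]
  exact mul_le_mul (mul_le_mul (hD0' _) (hC _ _) (abs_nonneg _) hD0.le) (hD1' _) (abs_nonneg _)
    (by positivity)

def Good (I : Finset ι) (a : ι) {Ω' : Type u} (Y' : Sys G Ω') (D : Ω' → ℝ) : Prop :=
  Bdd D ∧ ∀ (Ω'' : Type u) (Y'' : Sys G Ω'') (π : Ω'' → Ω'), IsExt Y'' Y' π →
    ∀ (f0 : Ω'' → ℝ) (f : ι → Ω'' → ℝ), Bdd f0 → (∀ i, Bdd (f i)) →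
    ∃ L, Tendsto (fun w => avg w (corr1 γ Y'' I a f0 f (fun ω => D (π ω)))) (FF E) (nhds L)

theorem corr1_add {Ω : Type u} (Y : Sys G Ω) (I : Finset ι) (a : ι) {f0 : Ω → ℝ}
    {f : ι → Ω → ℝ} {D D' : Ω → ℝ} (h0 : Bdd f0) (hf : ∀ i, Bdd (f i)) (hD : Bdd D)
    (hD' : Bdd D') (t : ℝ) (s : E) :
    corr1 γ Y I a f0 f (fun ω => D ω + t * D' ω) s
      = corr1 γ Y I a f0 f D s + t * corr1 γ Y I a f0 f D' s := by
  unfold corr1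
  have hb := h0.mul (pr_Bdd γ Y I hf s)
  rw [← Y.mean.smul t (hb.mul (hD'.comp _)),
    ← Y.mean.add (hb.mul (hD.comp _)) ((hb.mul (hD'.comp _)).cmul t)]
  congr 1; funext ω; ring

theorem Good.add {I : Finset ι} {a : ι} {Ω' : Type u} {Y' : Sys G Ω'} {D D' : Ω' → ℝ}
    (h : Good γ I a Y' D) (h' : Good γ I a Y' D') (t : ℝ) :
    Good γ I a Y' (fun ω => D ω + t * D' ω) := by
  refine ⟨h.1.add (h'.1.cmul t), fun Ω'' Y'' π hπ f0 f h0 hf => ?_⟩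
  obtain ⟨L, hL⟩ := h.2 Ω'' Y'' π hπ f0 f h0 hf
  obtain ⟨L', hL'⟩ := h'.2 Ω'' Y'' π hπ f0 f h0 hf
  refine ⟨L + t * L', (hL.add (hL'.const_mul t)).congr fun w => ?_⟩
  rw [← avg_smul, ← avg_add]
  congr 1; funext s
  exact (corr1_add γ Y'' I a h0 hf (h.1.comp π) (h'.1.comp π) t s).symm

theorem Good.zero (I : Finset ι) (a : ι) {Ω' : Type u} (Y' : Sys G Ω') :
    Good γ I a Y' (fun _ => 0) := by
  refine ⟨Bdd.const 0, fun Ω'' Y'' π hπ f0 f h0 hf => ⟨0, ?_⟩⟩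
  have : (fun w : Wt E => avg w (corr1 γ Y'' I a f0 f (fun ω => 0))) = fun _ => 0 := by
    funext w
    have : corr1 γ Y'' I a f0 f (fun ω => 0) = fun _ => 0 := by
      funext s; unfold corr1
      simp only [mul_zero]; exact Y''.mean.const 0
    rw [this, (avg_isMean w).const]
  rw [this]; exact tendsto_const_nhds

theorem Good.lift {I : Finset ι} {a : ι} {Ω' Ω : Type u} {Y' : Sys G Ω'} {Y : Sys G Ω}
    {π : Ω' → Ω} (hπ : IsExt Y' Y π) {D : Ω → ℝ} (h : Good γ I a Y D) :
    Good γ I a Y' (fun ω => D (π ω)) :=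
  ⟨h.1.comp π, fun Ω'' Y'' π' hπ' f0 f h0 hf => h.2 Ω'' Y'' _ (hπ'.comp hπ) f0 f h0 hf⟩

/-- the system carrying the averaged functions -/
noncomputable def sys2 {Ω : Type u} (Y : Sys G Ω) (U : Ultrafilter (Wt E)) :
    Sys G (Wt E × Ω) where
  φ := fun F => ulim U (fun w => Y.φ (fun ω => F (w, ω)))
  mean := (ulim_isMean U).bind_pair (fun _ => Y.mean)
  S := fun g p => (p.1, Y.S g p.2)
  S_zero := fun p => by simp [Y.S_zero]
  S_add := fun a b p => by simp [Y.S_add]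
  inv := fun F hF g => by
    congr 1; funext w
    exact Y.inv (fun ω => F (w, ω)) (hF.comp _) g

theorem sys2_ext {Ω : Type u} (Y : Sys G Ω) (U : Ultrafilter (Wt E)) :
    IsExt (sys2 Y U) Y Prod.snd where
  mean F _ := ulim_eq U (tendsto_const_nhds)
  equiv _ _ := rfl

/-- fibre integrand of the averaged function -/
noncomputable def hfun {Ω : Type u} (Y : Sys G Ω) (I : Finset ι) (a : ι) (f0 : Ω → ℝ)
    (f : ι → Ω → ℝ) (u : E) (ω : Ω) : ℝ :=
  f0 (Y.S (-(γ a u)) ω) * pr γ Y I f u (Y.S (-(γ a u)) ω)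

/-- the averaged function -/
noncomputable def sigma {Ω : Type u} (Y : Sys G Ω) (I : Finset ι) (a : ι) (f0 : Ω → ℝ)
    (f : ι → Ω → ℝ) (p : Wt E × Ω) : ℝ := avg p.1 (fun u => hfun γ Y I a f0 f u p.2)

theorem hfun_bdd {Ω : Type u} (Y : Sys G Ω) (I : Finset ι) (a : ι) {f0 : Ω → ℝ}
    {f : ι → Ω → ℝ} (h0 : Bdd f0) (hf : ∀ i, Bdd (f i)) :
    ∃ C, 0 < C ∧ ∀ u ω, |hfun γ Y I a f0 f u ω| ≤ C := by
  obtain ⟨C, hC0, hC⟩ := pr_bdd γ Y I hf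
  obtain ⟨D0, hD0, hD0'⟩ := h0.exists_pos
  refine ⟨D0 * C, by positivity, fun u ω => ?_⟩
  unfold hfun
  rw [abs_mul]
  exact mul_le_mul (hD0' _) (hC _ _) (abs_nonneg _) hD0.le

theorem hfun_pair {Ω : Type u} (Y : Sys G Ω) (I : Finset ι) (a : ι) {f0 : Ω → ℝ}
    {f : ι → Ω → ℝ} (h0 : Bdd f0) (hf : ∀ i, Bdd (f i)) {D : Ω → ℝ} (hD : Bdd D) (u : E) :
    corr1 γ Y I a f0 f D u = Y.φ (fun ω => hfun γ Y I a f0 f u ω * D ω) := by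
  unfold corr1
  rw [← Y.inv _ ((h0.mul (pr_Bdd γ Y I hf u)).mul (hD.comp _)) (-(γ a u))]
  congr 1; funext ω
  rw [← Y.S_add (γ a u), add_neg_cancel, Y.S_zero]
  rfl

/-- fibre product system -/
noncomputable def sys3 {Ω : Type u} (Y : Sys G Ω) (v : Ω → Wt E)
    (hv : ∀ g ω, v (Y.S g ω) = v ω) : Sys G (E × Ω) where
  φ := fun F => Y.φ (fun ω => avg (v ω) (fun u => F (u, ω)))
  mean := by
    exact Y.mean.bind (k := fun ω (F : E × Ω → ℝ) => avg (v ω) (fun u => F (u, ω)))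
      (fun ω => (avg_isMean (v ω)).map (fun u => (u, ω)))
  S := fun g p => (p.1, Y.S g p.2)
  S_zero := fun p => by simp [Y.S_zero]
  S_add := fun a b p => by simp [Y.S_add]
  inv := fun F hF g => by
    have hb : Bdd (fun ω => avg (v ω) (fun u => F (u, ω))) := by
      obtain ⟨C, hC⟩ := hF
      exact ⟨C, fun ω => avg_abs_le _ fun u => hC _⟩
    rw [← Y.inv _ hb g]
    simp only [hv]

theorem hfun_shift {Ω : Type u} (Y : Sys G Ω) (I : Finset ι) (a : ι) (f0 : Ω → ℝ)
    (f : ι → Ω → ℝ) (u s : E) (x : Ω) :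
    hfun γ Y I a f0 f (u + s) (Y.S (γ a s) x)
      = f0 (Y.S (-(γ a u)) x) * ∏ i ∈ I, f i (Y.S (γ i u - γ a u) (Y.S (γ i s) x)) := by
  unfold hfun pr
  have e1 : Y.S (-(γ a (u + s))) (Y.S (γ a s) x) = Y.S (-(γ a u)) x := by
    rw [← Y.S_add]; congr 1; rw [map_add]; abel
  rw [e1]
  congr 1
  refine Finset.prod_congr rfl fun i _ => ?_
  rw [← Y.S_add, ← Y.S_add]; congr 2; rw [map_add]; abel

theorem sigma_good {Ω : Type u} (Y : Sys G Ω) (I : Finset ι) (a : ι) {f0 : Ω → ℝ}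
    {f : ι → Ω → ℝ} (h0 : Bdd f0) (hf : ∀ i, Bdd (f i)) (U : Ultrafilter (Wt E))
    (hU : (U : Filter (Wt E)) ≤ FF E)
    (IH : ∀ (Ω : Type u) (Y : Sys G Ω) (f0 : Ω → ℝ) (f : ι → Ω → ℝ), Bdd f0 →
      (∀ i, Bdd (f i)) → ∃ L, Tendsto (fun w => avg w (corr γ Y I f0 f)) (FF E) (nhds L)) :
    Good γ I a (sys2 Y U) (sigma γ Y I a f0 f) := by
  obtain ⟨C, hC0, hC⟩ := hfun_bdd γ Y I a h0 hf
  have hσ : Bdd (sigma γ Y I a f0 f) := ⟨C, fun p => avg_abs_le _ fun u => hC _ _⟩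
  refine ⟨hσ, fun Ω'' Y'' π hπ g0 g hg0 hg => ?_⟩
  have hv : ∀ t ω, (π (Y''.S t ω)).1 = (π ω).1 := fun t ω => by rw [hπ.equiv]; rfl
  have hρ : ∀ t ω, (π (Y''.S t ω)).2 = Y.S t (π ω).2 := fun t ω => by rw [hπ.equiv]; rfl
  obtain ⟨L, hL⟩ := IH (E × Ω'') (sys3 Y'' (fun ω => (π ω).1) hv)
    (fun p => g0 p.2 * f0 (Y.S (-(γ a p.1)) (π p.2).2))
    (fun i p => g i p.2 * f i (Y.S (γ i p.1 - γ a p.1) (π p.2).2))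
    ((hg0.comp _).mul (h0.comp _)) (fun i => ((hg i).comp _).mul ((hf i).comp _))
  refine ⟨L, hL.congr fun w => ?_⟩
  congr 1
  funext s
  -- pointwise identity
  have e1 : corr γ (sys3 Y'' (fun ω => (π ω).1) hv) I
      (fun p => g0 p.2 * f0 (Y.S (-(γ a p.1)) (π p.2).2))
      (fun i p => g i p.2 * f i (Y.S (γ i p.1 - γ a p.1) (π p.2).2)) s
      = Y''.φ (fun ω => g0 ω * pr γ Y'' I g s ω *
          avg (π ω).1 (fun u => hfun γ Y I a f0 f (u + s) (Y.S (γ a s) (π ω).2))) := by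
    show Y''.φ _ = Y''.φ _
    congr 1; funext ω
    rw [← avg_smul]
    congr 1; funext u
    rw [hfun_shift]
    unfold pr
    show g0 ω * f0 _ * ∏ i ∈ I, (g i (Y''.S (γ i s) ω) *
      f i (Y.S (γ i u - γ a u) (π (Y''.S (γ i s) ω)).2)) = _
    rw [Finset.prod_mul_distrib]
    simp only [hρ]
    ring
  have e2 : corr1 γ Y'' I a g0 g (fun ω => sigma γ Y I a f0 f (π ω)) s
      = Y''.φ (fun ω => g0 ω * pr γ Y'' I g s ω *
          avg (π ω).1 (fun u => hfun γ Y I a f0 f u (Y.S (γ a s) (π ω).2))) := by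
    unfold corr1 sigma
    simp only [hv, hρ]
  rw [e1, e2]
  obtain ⟨D, hD0, hD⟩ := (hg0.mul (pr_Bdd γ Y'' I hg s)).exists_pos
  have hz : Y''.φ (fun ω => invErr (π ω).1 s) = 0 := by
    rw [hπ.mean (fun p => invErr p.1 s) ((invErr_bdd s).comp _)]
    show ulim U (fun w => Y.φ (fun ω => invErr w s)) = 0
    simp only [Y.mean.const]
    exact ulim_eq U ((FF_invErr s).mono_left hU)
  have hb1 : Bdd (fun ω => avg (π ω).1 (fun u => hfun γ Y I a f0 f (u + s)
      (Y.S (γ a s) (π ω).2))) := ⟨C, fun ω => avg_abs_le _ fun u => hC _ _⟩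
  have hb2 : Bdd (fun ω => avg (π ω).1 (fun u => hfun γ Y I a f0 f u
      (Y.S (γ a s) (π ω).2))) := ⟨C, fun ω => avg_abs_le _ fun u => hC _ _⟩
  have hbi : Bdd (fun ω => invErr (π ω).1 s) := (invErr_bdd s).comp (fun ω => (π ω).1)
  have hb0 := hg0.mul (pr_Bdd γ Y'' I hg s)
  have key := Y''.mean.sub_abs_le_mean (hb0.mul hb1) (hb0.mul hb2) (hbi.cmul (D * C)) (by
    intro ω
    rw [← mul_sub, abs_mul, mul_assoc]
    have h1 := invErr_bound (π ω).1 s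
      (g := fun u => hfun γ Y I a f0 f u (Y.S (γ a s) (π ω).2)) hC0 (fun u => hC _ _)
    exact mul_le_mul (hD ω) h1 (abs_nonneg _) hD0.le)
  rw [Y''.mean.smul _ hbi, hz, mul_zero] at key
  have := abs_nonpos_iff.1 key
  linarith

theorem thmB_step {Ω : Type u} (Y : Sys G Ω) (I : Finset ι) (a : ι) {f0 : Ω → ℝ}
    {f : ι → Ω → ℝ} {fa : Ω → ℝ} (h0 : Bdd f0) (hf : ∀ i, Bdd (f i)) (hfa : Bdd fa)
    (IH : ∀ (Ω : Type u) (Y : Sys G Ω) (f0 : Ω → ℝ) (f : ι → Ω → ℝ), Bdd f0 →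
      (∀ i, Bdd (f i)) → ∃ L, Tendsto (fun w => avg w (corr γ Y I f0 f)) (FF E) (nhds L)) :
    ∃ L, Tendsto (fun w => avg w (corr1 γ Y I a f0 f fa)) (FF E) (nhds L) := by
  classical
  set V : Set ℝ := {x | ∃ (Ω' : Type u) (Y' : Sys G Ω') (π : Ω' → Ω) (D : Ω' → ℝ),
    IsExt Y' Y π ∧ Good γ I a Y' D ∧ x = Y'.φ (fun ω => (fa (π ω) - D ω) ^ 2)} with hV
  have hVne : V.Nonempty := ⟨_, Ω, Y, id, fun _ => 0, ⟨fun _ _ => rfl, fun _ _ => rfl⟩,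
    Good.zero γ I a Y, rfl⟩
  have hVb : BddBelow V := by
    refine ⟨0, ?_⟩
    rintro x ⟨Ω', Y', π, D, hπ, hD, rfl⟩
    exact Y'.mean.nonneg ((hfa.comp π).sub hD.1).sq fun ω => sq_nonneg _
  set d := sInf V with hd
  obtain ⟨C, hC0, hC⟩ := hfun_bdd γ Y I a h0 hf
  have hcb := corr1_bound γ Y I a h0 hf hfa
  -- approximate limits
  have key : ∀ ε > 0, ∃ L, ∀ U : Ultrafilter (Wt E), (U : Filter (Wt E)) ≤ FF E →
      |ulim U (fun w => avg w (corr1 γ Y I a f0 f fa)) - L| ≤ ε * C := by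
    intro ε hε
    obtain ⟨x, ⟨Ω1, Y1, π, D, hπ, hD, rfl⟩, hx⟩ := Real.lt_sInf_add_pos hVne (sq_pos_of_pos hε)
    rw [← hd] at hx
    have h0' : Bdd (fun ω => f0 (π ω)) := h0.comp π
    have hf' : ∀ i, Bdd (fun ω => f i (π ω)) := fun i => (hf i).comp π
    obtain ⟨L, hL⟩ := hD.2 Ω1 Y1 id ⟨fun _ _ => rfl, fun _ _ => rfl⟩
      (fun ω => f0 (π ω)) (fun i ω => f i (π ω)) h0' hf'
    simp only [id] at hL
    refine ⟨L, fun U hU => ?_⟩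
    set F : Ω1 → ℝ := fun ω => fa (π ω) - D ω with hF
    have hFb : Bdd F := (hfa.comp π).sub hD.1
    have hpr : ∀ s ω, pr γ Y1 I (fun i ω => f i (π ω)) s ω = pr γ Y I f s (π ω) := by
      intro s ω; unfold pr; simp only [hπ.equiv]
    have hhf : ∀ u ω, hfun γ Y1 I a (fun ω => f0 (π ω)) (fun i ω => f i (π ω)) u ω
        = hfun γ Y I a f0 f u (π ω) := by
      intro u ω; unfold hfun; simp only [hpr, hπ.equiv]
    have hdec : ∀ s, corr1 γ Y I a f0 f fa s
        = corr1 γ Y1 I a (fun ω => f0 (π ω)) (fun i ω => f i (π ω)) D s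
        + corr1 γ Y1 I a (fun ω => f0 (π ω)) (fun i ω => f i (π ω)) F s := by
      intro s
      have h2 := corr1_add γ Y1 I a h0' hf' hD.1 hFb 1 s
      rw [one_mul] at h2
      rw [← h2]
      unfold corr1
      rw [← hπ.mean _ ((h0.mul (pr_Bdd γ Y I hf s)).mul (hfa.comp _))]
      congr 1; funext ω
      rw [hpr, hF, ← hπ.equiv]; ring
    have hb1 := corr1_bound γ Y1 I a h0' hf' hD.1
    have hb2 := corr1_bound γ Y1 I a h0' hf' hFb
    have e1 : ulim U (fun w => avg w (corr1 γ Y I a f0 f fa)) - L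
        = ulim U (fun w => avg w (corr1 γ Y1 I a (fun ω => f0 (π ω))
          (fun i ω => f i (π ω)) F)) := by
      have h3 := (ulim_isMean U).add hb1.avgw hb2.avgw
      rw [ulim_eq U (hL.mono_left hU)] at h3
      rw [sub_eq_iff_eq_add', ← h3]
      congr 1; funext w
      rw [← avg_add]; congr 1; funext s; exact hdec s
    rw [e1]
    set σ := sigma γ Y1 I a (fun ω => f0 (π ω)) (fun i ω => f i (π ω)) with hσdef
    have hσC : ∀ p, |σ p| ≤ C := fun p => avg_abs_le _ fun u => by
      simp only [hhf]; exact hC _ _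
    have hσb : Bdd σ := ⟨C, hσC⟩
    have hσg : Good γ I a (sys2 Y1 U) σ := sigma_good γ Y1 I a h0' hf' U hU IH
    have hF2 : Bdd (fun p : Wt E × Ω1 => F p.2) := hFb.comp _
    have e2 : ulim U (fun w => avg w (corr1 γ Y1 I a (fun ω => f0 (π ω))
          (fun i ω => f i (π ω)) F)) = (sys2 Y1 U).φ (fun p => σ p * F p.2) := by
      show _ = ulim U (fun w => Y1.φ (fun ω => σ (w, ω) * F ω))
      congr 1; funext w
      have h4 : ∀ s, corr1 γ Y1 I a (fun ω => f0 (π ω)) (fun i ω => f i (π ω)) F s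
          = Y1.φ (fun ω => hfun γ Y1 I a (fun ω => f0 (π ω)) (fun i ω => f i (π ω)) s ω * F ω) :=
        fun s => hfun_pair γ Y1 I a h0' hf' hFb s
      rw [show corr1 γ Y1 I a (fun ω => f0 (π ω)) (fun i ω => f i (π ω)) F = _ from funext h4]
      rw [← avg_comm_mean Y1.mean w
        (F := fun s ω => hfun γ Y1 I a (fun ω => f0 (π ω)) (fun i ω => f i (π ω)) s ω * F ω)]
      · congr 1; funext ω
        rw [avg_smul_right]; rfl
      · intro s
        exact Bdd.mul ⟨C, fun ω => by rw [hhf]; exact hC _ _⟩ hFb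
    rw [e2]
    set p := (sys2 Y1 U).φ (fun p => σ p * F p.2) with hp
    have hmin : ∀ t : ℝ, d ≤ (sys2 Y1 U).φ (fun q => F q.2 ^ 2) - 2 * t * p + t ^ 2 * C ^ 2 := by
      intro t
      have hext := (sys2_ext Y1 U).comp hπ
      have hg := (hD.lift γ (sys2_ext Y1 U)).add γ hσg t
      have h5 : d ≤ (sys2 Y1 U).φ (fun q => (fa (π q.2) - (D q.2 + t * σ q)) ^ 2) :=
        csInf_le hVb ⟨_, sys2 Y1 U, _, _, hext, hg, rfl⟩
      have h6 : (fun q : Wt E × Ω1 => (fa (π q.2) - (D q.2 + t * σ q)) ^ 2)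
          = fun q => (F q.2 ^ 2 + (-(2 * t)) * (σ q * F q.2)) + t ^ 2 * σ q ^ 2 := by
        funext q; rw [hF]; ring
      have hm := (sys2 Y1 U).mean
      rw [h6, hm.add (hF2.sq.add ((hσb.mul hF2).cmul _)) (hσb.sq.cmul _),
        hm.add hF2.sq ((hσb.mul hF2).cmul _), hm.smul _ (hσb.mul hF2), hm.smul _ hσb.sq] at h5
      have h7 : (sys2 Y1 U).φ (fun q => σ q ^ 2) ≤ C ^ 2 := hm.le_const hσb.sq fun q => by
        rw [← sq_abs]; exact pow_le_pow_left₀ (abs_nonneg _) (hσC q) 2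
      have h8 := mul_le_mul_of_nonneg_left h7 (sq_nonneg t)
      rw [← hp] at h5
      linarith
    have hFF : (sys2 Y1 U).φ (fun q => F q.2 ^ 2) = Y1.φ (fun ω => F ω ^ 2) :=
      (sys2_ext Y1 U).mean _ hFb.sq
    have h9 := hmin (p / C ^ 2)
    rw [hFF] at h9
    have hC2 : (0 : ℝ) < C ^ 2 := by positivity
    have h10 : p ^ 2 / C ^ 2 ≤ ε ^ 2 := by
      have : 2 * (p / C ^ 2) * p = 2 * (p ^ 2 / C ^ 2) := by ring
      have h11 : (p / C ^ 2) ^ 2 * C ^ 2 = p ^ 2 / C ^ 2 := by field_simp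
      rw [this, h11] at h9
      linarith
    rw [div_le_iff₀ hC2, ← mul_pow] at h10
    exact abs_le_of_sq_le_sq h10 (by positivity)
  -- conclude
  refine ⟨ulim (Ultrafilter.of (FF E)) (fun w => avg w (corr1 γ Y I a f0 f fa)),
    tendsto_of_ulim hcb.avgw fun U hU => ?_⟩
  refine eq_of_forall_dist_le fun ε hε => ?_
  obtain ⟨L, hL⟩ := key (ε / (2 * C)) (by positivity)
  have h1 := hL U hU
  have h2 := hL _ (Ultrafilter.of_le (FF E))
  have h3 : ε / (2 * C) * C = ε / 2 := by field_simp
  rw [h3] at h1 h2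
  rw [Real.dist_eq, abs_le]
  rw [abs_le] at h1 h2
  constructor <;> linarith [h1.1, h1.2, h2.1, h2.2]

theorem thmB (I : Finset ι) : ∀ (Ω : Type u) (Y : Sys G Ω) (f0 : Ω → ℝ) (f : ι → Ω → ℝ),
    Bdd f0 → (∀ i, Bdd (f i)) →
    ∃ L, Tendsto (fun w => avg w (corr γ Y I f0 f)) (FF E) (nhds L) := by
  classical
  induction I using Finset.induction_on with
  | empty =>
    intro Ω Y f0 f h0 hf
    refine ⟨Y.φ f0, tendsto_const_nhds.congr fun w => ?_⟩
    have : corr γ Y ∅ f0 f = fun _ => Y.φ f0 := by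
      funext s; unfold corr pr; simp
    rw [this, (avg_isMean w).const]
  | insert a I ha ih =>
    intro Ω Y f0 f h0 hf
    obtain ⟨L, hL⟩ := thmB_step γ Y I a h0 hf (hf a) ih
    refine ⟨L, hL.congr fun w => ?_⟩
    congr 1; funext s
    unfold corr corr1
    congr 1; funext ω
    unfold pr
    rw [Finset.prod_insert ha]; ring

/-- soft Walsh theorem, uniform form, over a fintype -/
theorem thmB_MU {κ : Type} [Fintype κ] (γ : κ → E →+ G) {Ω : Type u} (Y : Sys G Ω)
    (f : κ → Ω → ℝ) (hf : ∀ i, Bdd (f i)) :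
    ∃ L, MU (fun s => Y.φ (fun ω => ∏ i, f i (Y.S (γ i s) ω))) L := by
  obtain ⟨L, hL⟩ := thmB γ Finset.univ Ω Y (fun _ => 1) f (Bdd.const 1) hf
  refine ⟨L, MU_of_tendsto ?_⟩
  refine hL.congr fun w => ?_
  congr 1; funext s
  unfold corr pr; simp

end B
end P13

set_option linter.unusedVariables false
set_option linter.unusedSectionVars false

namespace P13

/-- unipotent map: `(U d) 0 = d 0`, `(U d) (i+1) = d (i+1) + d i` -/
def Um (q : ℕ) : (Fin (q + 1) → ℝ) →ₗ[ℝ] (Fin (q + 1) → ℝ) where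
  toFun d := Fin.cons (d 0) (fun i => d i.succ + d i.castSucc)
  map_add' a b := by
    funext i; refine Fin.cases ?_ (fun i => ?_) i <;> simp; ring
  map_smul' c b := by
    funext i; refine Fin.cases ?_ (fun i => ?_) i <;> simp; ring

@[simp] theorem Um_zero {q : ℕ} (d : Fin (q + 1) → ℝ) : Um q d 0 = d 0 := rfl
@[simp] theorem Um_succ {q : ℕ} (d : Fin (q + 1) → ℝ) (i : Fin q) :
    Um q d i.succ = d i.succ + d i.castSucc := rfl

/-- vectors supported on indices `≥ n` -/
def Vn (q n : ℕ) (c : Fin (q + 1) → ℝ) : Prop := ∀ i : Fin (q + 1), i.val < n → c i = 0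

theorem Um_Vn {q n : ℕ} {c : Fin (q + 1) → ℝ} (h : Vn q n c) (r : ℕ) :
    Vn q n ((Um q)^[r] c) ∧ ∀ (j : Fin q), j.val = n →
      (Um q)^[r] c j.castSucc = c j.castSucc ∧
      (Um q)^[r] c j.succ = c j.succ + r * c j.castSucc := by
  induction r with
  | zero => simpa using h
  | succ r ih =>
    rw [Function.iterate_succ_apply']
    set d := (Um q)^[r] c
    constructor
    · intro i
      refine Fin.cases (fun hi => ?_) (fun i hi => ?_) i
      · simpa using ih.1 0 hi
      · rw [Um_succ, ih.1 _ hi, ih.1 i.castSucc (by simp at hi ⊢; omega), add_zero]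
    · intro j hj
      obtain ⟨h1, h2⟩ := ih.2 j hj
      refine ⟨?_, ?_⟩
      · rw [← h1]
        by_cases hj0 : j.val = 0
        · have : j.castSucc = 0 := by ext; simpa using hj0
          rw [this]; rfl
        · obtain ⟨k, hk⟩ : ∃ k : Fin q, k.succ = j.castSucc :=
            ⟨⟨j.val - 1, by omega⟩, by ext; simp; omega⟩
          rw [← hk, Um_succ, ih.1 k.castSucc, add_zero]
          have : k.val + 1 = j.val := by have := congrArg Fin.val hk; simpa using this
          simp; omega
      · rw [Um_succ, h1, h2]; push_cast; ring

section hilbert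
variable {H : Type*} [NormedAddCommGroup H] [InnerProductSpace ℝ H] [CompleteSpace H]

theorem mautner {q : ℕ} (τ : (Fin (q + 1) → ℝ) → H →L[ℝ] H) (Uo : H →L[ℝ] H)
    (τn : ∀ a x, ‖τ a x‖ = ‖x‖) (τ0 : ∀ x, τ 0 x = x)
    (τa : ∀ a b x, τ (a + b) x = τ a (τ b x))
    (Ui : ∀ x y, inner ℝ (Uo x) (Uo y) = inner ℝ x y)
    (hc : ∀ a x, τ a (Uo x) = Uo (τ (Um q a) x))
    (v : H) (hv : Uo v = v)
    (hcont : ∀ a, Tendsto (fun n : ℕ => τ (((n : ℝ) + 1)⁻¹ • a) v) atTop (nhds v))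
    (c : Fin (q + 1) → ℝ) (hc0 : c 0 = 0) : τ c v = v := by
  have h1 : ∀ a (r : ℕ), inner ℝ v (τ ((Um q)^[r] a) v) = inner ℝ v (τ a v) := by
    intro a r
    induction r generalizing a with
    | zero => rfl
    | succ r ih =>
      rw [Function.iterate_succ_apply, ih, ← Ui v, ← hc, hv]
  -- main step for a single direction
  have step : ∀ n : ℕ, (∀ c, Vn q (n + 2) c → τ c v = v) → ∀ c, Vn q (n + 1) c → τ c v = v := by
    intro n IH c hcn
    by_cases hnq : n < q
    swap
    · exact IH c fun i hi => hcn i (by have := i.2; omega)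
    set j : Fin q := ⟨n, hnq⟩ with hj
    have single : ∀ x : ℝ, τ (Pi.single j.succ x) v = v := by
      intro x
      have npow : ∀ (y : ℝ) (r : ℕ) (z : H), (τ (Pi.single j.succ y))^[r] z
          = τ (Pi.single j.succ (r * y)) z := by
        intro y r z
        induction r with
        | zero => simp [τ0]
        | succ r ih =>
          rw [Function.iterate_succ_apply', ih, ← τa, ← Pi.single_add]
          congr 3; push_cast; ring
      -- projections
      set K : ℝ → Submodule ℝ H := fun y =>
        ((τ (Pi.single j.succ y)).eqLocus (1 : H →L[ℝ] H)) with hK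
      have hKmem : ∀ y z, z ∈ K y ↔ τ (Pi.single j.succ y) z = z := fun y z => Iff.rfl
      have hclosed : ∀ y, IsClosed (K y : Set H) := fun y =>
        isClosed_eq (τ (Pi.single j.succ y)).continuous continuous_id
      have hcomp : ∀ y, CompleteSpace (K y) := fun y => (hclosed y).completeSpace_coe
      have hineq : ∀ y, inner ℝ v (τ (Pi.single j.castSucc y) v)
          ≤ ‖v‖ * ‖(K y).orthogonalProjectionOnto v‖ := by
        intro y
        have hconst : ∀ r : ℕ, inner ℝ v (τ (Pi.single j.castSucc y)
            ((τ (Pi.single j.succ y))^[r] v)) = inner ℝ v (τ (Pi.single j.castSucc y) v) := by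
          intro r
          rw [← h1 (Pi.single j.castSucc y) r, npow, ← τa]
          have hV : Vn q n (Pi.single j.castSucc y : Fin (q + 1) → ℝ) := by
            intro i hi
            rw [Pi.single_eq_of_ne]
            rintro rfl
            simp [hj] at hi
          obtain ⟨hA, hB⟩ := Um_Vn hV r
          obtain ⟨hB1, hB2⟩ := hB j rfl
          set z := (Um q)^[r] (Pi.single j.castSucc y : Fin (q + 1) → ℝ) -
            (Pi.single j.castSucc y + Pi.single j.succ (r * y)) with hz
          have hne : j.castSucc ≠ j.succ := (Fin.castSucc_lt_succ).ne
          have hzV : Vn q (n + 2) z := by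
            intro i hi
            rw [hz, Pi.sub_apply, Pi.add_apply]
            by_cases h3 : i = j.castSucc
            · subst h3
              rw [hB1, Pi.single_eq_same, Pi.single_eq_of_ne hne]; ring
            by_cases h4 : i = j.succ
            · subst h4
              rw [hB2, Pi.single_eq_same, Pi.single_eq_same, Pi.single_eq_of_ne hne.symm]; ring
            · rw [Pi.single_eq_of_ne h3, Pi.single_eq_of_ne h4, hA i]
              · ring
              · have h5 : i.val ≠ n := fun h => h3 (by ext; simp [hj, h])
                have h6 : i.val ≠ n + 1 := fun h => h4 (by ext; simp [hj, h])
                omega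
          have : (Um q)^[r] (Pi.single j.castSucc y : Fin (q + 1) → ℝ)
            = (Pi.single j.castSucc y + Pi.single j.succ (r * y)) + z := by rw [hz]; abel
          rw [this, τa _ z, IH z hzV]
        have hnorm : ‖τ (Pi.single j.succ y)‖ ≤ 1 :=
          ContinuousLinearMap.opNorm_le_bound _ zero_le_one fun x => by rw [τn, one_mul]
        have hlim := (τ (Pi.single j.succ y)).tendsto_birkhoffAverage_orthogonalProjection hnorm v
        have hlim2 : Tendsto (fun r : ℕ => inner ℝ v (τ (Pi.single j.castSucc y)
            (birkhoffAverage ℝ (τ (Pi.single j.succ y)) _root_.id r v))) atTop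
            (nhds (inner ℝ v (τ (Pi.single j.castSucc y) ((K y).orthogonalProjectionOnto v)))) :=
          (((innerSL ℝ v).comp (τ (Pi.single j.castSucc y))).continuous.tendsto _).comp hlim
        have hev : ∀ᶠ r : ℕ in atTop, inner ℝ v (τ (Pi.single j.castSucc y) v) =
            inner ℝ v (τ (Pi.single j.castSucc y)
            (birkhoffAverage ℝ (τ (Pi.single j.succ y)) _root_.id r v)) := by
          filter_upwards [eventually_gt_atTop 0] with r hr
          unfold birkhoffAverage birkhoffSum
          rw [map_smul, map_sum, inner_smul_right, inner_sum]
          simp only [id, hconst]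
          rw [Finset.sum_const, card_range, nsmul_eq_mul, ← mul_assoc, inv_mul_cancel₀, one_mul]
          exact_mod_cast hr.ne'
        have heq := tendsto_nhds_unique (tendsto_const_nhds.congr' hev) hlim2
        rw [heq]
        refine (real_inner_le_norm _ _).trans ?_
        rw [τn]; rfl
      have hmono : ∀ n : ℕ, ‖(K (((n : ℝ) + 1)⁻¹ * x)).orthogonalProjectionOnto v‖
          ≤ ‖(K x).orthogonalProjectionOnto v‖ := by
        intro n
        have hle : K (((n : ℝ) + 1)⁻¹ * x) ≤ K x := by
          intro z hz
          rw [hKmem] at hz ⊢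
          have h3 := npow (((n : ℝ) + 1)⁻¹ * x) (n + 1) z
          rw [Function.iterate_fixed hz] at h3
          have h4 : ((n + 1 : ℕ) : ℝ) * (((n : ℝ) + 1)⁻¹ * x) = x := by
            push_cast
            have : (n : ℝ) + 1 ≠ 0 := by positivity
            field_simp
          rw [h4] at h3
          exact h3.symm
        set P := (K (((n : ℝ) + 1)⁻¹ * x)).orthogonalProjectionOnto v
        set P' := (K x).orthogonalProjectionOnto v
        have e1 : inner ℝ (P : H) v = inner ℝ (P : H) (P : H) := by
          have := Submodule.inner_orthogonalProjectionOnto_eq_of_mem_left P v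
          exact this.symm
        have e2 : inner ℝ (P : H) v = inner ℝ (P : H) (P' : H) := by
          have := Submodule.inner_orthogonalProjectionOnto_eq_of_mem_left
            (⟨P.1, hle P.2⟩ : K x) v
          exact this.symm
        have e3 : ‖P‖ * ‖P‖ ≤ ‖P‖ * ‖P'‖ := by
          have := real_inner_le_norm (P : H) (P' : H)
          rw [← e2, e1, real_inner_self_eq_norm_mul_norm] at this
          exact this
        rcases (norm_nonneg P).eq_or_lt with h | h
        · rw [← h]; exact norm_nonneg _
        · exact le_of_mul_le_mul_left e3 h
      have hfin : ‖v‖ * ‖v‖ ≤ ‖v‖ * ‖(K x).orthogonalProjectionOnto v‖ := by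
        rw [← real_inner_self_eq_norm_mul_norm]
        have ht : Tendsto (fun n : ℕ => inner ℝ v
            (τ (((n : ℝ) + 1)⁻¹ • Pi.single j.castSucc x) v)) atTop (nhds (inner ℝ v v)) :=
          ((innerSL ℝ v).continuous.tendsto _).comp (hcont (Pi.single j.castSucc x))
        refine le_of_tendsto' ht fun n => ?_
        rw [← Pi.single_smul, smul_eq_mul]
        exact (hineq _).trans (mul_le_mul_of_nonneg_left (hmono n) (norm_nonneg _))
      rcases (norm_nonneg v).eq_or_lt with h | h
      · have : v = 0 := norm_eq_zero.1 h.symm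
        rw [this, map_zero]
      · have h3 := le_of_mul_le_mul_left hfin h
        set P := (K x).orthogonalProjectionOnto v with hP
        have e1 : inner ℝ (P : H) v = inner ℝ (P : H) (P : H) := by
          have := Submodule.inner_orthogonalProjectionOnto_eq_of_mem_left P v
          exact this.symm
        have e2 : ‖v - P‖ ^ 2 ≤ 0 := by
          rw [norm_sub_sq_real, real_inner_comm, e1, real_inner_self_eq_norm_sq]
          have : ‖v‖ ^ 2 ≤ ‖(P : H)‖ ^ 2 := pow_le_pow_left₀ h.le h3 2
          linarith
        have e3 : v = P := by
          have : ‖v - P‖ = 0 := by nlinarith [norm_nonneg (v - P)]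
          exact sub_eq_zero.1 (norm_eq_zero.1 this)
        have := P.2
        rw [hKmem, ← e3] at this
        exact this
    have hrest : Vn q (n + 2) (c - Pi.single j.succ (c j.succ)) := by
      intro i hi
      rw [Pi.sub_apply]
      by_cases h4 : i = j.succ
      · subst h4; simp
      · rw [Pi.single_eq_of_ne h4, hcn i, sub_zero]
        have h6 : i.val ≠ n + 1 := fun h => h4 (by ext; simp [hj, h])
        omega
    have : c = Pi.single j.succ (c j.succ) + (c - Pi.single j.succ (c j.succ)) := by abel
    rw [this, τa, IH _ hrest, single]
  have all : ∀ k n : ℕ, q + 1 ≤ n + k → ∀ c, Vn q (n + 1) c → τ c v = v := by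
    intro k
    induction k with
    | zero =>
      intro n hn c hcn
      have : c = 0 := funext fun i => hcn i (by have := i.2; omega)
      rw [this, τ0]
    | succ k ih =>
      intro n hn
      exact step n (ih (n + 1) (by omega))
  refine all (q + 1) 0 (by omega) c fun i hi => ?_
  have : i = 0 := by ext; simp at hi ⊢; exact hi
  rw [this, hc0]

end hilbert

end P13

set_option linter.unusedVariables false
set_option linter.unusedSectionVars false

namespace P13
universe u

/-- mean ergodic theorem, repackaged -/
theorem mean_erg {H : Type*} [NormedAddCommGroup H] [InnerProductSpace ℝ H] [CompleteSpace H]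
    (Uo : H →L[ℝ] H) (hnU : ‖Uo‖ ≤ 1) (ξ : H) :
    ∃ v : H, Tendsto (birkhoffAverage ℝ Uo _root_.id · ξ) atTop (nhds v) ∧ Uo v = v ∧
      inner ℝ ξ v = inner ℝ v v := by
  refine ⟨_, Uo.tendsto_birkhoffAverage_orthogonalProjection hnU ξ,
    ((Uo.eqLocus (1 : H →L[ℝ] H)).orthogonalProjectionOnto ξ).2, ?_⟩
  have := Submodule.inner_orthogonalProjectionOnto_eq_of_mem_left
      ((Uo.eqLocus (1 : H →L[ℝ] H)).orthogonalProjectionOnto ξ) ξ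
  rw [real_inner_comm]; exact this.symm

/-- submodule of bounded functions -/
def bddSub (α : Type u) : Submodule ℝ (α → ℝ) where
  carrier := {f | Bdd f}
  add_mem' hf hg := hf.add hg
  zero_mem' := Bdd.const 0
  smul_mem' c f hf := hf.cmul c

/-- bounded functions with the semi-inner product of a mean -/
def PreL2 {α : Type u} (M : (α → ℝ) → ℝ) (hM : IsMean M) : Type u := bddSub α

section
variable {α : Type u} {M : (α → ℝ) → ℝ} (hM : IsMean M)

noncomputable instance : AddCommGroup (PreL2 M hM) := inferInstanceAs (AddCommGroup (bddSub α))
noncomputable instance : Module ℝ (PreL2 M hM) := inferInstanceAs (Module ℝ (bddSub α))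

noncomputable abbrev coreL2 : PreInnerProductSpace.Core ℝ (PreL2 M hM) where
  inner f g := M (fun x => f.1 x * g.1 x)
  conj_inner_symm f g := by
    simp only [conj_trivial]; congr 1; funext x; ring
  re_inner_nonneg f := by
    simp only [RCLike.re_to_real]
    exact hM.nonneg (f.2.mul f.2) fun x => mul_self_nonneg _
  add_left f g h := by
    show M (fun x => (f.1 x + g.1 x) * h.1 x) = _
    rw [← hM.add (f.2.mul h.2) (g.2.mul h.2)]
    congr 1; funext x; ring
  smul_left f g c := by
    show M (fun x => (c * f.1 x) * g.1 x) = _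
    simp only [conj_trivial]
    rw [← hM.smul c (f.2.mul g.2)]
    congr 1; funext x; ring

noncomputable instance : SeminormedAddCommGroup (PreL2 M hM) :=
  InnerProductSpace.Core.toSeminormedAddCommGroup (c := coreL2 hM)
noncomputable instance : InnerProductSpace ℝ (PreL2 M hM) :=
  InnerProductSpace.ofCore (coreL2 hM)

theorem inner_L2 (f g : PreL2 M hM) : inner ℝ f g = M (fun x => f.1 x * g.1 x) := rfl

/-- composition operator -/
noncomputable def compL2 (σ : α → α) (hσ : ∀ f, Bdd f → M (fun x => f (σ x)) = M f) :
    PreL2 M hM →ₗᵢ[ℝ] PreL2 M hM :=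
  LinearMap.isometryOfInner (E := PreL2 M hM) (E' := PreL2 M hM)
  { toFun := fun f => (⟨fun x => f.1 (σ x), f.2.comp σ⟩ : bddSub α)
    map_add' := fun f g => rfl
    map_smul' := fun c f => rfl }
  (fun f g => by
    rw [inner_L2, inner_L2]
    exact hσ _ (f.2.mul g.2))

/-- completed composition operator -/
noncomputable def compH (σ : α → α) (hσ : ∀ f, Bdd f → M (fun x => f (σ x)) = M f) :
    UniformSpace.Completion (PreL2 M hM) →L[ℝ] UniformSpace.Completion (PreL2 M hM) :=
  (compL2 hM σ hσ).toContinuousLinearMap.completion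

/-- bounded function as an element of the pre-Hilbert space -/
def mkL2 (f : α → ℝ) (hf : Bdd f) : PreL2 M hM := (⟨f, hf⟩ : bddSub α)

/-- class of a bounded function -/
noncomputable def clH (f : α → ℝ) (hf : Bdd f) : UniformSpace.Completion (PreL2 M hM) :=
  ((mkL2 hM f hf : PreL2 M hM) : UniformSpace.Completion (PreL2 M hM))

theorem compH_cl (σ : α → α) (hσ : ∀ f, Bdd f → M (fun x => f (σ x)) = M f) (f : α → ℝ)
    (hf : Bdd f) : compH hM σ hσ (clH hM f hf) = clH hM (fun x => f (σ x)) (hf.comp σ) := by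
  unfold compH clH
  rw [ContinuousLinearMap.completion_apply_coe]
  rfl

theorem inner_cl (f g : α → ℝ) (hf : Bdd f) (hg : Bdd g) :
    inner ℝ (clH hM f hf) (clH hM g hg) = M (fun x => f x * g x) := by
  unfold clH
  rw [UniformSpace.Completion.inner_coe]; rfl

theorem norm_cl (f : α → ℝ) (hf : Bdd f) : ‖clH hM f hf‖ ^ 2 = M (fun x => f x ^ 2) := by
  rw [← real_inner_self_eq_norm_sq, inner_cl]
  congr 1; funext x; ring

theorem compH_norm (σ : α → α) (hσ : ∀ f, Bdd f → M (fun x => f (σ x)) = M f) (x) :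
    ‖compH hM σ hσ x‖ = ‖x‖ := by
  refine UniformSpace.Completion.induction_on x ?_ fun f => ?_
  · exact isClosed_eq (compH hM σ hσ).continuous.norm continuous_norm
  · unfold compH
    rw [ContinuousLinearMap.completion_apply_coe]
    simp

theorem compH_inner (σ : α → α) (hσ : ∀ f, Bdd f → M (fun x => f (σ x)) = M f) (x y) :
    inner ℝ (compH hM σ hσ x) (compH hM σ hσ y) = inner ℝ x y := by
  rw [real_inner_eq_norm_add_mul_self_sub_norm_mul_self_sub_norm_mul_self_div_two,
    real_inner_eq_norm_add_mul_self_sub_norm_mul_self_sub_norm_mul_self_div_two, ← map_add]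
  simp only [compH_norm]

theorem H_ext {A B : UniformSpace.Completion (PreL2 M hM) →L[ℝ]
    UniformSpace.Completion (PreL2 M hM)}
    (h : ∀ f hf, A (clH hM f hf) = B (clH hM f hf)) (x) : A x = B x := by
  refine UniformSpace.Completion.induction_on x ?_ fun f => ?_
  · exact isClosed_eq A.continuous B.continuous
  · exact h f.1 f.2

/-- the Mautner argument in the language of means -/
theorem mautner_mean (hM : IsMean M) {q : ℕ} (τ : (Fin (q + 1) → ℝ) → α → α) (V : α → α)
    (hτ : ∀ a f, Bdd f → M (fun x => f (τ a x)) = M f)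
    (hV : ∀ f, Bdd f → M (fun x => f (V x)) = M f)
    (τ0 : ∀ x, τ 0 x = x) (τa : ∀ a b x, τ (a + b) x = τ a (τ b x))
    (hc : ∀ a x, V (τ a x) = τ (Um q a) (V x))
    (F : α → ℝ) (hF : Bdd F)
    (hcont : ∀ a, Tendsto (fun n : ℕ => M (fun x => (F (τ (((n : ℝ) + 1)⁻¹ • a) x) - F x) ^ 2))
      atTop (nhds 0))
    (w : Wt (Fin (q + 1) → ℝ)) (hw : ∀ c ∈ w.1, c 0 = 0) (ε : ℝ) (hε : 0 < ε) :
    ∃ R : ℕ, M (fun x => (avg (prog 1 R) (fun r : ℤ => F (V^[r.toNat] x))) ^ 2)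
      ≤ M (fun x => avg w (fun u => F (τ u x)) ^ 2) + ε := by
  set To := fun a => compH hM (τ a) (hτ a) with hTo
  set Uo := compH hM V hV with hUo
  set ξ := clH hM F hF with hξ
  have hnU : ‖Uo‖ ≤ 1 :=
    ContinuousLinearMap.opNorm_le_bound _ zero_le_one fun x => by rw [compH_norm, one_mul]
  obtain ⟨v, hlim, hUv, hξv⟩ := mean_erg Uo hnU ξ
  have T0 : ∀ x, To 0 x = x := fun x => by
    have := H_ext hM (A := To 0) (B := ContinuousLinearMap.id ℝ _) (fun f hf => by
      rw [hTo]; simp only [compH_cl, τ0]; rfl) x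
    simpa using this
  have Ta : ∀ a b x, To (a + b) x = To a (To b x) := fun a b x => by
    have := H_ext hM (A := To (a + b)) (B := (To a).comp (To b)) (fun f hf => by
      rw [hTo]; simp only [ContinuousLinearMap.comp_apply, compH_cl]
      congr 1; funext x; rw [add_comm, τa]) x
    simpa using this
  have hcomm : ∀ a x, To a (Uo x) = Uo (To (Um q a) x) := fun a x => by
    have := H_ext hM (A := (To a).comp Uo) (B := Uo.comp (To (Um q a))) (fun f hf => by
      rw [hTo, hUo]; simp only [ContinuousLinearMap.comp_apply, compH_cl, hc]) x
    simpa using this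
  have hUcl : ∀ r : ℕ, Uo^[r] ξ = clH hM (fun x => F (V^[r] x)) (hF.comp _) := by
    intro r
    induction r with
    | zero => rfl
    | succ r ih =>
      rw [Function.iterate_succ_apply', ih, hUo, compH_cl]
      simp only [← Function.iterate_succ_apply]
  -- continuity
  have hcontξ : ∀ a, Tendsto (fun n : ℕ => To (((n : ℝ) + 1)⁻¹ • a) ξ) atTop (nhds ξ) := by
    intro a
    rw [tendsto_iff_norm_sub_tendsto_zero]
    have h1 : ∀ n : ℕ, ‖To (((n : ℝ) + 1)⁻¹ • a) ξ - ξ‖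
        = √ (M (fun x => (F (τ (((n : ℝ) + 1)⁻¹ • a) x) - F x) ^ 2)) := by
      intro n
      rw [hTo, hξ]
      simp only [compH_cl]
      rw [show clH hM (fun x => F (τ (((n : ℝ) + 1)⁻¹ • a) x)) (hF.comp _) - clH hM F hF
        = clH hM (fun x => F (τ (((n : ℝ) + 1)⁻¹ • a) x) - F x) ((hF.comp _).sub hF) from
          (UniformSpace.Completion.coe_sub _ _).symm,
        ← norm_cl hM (fun x => F (τ (((n : ℝ) + 1)⁻¹ • a) x) - F x) ((hF.comp _).sub hF), Real.sqrt_sq (norm_nonneg _)]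
    simp only [h1]
    have := (Real.continuous_sqrt.tendsto 0).comp (hcont a)
    rw [Real.sqrt_zero] at this
    exact this
  have hshift : ∀ (r : ℕ) a x, To a (Uo^[r] x) = Uo^[r] (To ((Um q)^[r] a) x) := by
    intro r
    induction r with
    | zero => intro a x; rfl
    | succ r ih =>
      intro a x
      rw [Function.iterate_succ_apply, ih, hcomm, ← Function.iterate_succ_apply (f := Uo),
        Function.iterate_succ_apply' (Um q)]
  have hlin : ∀ (r : ℕ) (s : ℝ) a, (Um q)^[r] (s • a) = s • (Um q)^[r] a := by
    intro r s
    induction r with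
    | zero => intro a; rfl
    | succ r ih => intro a; rw [Function.iterate_succ_apply, map_smul, ih]; rfl
  have hit : ∀ r : ℕ, Continuous (Uo^[r]) := fun r => Uo.continuous.iterate r
  have hcontr : ∀ a (r : ℕ), Tendsto (fun n : ℕ => To (((n : ℝ) + 1)⁻¹ • a) (Uo^[r] ξ)) atTop
      (nhds (Uo^[r] ξ)) := by
    intro a r
    simp only [hshift, hlin]
    exact ((hit r).tendsto _).comp (hcontξ _)
  have hcontA : ∀ a (R : ℕ), Tendsto (fun n : ℕ => To (((n : ℝ) + 1)⁻¹ • a)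
      (birkhoffAverage ℝ Uo _root_.id R ξ)) atTop (nhds (birkhoffAverage ℝ Uo _root_.id R ξ)) := by
    intro a R
    unfold birkhoffAverage birkhoffSum
    simp only [map_smul, map_sum, id]
    exact (tendsto_finsetSum _ fun r _ => hcontr a r).const_smul _
  have hcontv : ∀ a, Tendsto (fun n : ℕ => To (((n : ℝ) + 1)⁻¹ • a) v) atTop (nhds v) := by
    intro a
    rw [Metric.tendsto_atTop]
    intro ε hε
    obtain ⟨R, hR⟩ := (Metric.tendsto_nhds.1 hlim (ε / 3) (by positivity)).exists
    obtain ⟨N, hN⟩ := Metric.tendsto_atTop.1 (hcontA a R) (ε / 3) (by positivity)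
    refine ⟨N, fun n hn => ?_⟩
    have h1 := hN n hn
    set y := birkhoffAverage ℝ Uo _root_.id R ξ
    have h2 : dist (To (((n : ℝ) + 1)⁻¹ • a) v) (To (((n : ℝ) + 1)⁻¹ • a) y) < ε / 3 := by
      rw [dist_eq_norm, ← map_sub, hTo, compH_norm, ← dist_eq_norm, dist_comm]; exact hR
    calc dist _ v ≤ dist (To (((n : ℝ) + 1)⁻¹ • a) v) (To (((n : ℝ) + 1)⁻¹ • a) y)
        + dist (To (((n : ℝ) + 1)⁻¹ • a) y) y + dist y v := dist_triangle4 _ _ _ _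
      _ < ε / 3 + ε / 3 + ε / 3 := by linarith [hR]
      _ = ε := by ring
  have hinv : ∀ c : Fin (q + 1) → ℝ, c 0 = 0 → To c v = v := fun c hc0 =>
    mautner To Uo (fun a x => compH_norm hM _ _ x) T0 Ta (compH_inner hM V hV) hcomm v hUv hcontv
      c hc0
  -- the average b_w
  have hbw : Bdd (fun x => avg w (fun u => F (τ u x))) :=
    Bdd.avg w (F := fun u x => F (τ u x)) fun u => hF.comp (τ u)
  set b := clH hM (fun x => avg w (fun u => F (τ u x))) hbw with hb
  have hiv : ∀ (f : α → ℝ) hf, inner ℝ (clH hM f hf) v = inner ℝ v (clH hM f hf) :=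
    fun f hf => real_inner_comm _ _
  have hbsum : b = ((w.1.length : ℝ)⁻¹) • ((w.1.map (fun u => To u ξ)).sum) := by
    have hl : ∀ l : List (Fin (q + 1) → ℝ), ∃ h, (l.map (fun u => To u ξ)).sum
        = clH hM (fun x => (l.map (fun u => F (τ u x))).sum) h := by
      intro l
      induction l with
      | nil => exact ⟨by simpa using Bdd.const 0, rfl⟩
      | cons a l ih =>
        obtain ⟨h, ih⟩ := ih
        refine ⟨by simpa using (hF.comp (τ a)).add h, ?_⟩
        rw [List.map_cons, List.sum_cons, ih, hTo, hξ]
        simp only [compH_cl]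
        exact (UniformSpace.Completion.coe_add _ _).symm
    obtain ⟨h, e⟩ := hl w.1
    rw [e, hb]
    unfold clH
    rw [← UniformSpace.Completion.coe_smul]
    congr 1
    refine Subtype.ext (funext fun x => ?_)
    show (w.1.map _).sum / _ = (w.1.length : ℝ)⁻¹ * (w.1.map _).sum
    rw [div_eq_inv_mul]
  have hbv : inner ℝ b v = inner ℝ v v := by
    rw [hbsum, inner_smul_left]
    have hl : ∀ l : List (Fin (q + 1) → ℝ), (∀ c ∈ l, c 0 = 0) →
        inner ℝ ((l.map (fun u => To u ξ)).sum) v = l.length * inner ℝ v v := by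
      intro l hl
      induction l with
      | nil => simp
      | cons a l ih =>
        rw [List.map_cons, List.sum_cons, inner_add_left, ih fun c hc => hl c (by simp [hc])]
        have : inner ℝ (To a ξ) v = inner ℝ v v := by
          conv_lhs => rw [← hinv a (hl a (by simp))]
          rw [hTo, compH_inner, hξv]
        rw [this]; push_cast [List.length_cons]; ring
    rw [hl w.1 hw]
    simp only [conj_trivial]
    rw [← mul_assoc, inv_mul_cancel₀ w.len_pos.ne', one_mul]
  have hvb : ‖v‖ ≤ ‖b‖ := by
    have h1 : ‖v‖ * ‖v‖ ≤ ‖b‖ * ‖v‖ := by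
      rw [← real_inner_self_eq_norm_mul_norm, ← hbv]; exact real_inner_le_norm _ _
    rcases (norm_nonneg v).eq_or_lt with h | h
    · rw [← h]; exact norm_nonneg _
    · exact le_of_mul_le_mul_right h1 h
  have hlim2 : Tendsto (fun n : ℕ => ‖birkhoffAverage ℝ Uo _root_.id n ξ‖ ^ 2) atTop
      (nhds (‖v‖ ^ 2)) := (hlim.norm).pow 2
  have hlt : ‖v‖ ^ 2 < ‖b‖ ^ 2 + ε :=
    lt_of_le_of_lt (pow_le_pow_left₀ (norm_nonneg _) hvb 2) (by linarith)
  obtain ⟨R, hR, hR0⟩ := ((hlim2.eventually_lt_const hlt).and (eventually_gt_atTop 0)).exists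
  refine ⟨R - 1, ?_⟩
  rw [← norm_cl hM _ hbw, ← hb]
  have hbR : Bdd (fun x => avg (prog 1 (R - 1)) (fun r : ℤ => F (V^[r.toNat] x))) :=
    Bdd.avg _ (F := fun (r : ℤ) x => F (V^[r.toNat] x)) fun r => hF.comp _
  rw [← norm_cl hM _ hbR]
  refine le_of_eq_of_le ?_ hR.le
  congr 2
  unfold birkhoffAverage birkhoffSum
  simp only [id, hUcl]
  have hl : ∀ n : ℕ, ∃ h, ∑ r ∈ Finset.range n, clH hM (fun x => F (V^[r] x)) (hF.comp _)
        = clH hM (fun x => ∑ r ∈ Finset.range n, F (V^[r] x)) h := by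
    intro n
    induction n with
    | zero => exact ⟨by simpa using Bdd.const 0, by simp only [Finset.sum_range_zero]; rfl⟩
    | succ n ih =>
      obtain ⟨h, ih⟩ := ih
      refine ⟨by simpa [Finset.sum_range_succ] using h.add (hF.comp (V^[n])), ?_⟩
      simp only [Finset.sum_range_succ]
      rw [ih]
      exact (UniformSpace.Completion.coe_add _ _).symm
  obtain ⟨h, e⟩ := hl R
  rw [e]
  unfold clH
  rw [← UniformSpace.Completion.coe_smul]
  congr 1
  refine Subtype.ext (funext fun x => ?_)
  show avg (prog 1 (R - 1)) (fun r : ℤ => F (V^[r.toNat] x))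
    = (R : ℝ)⁻¹ * ∑ r ∈ Finset.range R, F (V^[r] x)
  unfold avg prog
  simp only [List.map_map, List.length_map, List.length_range]
  rw [Nat.sub_add_cancel hR0, div_eq_inv_mul]
  congr 1
  rw [Finset.sum_range, ← List.sum_ofFn, List.ofFn_eq_map, ← List.map_coe_finRange_eq_range,
    List.map_map]
  congr 1
  refine List.map_congr_left fun r _ => ?_
  simp

end

end P13

set_option linter.unusedVariables false
set_option linter.unusedSectionVars false

namespace P13
universe u

/-- bounded by one and continuous along the action in mean -/
structure GoodF {Ω : Type u} (Y : Sys ℝ Ω) (f : Ω → ℝ) : Prop where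
  le_one : ∀ ω, |f ω| ≤ 1
  cont : ∀ ε > (0 : ℝ), ∃ δ > (0 : ℝ), ∀ x : ℝ, |x| < δ → Y.φ (fun ω => |f (Y.S x ω) - f ω|) ≤ ε

theorem GoodF.bdd {Ω : Type u} {Y : Sys ℝ Ω} {f : Ω → ℝ} (h : GoodF Y f) : Bdd f := ⟨1, h.le_one⟩

theorem GoodF.shift {Ω : Type u} {Y : Sys ℝ Ω} {f : Ω → ℝ} (h : GoodF Y f) (a : ℝ) :
    GoodF Y (fun ω => f (Y.S a ω)) where
  le_one ω := h.le_one _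
  cont ε hε := by
    obtain ⟨δ, hδ, H⟩ := h.cont ε hε
    refine ⟨δ, hδ, fun x hx => ?_⟩
    have e : (fun ω => |f (Y.S a (Y.S x ω)) - f (Y.S a ω)|)
        = (fun ω => (fun ω => |f (Y.S x ω) - f ω|) (Y.S a ω)) := by
      funext ω
      simp only [← Y.S_add, add_comm a x]
    rw [e, Y.inv _ ((h.bdd.comp _).sub h.bdd).abs]
    exact H x hx

section corr
variable {Ω : Type u} (Y : Sys ℝ Ω) {κ κ' : Type} [Fintype κ] [Fintype κ']
  {W W' : Type} [AddCommGroup W] [Module ℝ W] [AddCommGroup W'] [Module ℝ W']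

/-- product function -/
def Fp (γ : κ → W →ₗ[ℝ] ℝ) (f : κ → Ω → ℝ) (x : W) (ω : Ω) : ℝ := ∏ i, f i (Y.S (γ i x) ω)

/-- correlation -/
def Corr (γ : κ → W →ₗ[ℝ] ℝ) (f : κ → Ω → ℝ) (x : W) : ℝ := Y.φ (Fp Y γ f x)

variable {Y} {γ : κ → W →ₗ[ℝ] ℝ} {f : κ → Ω → ℝ} {γ' : κ' → W →ₗ[ℝ] ℝ} {f' : κ' → Ω → ℝ}

theorem Fp_abs (hf : ∀ i, GoodF Y (f i)) (x : W) (ω : Ω) : |Fp Y γ f x ω| ≤ 1 := by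
  unfold Fp
  rw [Finset.abs_prod]
  exact Finset.prod_le_one (fun i _ => abs_nonneg _) fun i _ => (hf i).le_one _

theorem Fp_bdd (hf : ∀ i, GoodF Y (f i)) (x : W) : Bdd (Fp Y γ f x) := ⟨1, Fp_abs hf x⟩

theorem Corr_bdd (hf : ∀ i, GoodF Y (f i)) : Bdd (Corr Y γ f) :=
  ⟨1, fun x => Y.mean.abs_le (Fp_abs hf x)⟩

theorem prod_diff {κ : Type} (s : Finset κ) (x y : κ → ℝ) (hx : ∀ i, |x i| ≤ 1)
    (hy : ∀ i, |y i| ≤ 1) : |∏ i ∈ s, x i - ∏ i ∈ s, y i| ≤ ∑ i ∈ s, |x i - y i| := by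
  classical
  induction s using Finset.induction_on with
  | empty => simp
  | insert a s ha ih =>
    rw [Finset.prod_insert ha, Finset.prod_insert ha, Finset.sum_insert ha]
    have h1 : |∏ i ∈ s, x i| ≤ 1 := by
      rw [Finset.abs_prod]; exact Finset.prod_le_one (fun i _ => abs_nonneg _) fun i _ => hx i
    calc |x a * ∏ i ∈ s, x i - y a * ∏ i ∈ s, y i|
        = |(x a - y a) * ∏ i ∈ s, x i + y a * (∏ i ∈ s, x i - ∏ i ∈ s, y i)| := by congr 1; ring
      _ ≤ |x a - y a| * |∏ i ∈ s, x i| + |y a| * |∏ i ∈ s, x i - ∏ i ∈ s, y i| := by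
          refine (abs_add_le _ _).trans ?_
          rw [abs_mul, abs_mul]
      _ ≤ |x a - y a| * 1 + 1 * ∑ i ∈ s, |x i - y i| := by
          gcongr
          exact hy a
      _ = _ := by ring

theorem Fp_diff (hf : ∀ i, GoodF Y (f i)) (x y : W) :
    Y.φ (fun ω => |Fp Y γ f x ω - Fp Y γ f y ω|)
      ≤ ∑ i, Y.φ (fun ω => |f i (Y.S (γ i (x - y)) ω) - f i ω|) := by
  have h1 : ∀ i, Y.φ (fun ω => |f i (Y.S (γ i (x - y)) ω) - f i ω|)
      = Y.φ (fun ω => |f i (Y.S (γ i x) ω) - f i (Y.S (γ i y) ω)|) := by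
    intro i
    rw [← Y.inv _ (((hf i).bdd.comp _).sub (hf i).bdd).abs (γ i y)]
    simp only [← Y.S_add, map_sub, sub_add_cancel]
  simp only [h1]
  rw [← Y.mean.sum fun i _ => (((hf i).bdd.comp _).sub ((hf i).bdd.comp _)).abs]
  refine Y.mean.mono ((Fp_bdd hf x).sub (Fp_bdd hf y)).abs
    (Bdd.sum fun i _ => (((hf i).bdd.comp _).sub ((hf i).bdd.comp _)).abs) fun ω => ?_
  exact prod_diff _ _ _ (fun i => (hf i).le_one _) (fun i => (hf i).le_one _)

theorem Fp_UC (hf : ∀ i, GoodF Y (f i)) (ε : ℝ) (hε : 0 < ε) : ∃ δ > (0 : ℝ), ∀ x y : W,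
    (∀ i, |γ i (x - y)| < δ) → Y.φ (fun ω => |Fp Y γ f x ω - Fp Y γ f y ω|) ≤ ε := by
  have hpos : 0 < ε / (Fintype.card κ + 1) := by positivity
  choose δ hδ H using fun i => (hf i).cont _ hpos
  obtain ⟨d, hd, hd'⟩ : ∃ d > (0 : ℝ), ∀ i, d ≤ δ i := by
    rcases isEmpty_or_nonempty κ with h | h
    · exact ⟨1, one_pos, fun i => h.elim i⟩
    · obtain ⟨i, hi⟩ := Finite.exists_min δ
      exact ⟨δ i, hδ i, hi⟩
  refine ⟨d, hd, fun x y hxy => (Fp_diff hf x y).trans ?_⟩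
  calc _ ≤ ∑ i : κ, ε / (Fintype.card κ + 1) :=
        Finset.sum_le_sum fun i _ => H i _ ((hxy i).trans_le (hd' i))
    _ ≤ ε := by
        rw [Finset.sum_const, nsmul_eq_mul, Finset.card_univ, mul_div_assoc', div_le_iff₀ (by positivity)]
        nlinarith

theorem Corr_diff (hf : ∀ i, GoodF Y (f i)) (x y : W) :
    |Corr Y γ f x - Corr Y γ f y| ≤ Y.φ (fun ω => |Fp Y γ f x ω - Fp Y γ f y ω|) := by
  unfold Corr
  rw [← Y.mean.sub (Fp_bdd hf x) (Fp_bdd hf y)]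
  exact Y.mean.abs_le_abs ((Fp_bdd hf x).sub (Fp_bdd hf y))

theorem Corr_MU (hf : ∀ i, GoodF Y (f i)) : ∃ L, MU (Corr Y γ f) L :=
  thmB_MU (fun i => (γ i).toAddMonoidHom) Y f fun i => (hf i).bdd

theorem Corr_means (hf : ∀ i, GoodF Y (f i)) {m m' : (W → ℝ) → ℝ} (hm : IsMean m) (hm' : IsMean m')
    (ht : TInv m) (ht' : TInv m') : m (Corr Y γ f) = m' (Corr Y γ f) := by
  obtain ⟨L, hL⟩ := Corr_MU (γ := γ) hf
  rw [hL.mean (Corr_bdd hf) hm fun a => ht _ (Corr_bdd hf) a,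
    hL.mean (Corr_bdd hf) hm' fun a => ht' _ (Corr_bdd hf) a]

theorem Fp_mul (x : W) (ω : Ω) :
    Fp Y γ f x ω * Fp Y γ' f' x ω = Fp Y (Sum.elim γ γ') (Sum.elim f f') x ω := by
  unfold Fp
  rw [Fintype.prod_sum_type]; rfl

theorem good_sum (hf : ∀ i, GoodF Y (f i)) (hf' : ∀ i, GoodF Y (f' i)) :
    ∀ i, GoodF Y (Sum.elim f f' i) := by
  rintro (i | i)
  · exact hf i
  · exact hf' i

theorem Fp_affine (A : W' →ₗ[ℝ] W) (a : W) (x : W') (ω : Ω) :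
    Fp Y γ f (A x + a) ω
      = Fp Y (fun i => (γ i).comp A) (fun i ω => f i (Y.S (γ i a) ω)) x ω := by
  unfold Fp
  refine Finset.prod_congr rfl fun i _ => ?_
  simp only [LinearMap.comp_apply, map_add, ← Y.S_add, add_comm]

theorem Fp_lin (A : W' →ₗ[ℝ] W) (x : W') (ω : Ω) :
    Fp Y γ f (A x) ω = Fp Y (fun i => (γ i).comp A) f x ω := rfl

theorem Corr_shift (χ : W →ₗ[ℝ] ℝ) (hf : ∀ i, GoodF Y (f i)) :
    Corr Y (fun i => γ i - χ) f = Corr Y γ f := by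
  funext x
  unfold Corr
  rw [← Y.inv _ (Fp_bdd hf x) (χ x)]
  congr 1; funext ω
  unfold Fp
  refine Finset.prod_congr rfl fun i _ => ?_
  simp only [← Y.S_add, LinearMap.sub_apply, sub_add_cancel]

end corr

section path
variable {q : ℕ} {Ω : Type u}

/-- embedding of the fast directions -/
def io (q : ℕ) : (Fin q → ℝ) →ₗ[ℝ] (Fin (q + 1) → ℝ) where
  toFun t := Fin.cons 0 t
  map_add' a b := by
    funext i; refine Fin.cases ?_ (fun i => ?_) i <;> simp
  map_smul' c b := by
    funext i; refine Fin.cases ?_ (fun i => ?_) i <;> simp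

@[simp] theorem io_zero (t : Fin q → ℝ) : io q t 0 = 0 := rfl
@[simp] theorem io_succ (t : Fin q → ℝ) (i : Fin q) : io q t i.succ = t i := rfl

/-- fast part -/
def tl (q : ℕ) : (Fin (q + 1) → ℝ) →ₗ[ℝ] (Fin q → ℝ) where
  toFun c i := c i.succ
  map_add' a b := rfl
  map_smul' c b := rfl

theorem io_tl {c : Fin (q + 1) → ℝ} (h : c 0 = 0) : io q (tl q c) = c := by
  funext i; refine Fin.cases ?_ (fun i => ?_) i
  · simp [h]
  · simp [tl]

@[simp] theorem tl_io (t : Fin q → ℝ) : tl q (io q t) = t := rfl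

/-- induced unipotent on the fast part -/
def UT (q : ℕ) : Module.End ℝ (Fin q → ℝ) := (tl q).comp ((Um q).comp (io q))

theorem io_UT (t : Fin q → ℝ) : io q (UT q t) = Um q (io q t) := by
  unfold UT; simp only [LinearMap.comp_apply]; rw [io_tl]; simp

theorem Um_it_zero (r : ℕ) (c : Fin (q + 1) → ℝ) : (Um q)^[r] c 0 = c 0 := by
  induction r with
  | zero => rfl
  | succ r ih => rw [Function.iterate_succ_apply']; simpa using ih

theorem io_UT_pow (r : ℕ) (t : Fin q → ℝ) : io q ((UT q ^ r) t) = (Um q)^[r] (io q t) := by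
  induction r with
  | zero => rfl
  | succ r ih =>
    rw [pow_succ', Module.End.mul_apply, io_UT, ih, Function.iterate_succ_apply']

theorem exists_io {c c' : Fin (q + 1) → ℝ} (h : c 0 = c' 0) : ∃ t, c = c' + io q t :=
  ⟨tl q (c - c'), by rw [io_tl (by simp [h])]; simp⟩

variable {E : Type} [AddCommGroup E] [Module ℝ E]

/-- uniformly continuous in the slow coordinate -/
def UCl (Ψ : E × (Fin (q + 1) → ℝ) → ℝ) : Prop :=
  ∀ ε > (0 : ℝ), ∃ δ > (0 : ℝ), ∀ (s : E) (x y : ℝ) (t : Fin q → ℝ), |x - y| < δ →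
    |Ψ (s, Fin.cons x t) - Ψ (s, Fin.cons y t)| ≤ ε

/-- path means -/
structure PM (m : (E × (Fin (q + 1) → ℝ) → ℝ) → ℝ) : Prop where
  mean : IsMean m
  trE : ∀ Ψ, Bdd Ψ → ∀ e : E, m (fun x => Ψ (x.1 + e, x.2)) = m Ψ
  U : ∀ Ψ, Bdd Ψ → UCl Ψ → m (fun x => Ψ (x.1, Um q x.2)) = m Ψ
  th : ∀ Ψ : E × ℝ → ℝ, Bdd Ψ → (∀ ε > (0 : ℝ), ∃ δ > (0 : ℝ), ∀ s x y, |x - y| < δ →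
    |Ψ (s, x) - Ψ (s, y)| ≤ ε) → ∀ a, m (fun x => Ψ (x.1, x.2 0 + a)) = m (fun x => Ψ (x.1, x.2 0))

theorem n_eq {m : (E × (Fin (q + 1) → ℝ) → ℝ) → ℝ} (hm : PM m) {m0 : ((Fin q → ℝ) → ℝ) → ℝ}
    (h0 : IsMean m0) (ht : TInv m0) {Ψ : E × (Fin (q + 1) → ℝ) → ℝ} (hb : Bdd Ψ) (hU : UCl Ψ)
    {L : ℝ} (hL : MU Ψ L) : m (fun x => m0 (fun t => Ψ (x + (0, io q t)))) = L := by
  have hn : IsMean (fun G : E × (Fin (q + 1) → ℝ) → ℝ =>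
      m (fun x => m0 (fun t => G (x + (0, io q t))))) :=
    hm.mean.bind (k := fun x G => m0 (fun t => G (x + (0, io q t)))) fun x => h0.map _
  refine hL.mean hb hn fun a => ?_
  obtain ⟨e, c⟩ := a
  set g0 : E × ℝ → ℝ := fun p => m0 (fun t => Ψ (p.1, Fin.cons p.2 t)) with hg0
  have key : ∀ x : E × (Fin (q + 1) → ℝ), m0 (fun t => Ψ (x + (0, io q t))) = g0 (x.1, x.2 0) := by
    rintro ⟨s, d⟩
    have := ht (fun t => Ψ (s, Fin.cons (d 0) t)) (hb.comp _) (tl q d)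
    rw [hg0]; simp only
    rw [← this]
    congr 1; funext t; congr 1
    refine Prod.ext (by simp) (funext fun i => ?_)
    refine Fin.cases ?_ (fun i => ?_) i
    · simp
    · simp [tl, add_comm]
  have hg0b : Bdd g0 := by
    obtain ⟨C, hC⟩ := hb
    exact ⟨C, fun p => h0.abs_le fun t => hC _⟩
  have e1 : ∀ x : E × (Fin (q + 1) → ℝ), m0 (fun t => Ψ (x + (0, io q t) + (e, c)))
      = g0 (x.1 + e, x.2 0 + c 0) := by
    intro x
    have := key (x + (e, c))
    simp only [Prod.fst_add, Prod.snd_add, Pi.add_apply] at this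
    rw [← this]; congr 1; funext t; congr 1; abel
  simp only [e1, key]
  rw [hm.trE (fun x => g0 (x.1, x.2 0 + c 0)) (hg0b.comp _) e]
  refine hm.th g0 hg0b ?_ _
  intro ε hε
  obtain ⟨δ, hδ, H⟩ := hU ε hε
  exact ⟨δ, hδ, fun s x y hxy => h0.sub_abs_le (hb.comp _) (hb.comp _) fun t => H s x y t hxy⟩

/-- class of a linear form -/
def cls (γ : E × (Fin (q + 1) → ℝ) →ₗ[ℝ] ℝ) : (Fin q → ℝ) →ₗ[ℝ] ℝ :=
  γ.comp ((LinearMap.inr ℝ E _).comp (io q))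

theorem cls_apply (γ : E × (Fin (q + 1) → ℝ) →ₗ[ℝ] ℝ) (t : Fin q → ℝ) :
    cls γ t = γ (0, io q t) := rfl

theorem Corr_UCl {Y : Sys ℝ Ω} {κ : Type} [Fintype κ] {γ : κ → E × (Fin (q + 1) → ℝ) →ₗ[ℝ] ℝ}
    {f : κ → Ω → ℝ} (hf : ∀ i, GoodF Y (f i)) : UCl (Corr Y γ f) := by
  intro ε hε
  obtain ⟨δ, hδ, H⟩ := Fp_UC (γ := γ) hf ε hε
  set e0 : E × (Fin (q + 1) → ℝ) := (0, Pi.single 0 1) with he0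
  set Cc := ∑ i, |γ i e0| with hCc
  have hC0 : 0 ≤ Cc := Finset.sum_nonneg fun _ _ => abs_nonneg _
  refine ⟨δ / (Cc + 1), by positivity, fun s x y t hxy => (Corr_diff hf _ _).trans (H _ _ fun i => ?_)⟩
  have e : ((s, Fin.cons x t) - (s, Fin.cons y t) : E × (Fin (q + 1) → ℝ)) = (x - y) • e0 := by
    refine Prod.ext (by simp [he0]) (funext fun j => ?_)
    refine Fin.cases ?_ (fun j => ?_) j <;> simp [he0]
  rw [e, map_smul, smul_eq_mul, abs_mul]
  have : |γ i e0| ≤ Cc := Finset.single_le_sum (f := fun i => |γ i e0|) (fun _ _ => abs_nonneg _)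
    (Finset.mem_univ i)
  rw [lt_div_iff₀ (by positivity)] at hxy
  nlinarith [abs_nonneg (x - y)]

/-- the statement for classes in `B ∪ {0}` -/
def St (Y : Sys ℝ Ω) (q : ℕ) (B : Set ((Fin q → ℝ) →ₗ[ℝ] ℝ)) : Prop :=
  ∀ (E : Type) [AddCommGroup E] [Module ℝ E] (κ : Type) [Fintype κ]
    (γ : κ → E × (Fin (q + 1) → ℝ) →ₗ[ℝ] ℝ) (f : κ → Ω → ℝ), (∀ i, GoodF Y (f i)) →
    (∀ i, cls (γ i) ∈ B ∨ cls (γ i) = 0) →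
    ∀ m : (E × (Fin (q + 1) → ℝ) → ℝ) → ℝ, PM m → ∀ L, MU (Corr Y γ f) L → m (Corr Y γ f) = L

theorem cls_zero_inv {γ : E × (Fin (q + 1) → ℝ) →ₗ[ℝ] ℝ} (h : cls γ = 0)
    (x : E × (Fin (q + 1) → ℝ)) (t : Fin q → ℝ) : γ (x + (0, io q t)) = γ x := by
  rw [map_add, ← cls_apply, h]; simp

theorem St_base (Y : Sys ℝ Ω) (B : Set ((Fin q → ℝ) →ₗ[ℝ] ℝ)) (hB : ∀ l ∈ B, l = 0) :
    St Y q B := by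
  intro E _ _ κ _ γ f hf hc m hm L hL
  have hc' : ∀ i, cls (γ i) = 0 := fun i => (hc i).elim (hB _) id
  obtain ⟨m0, h0, ht⟩ := exists_invMean (Fin q → ℝ)
  rw [← n_eq hm h0 ht (Corr_bdd hf) (Corr_UCl hf) hL]
  congr 1; funext x
  rw [← h0.const (Corr Y γ f x)]
  congr 1; funext t
  unfold Corr Fp
  simp only [cls_zero_inv (hc' _)]

theorem St_low {Y : Sys ℝ Ω} {B : Set ((Fin q → ℝ) →ₗ[ℝ] ℝ)} (a : (Fin q → ℝ) →ₗ[ℝ] ℝ)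
    (hS : St Y q B) {κ : Type} [Fintype κ]
    (γ : κ → E × (Fin (q + 1) → ℝ) →ₗ[ℝ] ℝ) (f : κ → Ω → ℝ) (hf : ∀ i, GoodF Y (f i))
    (hc : ∀ i, cls (γ i) - a ∈ B)
    (m : (E × (Fin (q + 1) → ℝ) → ℝ) → ℝ) (hm : PM m)
    (m' : (E × (Fin (q + 1) → ℝ) → ℝ) → ℝ) (hm' : IsMean m') (ht' : TInv m') :
    m (Corr Y γ f) = m' (Corr Y γ f) := by
  set χ : E × (Fin (q + 1) → ℝ) →ₗ[ℝ] ℝ := a.comp ((tl q).comp (LinearMap.snd ℝ _ _)) with hχ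
  have hcl : ∀ i, cls (γ i - χ) = cls (γ i) - a := by
    intro i; refine LinearMap.ext fun t => ?_
    simp [cls_apply, hχ]
  rw [← Corr_shift χ hf]
  obtain ⟨L, hL⟩ := Corr_MU (γ := fun i => γ i - χ) hf
  rw [hS E κ _ f hf (fun i => Or.inl (by rw [hcl]; exact hc i)) m hm L hL,
    hL.mean (Corr_bdd hf) hm' fun a => ht' _ (Corr_bdd hf) a]

end path

end P13

set_option linter.unusedVariables false
set_option linter.unusedSectionVars false

namespace P13
universe u

theorem Um_inj (q : ℕ) : Function.Injective (Um q) := by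
  rw [injective_iff_map_eq_zero]
  intro d hd
  funext i
  induction i using Fin.induction with
  | zero => have := congrFun hd 0; simpa using this
  | succ i ih => have := congrFun hd i.succ; simpa [ih] using this

section
variable {q : ℕ} {E : Type} [AddCommGroup E] [Module ℝ E]

theorem exists_UInv (q : ℕ) (E : Type) [AddCommGroup E] [Module ℝ E] :
    ∃ m : (E × (Fin (q + 1) → ℝ) → ℝ) → ℝ, IsMean m ∧ TInv m ∧
      ∀ g, Bdd g → m (fun x => g (x.1, Um q x.2)) = m g := by
  obtain ⟨m, hm, ht⟩ := exists_invMean (E × (Fin (q + 1) → ℝ))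
  obtain ⟨ν, hν, hνt⟩ := exists_invMean ℤ
  set eU : (Fin (q + 1) → ℝ) ≃ₗ[ℝ] (Fin (q + 1) → ℝ) := LinearEquiv.ofInjectiveEndo (Um q) (Um_inj q)
  set e : (E × (Fin (q + 1) → ℝ)) ≃ₗ[ℝ] (E × (Fin (q + 1) → ℝ)) :=
    LinearEquiv.prodCongr (LinearEquiv.refl ℝ E) eU with he
  have hex : ∀ x, e x = (x.1, Um q x.2) := fun x => rfl
  refine ⟨fun g => ν (fun r => m (fun x => g ((e ^ r) x))),
    hν.bind (k := fun r g => m (fun x => g ((e ^ r) x))) fun r => hm.map _, ?_, ?_⟩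
  · intro g hg a
    show ν _ = ν _
    congr 1; funext r
    have := ht (fun x => g ((e ^ r) x)) (hg.comp _) ((e ^ r).symm a)
    simpa using this
  · intro g hg
    show ν _ = ν _
    have hb : Bdd (fun r : ℤ => m (fun x => g ((e ^ r) x))) := by
      obtain ⟨C, hC⟩ := hg
      exact ⟨C, fun r => hm.abs_le fun x => hC _⟩
    rw [← hνt _ hb 1]
    congr 1; funext r
    congr 1; funext x
    beta_reduce
    rw [← hex, add_comm r 1, zpow_add, zpow_one]; rfl

theorem PM_hat {m : (E × (Fin (q + 1) → ℝ) → ℝ) → ℝ} (hm : PM m) {m0 : ((Fin q → ℝ) → ℝ) → ℝ}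
    (h0 : IsMean m0) (ht : TInv m0) :
    PM (E := E × (Fin q → ℝ)) (fun Ψ => m (fun x => m0 (fun t => Ψ ((x.1, t), x.2)))) where
  mean := hm.mean.bind (k := fun x Ψ => m0 (fun t => Ψ ((x.1, t), x.2))) fun x => h0.map _
  trE Ψ hΨ e := by
    have hb : Bdd (fun x : E × (Fin (q + 1) → ℝ) => m0 (fun t => Ψ ((x.1, t), x.2))) := by
      obtain ⟨C, hC⟩ := hΨ
      exact ⟨C, fun r => h0.abs_le fun x => hC _⟩
    show m _ = m _
    rw [← hm.trE _ hb e.1]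
    congr 1; funext x
    exact ht (fun t => Ψ ((x.1 + e.1, t), x.2)) (hΨ.comp _) e.2
  U Ψ hΨ hu := by
    have hb : Bdd (fun x : E × (Fin (q + 1) → ℝ) => m0 (fun t => Ψ ((x.1, t), x.2))) := by
      obtain ⟨C, hC⟩ := hΨ
      exact ⟨C, fun r => h0.abs_le fun x => hC _⟩
    refine hm.U _ hb ?_
    intro ε hε
    obtain ⟨δ, hδ, H⟩ := hu ε hε
    exact ⟨δ, hδ, fun s x y t hxy => h0.sub_abs_le (hΨ.comp _) (hΨ.comp _) fun t' => H _ x y t hxy⟩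
  th Ψ hΨ hu a := by
    have hb : Bdd (fun x : E × ℝ => m0 (fun t => Ψ ((x.1, t), x.2))) := by
      obtain ⟨C, hC⟩ := hΨ
      exact ⟨C, fun r => h0.abs_le fun x => hC _⟩
    refine hm.th (fun x : E × ℝ => m0 (fun t => Ψ ((x.1, t), x.2))) hb ?_ a
    intro ε hε
    obtain ⟨δ, hδ, H⟩ := hu ε hε
    exact ⟨δ, hδ, fun s x y hxy => h0.sub_abs_le (hΨ.comp _) (hΨ.comp _) fun t' => H _ x y hxy⟩

theorem TInv_hat {m : (E × (Fin (q + 1) → ℝ) → ℝ) → ℝ} (hm : IsMean m) (hmt : TInv m)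
    {m0 : ((Fin q → ℝ) → ℝ) → ℝ} (h0 : IsMean m0) (ht : TInv m0) :
    IsMean (fun Ψ : (E × (Fin q → ℝ)) × (Fin (q + 1) → ℝ) → ℝ =>
      m (fun x => m0 (fun t => Ψ ((x.1, t), x.2)))) ∧
    TInv (fun Ψ : (E × (Fin q → ℝ)) × (Fin (q + 1) → ℝ) → ℝ =>
      m (fun x => m0 (fun t => Ψ ((x.1, t), x.2)))) := by
  refine ⟨hm.bind (k := fun x Ψ => m0 (fun t => Ψ ((x.1, t), x.2))) fun x => h0.map _, ?_⟩
  intro Ψ hΨ a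
  have hb : Bdd (fun x : E × (Fin (q + 1) → ℝ) => m0 (fun t => Ψ ((x.1, t), x.2))) := by
    obtain ⟨C, hC⟩ := hΨ
    exact ⟨C, fun r => h0.abs_le fun x => hC _⟩
  show m _ = m _
  rw [← hmt _ hb (a.1.1, a.2)]
  congr 1; funext x
  exact ht (fun t => Ψ ((x.1 + a.1.1, t), x.2 + a.2)) (hΨ.comp _) a.1.2

theorem sq_expand {Z I : Type*} {K : (Z → ℝ) → ℝ} (hK : IsMean K) (w : Wt I) (f : I → Z → ℝ)
    (hf : ∀ i, Bdd (f i)) : K (fun z => avg w (fun i => f i z) ^ 2)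
      = avg w (fun i => avg w (fun i' => K (fun z => f i z * f i' z))) := by
  have e : (fun z => avg w (fun i => f i z) ^ 2)
      = (fun z => avg w (fun i => avg w (fun i' => f i z * f i' z))) := by
    funext z
    simp only [avg_smul, avg_smul_right, pow_two]
  rw [e, avg_comm_mean hK w (F := fun i z => avg w (fun i' => f i z * f i' z))
    (fun i => Bdd.avg w (F := fun i' z => f i z * f i' z) fun i' => (hf i).mul (hf i'))]
  congr 1; funext i
  exact avg_comm_mean hK w (F := fun i' z => f i z * f i' z) fun i' => (hf i).mul (hf i')

theorem mix_expand {Z I J : Type*} {K : (Z → ℝ) → ℝ} (hK : IsMean K) (w : Wt I) (v : Wt J)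
    (f : I → Z → ℝ) (g : J → Z → ℝ)
    (hf : ∀ i, Bdd (f i)) (hg : ∀ i, Bdd (g i)) :
    K (fun z => avg w (fun i => f i z) * avg v (fun j => g j z))
      = avg w (fun i => avg v (fun j => K (fun z => f i z * g j z))) := by
  have e : (fun z => avg w (fun i => f i z) * avg v (fun j => g j z))
      = (fun z => avg w (fun i => avg v (fun i' => f i z * g i' z))) := by
    funext z
    simp only [avg_smul, avg_smul_right]
  rw [e, avg_comm_mean hK w (F := fun i z => avg v (fun i' => f i z * g i' z))
    (fun i => Bdd.avg v (F := fun i' z => f i z * g i' z) fun i' => (hf i).mul (hg i'))]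
  congr 1; funext i
  exact avg_comm_mean hK v (F := fun i' z => f i z * g i' z) fun i' => (hf i).mul (hg i')

theorem diff_expand {Z I J : Type*} {K : (Z → ℝ) → ℝ} (hK : IsMean K) (w : Wt I) (v : Wt J)
    (f : I → Z → ℝ) (g : J → Z → ℝ)
    (hf : ∀ i, Bdd (f i)) (hg : ∀ i, Bdd (g i)) :
    K (fun z => (avg w (fun i => f i z) - avg v (fun j => g j z)) ^ 2)
      = avg w (fun i => avg w (fun i' => K (fun z => f i z * f i' z)))
        - 2 * avg w (fun i => avg v (fun j => K (fun z => f i z * g j z)))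
        + avg v (fun j => avg v (fun j' => K (fun z => g j z * g j' z))) := by
  have ha : Bdd (fun z => avg w (fun i => f i z)) := Bdd.avg w hf
  have hb : Bdd (fun z => avg v (fun i => g i z)) := Bdd.avg v hg
  rw [← sq_expand hK w f hf, ← sq_expand hK v g hg, ← mix_expand hK w v f g hf hg,
    ← hK.smul 2 (ha.mul hb), ← hK.sub ha.sq ((ha.mul hb).cmul 2), ← hK.add (ha.sq.sub
      ((ha.mul hb).cmul 2)) hb.sq]
  congr 1; funext z; ring

end

end P13

set_option linter.unusedVariables false
set_option linter.unusedSectionVars false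

namespace P13
universe u

section
variable {q : ℕ} {E : Type} [AddCommGroup E] [Module ℝ E] {Ω : Type u}

/-- `(s,t,c) ↦ (s, U^r c)` -/
def lA (q : ℕ) (E : Type) [AddCommGroup E] [Module ℝ E] (r : ℕ) :
    (E × (Fin q → ℝ)) × (Fin (q + 1) → ℝ) →ₗ[ℝ] E × (Fin (q + 1) → ℝ) :=
  LinearMap.prod ((LinearMap.fst ℝ _ _).comp (LinearMap.fst ℝ _ _))
    (((Um q) ^ r : Module.End ℝ (Fin (q + 1) → ℝ)).comp (LinearMap.snd ℝ _ _))

theorem lA_apply (r : ℕ) (y : (E × (Fin q → ℝ)) × (Fin (q + 1) → ℝ)) :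
    lA q E r y = (y.1.1, (Um q)^[r] y.2) := by
  simp [lA, Module.End.pow_apply]

/-- `(s,t,c) ↦ (s, c + ι t)` -/
def lB (q : ℕ) (E : Type) [AddCommGroup E] [Module ℝ E] :
    (E × (Fin q → ℝ)) × (Fin (q + 1) → ℝ) →ₗ[ℝ] E × (Fin (q + 1) → ℝ) :=
  LinearMap.prod ((LinearMap.fst ℝ _ _).comp (LinearMap.fst ℝ _ _))
    (LinearMap.snd ℝ _ _ + (io q).comp ((LinearMap.snd ℝ _ _).comp (LinearMap.fst ℝ _ _)))

theorem lB_apply (y : (E × (Fin q → ℝ)) × (Fin (q + 1) → ℝ)) :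
    lB q E y = (y.1.1, y.2 + io q y.1.2) := by
  simp [lB]

/-- the affine maps used in the step: linear part -/
def Xl (q : ℕ) (E : Type) [AddCommGroup E] [Module ℝ E] : ℕ ⊕ (Fin q → ℝ) →
    ((E × (Fin q → ℝ)) × (Fin (q + 1) → ℝ) →ₗ[ℝ] E × (Fin (q + 1) → ℝ))
  | Sum.inl r => lA q E r
  | Sum.inr u => lB q E

/-- the affine maps used in the step: constant part -/
def Xc (q : ℕ) (E : Type) [AddCommGroup E] [Module ℝ E] : ℕ ⊕ (Fin q → ℝ) →
    E × (Fin (q + 1) → ℝ)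
  | Sum.inl r => 0
  | Sum.inr u => (0, io q u)

/-- power of the unipotent -/
def Xr (q : ℕ) : ℕ ⊕ (Fin q → ℝ) → ℕ
  | Sum.inl r => r
  | Sum.inr u => 0

theorem cls_X (γ : E × (Fin (q + 1) → ℝ) →ₗ[ℝ] ℝ) (k : ℕ ⊕ (Fin q → ℝ)) :
    cls (γ.comp (Xl q E k)) = (cls γ).comp (UT q ^ Xr q k) := by
  refine LinearMap.ext fun t => ?_
  rcases k with r | u
  · simp only [Xl, Xr, cls_apply, LinearMap.comp_apply, lA_apply, io_UT_pow]; rfl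
  · simp only [Xl, Xr, cls_apply, LinearMap.comp_apply, lB_apply, io_UT_pow]
    simp

variable {Y : Sys ℝ Ω} {κ : Type} [Fintype κ] {γ : κ → E × (Fin (q + 1) → ℝ) →ₗ[ℝ] ℝ}
  {f : κ → Ω → ℝ}

/-- the functions in the step -/
def XF (Y : Sys ℝ Ω) (γ : κ → E × (Fin (q + 1) → ℝ) →ₗ[ℝ] ℝ) (f : κ → Ω → ℝ)
    (k : ℕ ⊕ (Fin q → ℝ)) (z : ((E × (Fin q → ℝ)) × (Fin (q + 1) → ℝ)) × Ω) : ℝ :=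
  Fp Y γ f (Xl q E k z.1 + Xc q E k) z.2

theorem XF_inl (r : ℕ) (s : E) (t : Fin q → ℝ) (c : Fin (q + 1) → ℝ) (ω : Ω) :
    XF Y γ f (Sum.inl r) (((s, t), c), ω) = Fp Y γ f (s, (Um q)^[r] c) ω := by
  unfold XF; simp [Xl, Xc, lA_apply]

theorem XF_inr (u : Fin q → ℝ) (s : E) (t : Fin q → ℝ) (c : Fin (q + 1) → ℝ) (ω : Ω) :
    XF Y γ f (Sum.inr u) (((s, t), c), ω) = Fp Y γ f ((s, c) + (0, io q (t + u))) ω := by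
  unfold XF; simp [Xl, Xc, lB_apply, add_assoc]

theorem XF_bdd (hf : ∀ i, GoodF Y (f i)) (k) : Bdd (XF Y γ f k) := ⟨1, fun z => Fp_abs hf _ _⟩

theorem X_pair {a : (Fin q → ℝ) →ₗ[ℝ] ℝ} {B : Set ((Fin q → ℝ) →ₗ[ℝ] ℝ)}
    (hlow : ∀ r r' : ℕ, St Y q {l | ∃ l' ∈ B, l' ≠ 0 ∧
      (l = l'.comp (UT q ^ r) - a ∨ l = l'.comp (UT q ^ r') - a)})
    (hf : ∀ i, GoodF Y (f i)) (hc : ∀ i, cls (γ i) ∈ B) (hc0 : ∀ i, cls (γ i) ≠ 0)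
    (k k' : ℕ ⊕ (Fin q → ℝ))
    {m m' : ((E × (Fin q → ℝ)) × (Fin (q + 1) → ℝ) → ℝ) → ℝ} (hm : PM m)
    (hm' : IsMean m') (ht' : TInv m') :
    m (fun y => Y.φ (fun ω => XF Y γ f k (y, ω) * XF Y γ f k' (y, ω)))
      = m' (fun y => Y.φ (fun ω => XF Y γ f k (y, ω) * XF Y γ f k' (y, ω))) := by
  unfold XF
  simp only [Fp_affine, Fp_mul]
  refine St_low (a := a) (hlow (Xr q k) (Xr q k')) _ _
    (good_sum (fun i => (hf i).shift _) (fun i => (hf i).shift _)) ?_ m hm m' hm' ht'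
  rintro (i | i)
  · exact ⟨cls (γ i), hc i, hc0 i, Or.inl (by rw [Sum.elim_inl, cls_X])⟩
  · exact ⟨cls (γ i), hc i, hc0 i, Or.inr (by rw [Sum.elim_inr, cls_X])⟩

theorem V_iter (r : ℕ) (x : (E × (Fin (q + 1) → ℝ)) × Ω) :
    (fun x : (E × (Fin (q + 1) → ℝ)) × Ω => ((x.1.1, Um q x.1.2), x.2))^[r] x
      = ((x.1.1, (Um q)^[r] x.1.2), x.2) := by
  induction r with
  | zero => rfl
  | succ r ih => rw [Function.iterate_succ_apply', ih, Function.iterate_succ_apply']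

set_option maxHeartbeats 4000000 in
theorem step_core {a : (Fin q → ℝ) →ₗ[ℝ] ℝ} {B : Set ((Fin q → ℝ) →ₗ[ℝ] ℝ)}
    (hlow : ∀ r r' : ℕ, St Y q {l | ∃ l' ∈ B, l' ≠ 0 ∧
      (l = l'.comp (UT q ^ r) - a ∨ l = l'.comp (UT q ^ r') - a)})
    (hf : ∀ i, GoodF Y (f i)) (hc : ∀ i, cls (γ i) ∈ B) (hc0 : ∀ i, cls (γ i) ≠ 0)
    {m : ((E × (Fin q → ℝ)) × (Fin (q + 1) → ℝ) → ℝ) → ℝ} (hm : PM m) (ε : ℝ) (hε : 0 < ε) :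
    ∃ (R : ℕ) (w : Wt (Fin q → ℝ)), m (fun y => Y.φ (fun ω =>
      (avg (prog (1 : ℤ) R) (fun r => XF Y γ f (Sum.inl r.toNat) (y, ω))
        - avg w (fun u => XF Y γ f (Sum.inr u) (y, ω))) ^ 2)) ≤ 3 * ε := by
  obtain ⟨M0, hM0, hM0t, hM0U⟩ := exists_UInv q E
  obtain ⟨m0, h0, h0t⟩ := exists_invMean (Fin q → ℝ)
  set F := Fp Y γ f with hF
  obtain ⟨hm', ht'⟩ := TInv_hat hM0 hM0t h0 h0t
  set m' := (fun Ψ : (E × (Fin q → ℝ)) × (Fin (q + 1) → ℝ) → ℝ =>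
      M0 (fun x => m0 (fun t => Ψ ((x.1, t), x.2)))) with hm'def
  have hFb : ∀ x, Bdd (F x) := Fp_bdd hf
  have hφb : ∀ {W : Type} (P Q : W → E × (Fin (q + 1) → ℝ)),
      Bdd (fun y => Y.φ (fun ω => F (P y) ω * F (Q y) ω)) := fun P Q =>
    ⟨1, fun y => Y.mean.abs_le fun ω => by
      rw [abs_mul]
      exact mul_le_one₀ (Fp_abs hf _ _) (abs_nonneg _) (Fp_abs hf _ _)⟩
  -- M
  set M : ((E × (Fin (q + 1) → ℝ)) × Ω → ℝ) → ℝ :=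
    fun H => M0 (fun x => Y.φ (fun ω => H (x, ω))) with hMdef
  have hM : IsMean M := hM0.bind_pair (k := fun _ => Y.φ) fun _ => Y.mean
  have hMb : ∀ {H : (E × (Fin (q + 1) → ℝ)) × Ω → ℝ}, Bdd H →
      Bdd (fun x => Y.φ (fun ω => H (x, ω))) := by
    rintro H ⟨C, hC⟩
    exact ⟨C, fun x => Y.mean.abs_le fun ω => hC _⟩
  -- h
  set h : (Fin q → ℝ) → ℝ := fun t => M0 (fun x => Y.φ (fun ω => F x ω * F (x + (0, io q t)) ω))
    with hh
  have hb : Bdd h := by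
    refine ⟨1, fun t => hM0.abs_le fun x => Y.mean.abs_le fun ω => ?_⟩
    rw [abs_mul]
    exact mul_le_one₀ (Fp_abs hf _ _) (abs_nonneg _) (Fp_abs hf _ _)
  set p := M0 (fun x => m0 (fun t => Y.φ (fun ω => F x ω * F (x + (0, io q t)) ω))) with hp
  -- h is MU
  have hMU : ∃ L, MU h L := by
    let YQ : Sys (Fin q → ℝ) ((E × (Fin (q + 1) → ℝ)) × Ω) :=
      { φ := M
        mean := hM
        S := fun t z => (z.1 + (0, io q t), z.2)
        S_zero := fun z => by
          show (z.1 + (0, io q 0), z.2) = z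
          rw [map_zero]; exact Prod.ext (add_zero z.1) rfl
        S_add := fun a b z => by
          refine Prod.ext ?_ rfl
          simp only [map_add, add_assoc]
          congr 1
          refine Prod.ext (by simp) ?_
          simp [add_comm]
        inv := fun H hH g => hM0t (fun x => Y.φ (fun ω => H (x, ω))) (hMb hH) (0, io q g) }
    obtain ⟨L, hL⟩ := thmB_MU (κ := Bool) (fun b => if b then AddMonoidHom.id (Fin q → ℝ) else 0) YQ
      (fun _ z => F z.1 z.2) (fun _ => ⟨1, fun z => Fp_abs hf _ _⟩)
    refine ⟨L, ?_⟩
    convert hL using 1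
    funext t
    simp only [Fintype.prod_bool]
    show M0 _ = M0 _
    congr 1; funext x
    congr 1; funext ω
    show _ = F (x + (0, io q t)) ω * F (x + (0, io q 0)) ω
    rw [map_zero, show ((0, 0) : E × (Fin (q + 1) → ℝ)) = 0 from rfl, add_zero, mul_comm]
  obtain ⟨L, hL⟩ := hMU
  have hLm : m0 h = L := hL.mean hb h0 fun a => h0t h hb a
  have hpL : p = L := by
    rw [← hLm]
    set l2 : (E × (Fin (q + 1) → ℝ)) × (Fin q → ℝ) →ₗ[ℝ] E × (Fin (q + 1) → ℝ) :=
      LinearMap.fst ℝ _ _ + (LinearMap.inr ℝ E _).comp ((io q).comp (LinearMap.snd ℝ _ _)) with hl2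
    have hl2a : ∀ x t, l2 (x, t) = x + (0, io q t) := fun x t => by simp [hl2]
    have e : ∀ x t, Y.φ (fun ω => F x ω * F (x + (0, io q t)) ω)
        = Corr Y (Sum.elim (fun i => (γ i).comp (LinearMap.fst ℝ _ _)) (fun i => (γ i).comp l2))
          (Sum.elim f f) (x, t) := by
      intro x t
      unfold Corr
      congr 1; funext ω
      rw [← Fp_mul, ← Fp_lin, ← Fp_lin, hl2a]; rfl
    rw [hp, hh]
    simp only [e]
    set Cr := Corr Y (Sum.elim (fun i => (γ i).comp (LinearMap.fst ℝ _ _)) (fun i => (γ i).comp l2))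
          (Sum.elim f f) with hCr
    have hg := good_sum hf hf
    refine Corr_means (m := fun G => M0 (fun x => m0 (fun t => G (x, t))))
      (m' := fun G => m0 (fun t => M0 (fun x => G (x, t)))) hg
      (hM0.bind_pair fun _ => h0) (h0.bind (k := fun t G => M0 (fun x => G (x, t)))
        fun t => hM0.map _) ?_ ?_
    · intro G hG b
      show M0 _ = M0 _
      rw [← hM0t (fun x => m0 (fun t => G (x, t))) (by
        obtain ⟨C, hC⟩ := hG
        exact ⟨C, fun x => h0.abs_le fun t => hC _⟩) b.1]
      congr 1; funext x
      exact h0t (fun t => G (x + b.1, t)) (hG.comp _) b.2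
    · intro G hG b
      show m0 _ = m0 _
      rw [← h0t (fun t => M0 (fun x => G (x, t))) (by
        obtain ⟨C, hC⟩ := hG
        exact ⟨C, fun x => hM0.abs_le fun t => hC _⟩) b.2]
      congr 1; funext t
      exact hM0t (fun x => G (x, t + b.2)) (hG.comp _) b.1
  -- choose w and R
  obtain ⟨w, hw⟩ := hL ε hε
  have hτ : ∀ u u' : Fin q → ℝ, M (fun z => F (z.1 + (0, io q u)) z.2 * F (z.1 + (0, io q u')) z.2)
      = h (u' - u) := by
    intro u u'
    rw [hMdef, hh]
    simp only
    rw [← hM0t (fun x => Y.φ (fun ω => F x ω * F (x + (0, io q (u' - u))) ω)) (hφb _ _) (0, io q u)]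
    congr 1; funext x; congr 1; funext ω; congr 2
    rw [add_assoc]; congr 1
    refine Prod.ext (by simp) ?_
    simp
  have hbw : M (fun z => avg w (fun u => F (z.1 + (0, io q u)) z.2) ^ 2) ≤ p + ε := by
    rw [sq_expand hM w (fun u z => F (z.1 + (0, io q u)) z.2) fun u => ⟨1, fun z => Fp_abs hf _ _⟩]
    simp only [hτ]
    have h1 : ∀ u, avg w (fun u' => h (u' - u)) ≤ p + ε := fun u => by
      have := (abs_le.1 (hw (-u))).2
      rw [hpL]
      have e : avg w (fun u' => h (u' - u)) = avg w (fun u' => h (-u + u')) := by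
        congr 1; funext u'; congr 1; abel
      rw [e]; linarith
    refine (avg_isMean w).le_const ?_ h1
    obtain ⟨C, hC⟩ := hb
    exact ⟨C, fun u => avg_abs_le w fun u' => hC _⟩
  have hFM : Bdd (fun z : (E × (Fin (q + 1) → ℝ)) × Ω => F z.1 z.2) := ⟨1, fun z => Fp_abs hf _ _⟩
  obtain ⟨R, hR⟩ := mautner_mean (α := (E × (Fin (q + 1) → ℝ)) × Ω) (M := M) hM (q := q)
    (τ := fun c z => (z.1 + (0, c), z.2)) (V := fun x => ((x.1.1, Um q x.1.2), x.2))
    (fun c H hH => hM0t (fun x => Y.φ (fun ω => H (x, ω))) (hMb hH) (0, c))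
    (fun H hH => hM0U (fun x => Y.φ (fun ω => H (x, ω))) (hMb hH))
    (fun x => Prod.ext (add_zero x.1) rfl)
    (fun a b x => by
      refine Prod.ext ?_ rfl
      simp only [add_assoc]
      congr 1
      refine Prod.ext (by simp) ?_
      simp [add_comm])
    (fun c x => by
      refine Prod.ext (Prod.ext ?_ ?_) rfl <;> simp)
    (fun z => F z.1 z.2) hFM
    (by
      intro c
      have key : ∀ n : ℕ, M (fun x => (F (x.1 + (0, ((n : ℝ) + 1)⁻¹ • c)) x.2 - F x.1 x.2) ^ 2)
          ≤ 2 * M0 (fun x => Y.φ (fun ω => |F (x + (0, ((n : ℝ) + 1)⁻¹ • c)) ω - F x ω|)) := by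
        intro n
        rw [hMdef]
        simp only
        have b1 : Bdd (fun x => Y.φ (fun ω => |F (x + (0, ((n : ℝ) + 1)⁻¹ • c)) ω - F x ω|)) :=
          hMb (H := fun z => |F (z.1 + (0, ((n : ℝ) + 1)⁻¹ • c)) z.2 - F z.1 z.2|)
            (((hFM.comp (fun z : (E × (Fin (q + 1) → ℝ)) × Ω =>
              (z.1 + (0, ((n : ℝ) + 1)⁻¹ • c), z.2))).sub hFM).abs)
        have b2 : Bdd (fun x => Y.φ (fun ω => (F (x + (0, ((n : ℝ) + 1)⁻¹ • c)) ω - F x ω) ^ 2)) :=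
          hMb (H := fun z => (F (z.1 + (0, ((n : ℝ) + 1)⁻¹ • c)) z.2 - F z.1 z.2) ^ 2)
            (((hFM.comp (fun z : (E × (Fin (q + 1) → ℝ)) × Ω =>
              (z.1 + (0, ((n : ℝ) + 1)⁻¹ • c), z.2))).sub hFM).sq)
        rw [← hM0.smul 2 b1]
        refine hM0.mono b2 (b1.cmul 2) fun x => ?_
        rw [← Y.mean.smul 2 ((hFb _).sub (hFb _)).abs]
        refine Y.mean.mono ((hFb _).sub (hFb _)).sq (((hFb _).sub (hFb _)).abs.cmul 2) fun ω => ?_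
        rw [← sq_abs]
        have h1 := Fp_abs (γ := γ) hf (x + (0, ((n : ℝ) + 1)⁻¹ • c)) ω
        have h2 := Fp_abs (γ := γ) hf x ω
        have h3 := abs_sub (F (x + (0, ((n : ℝ) + 1)⁻¹ • c)) ω) (F x ω)
        nlinarith [abs_nonneg (F (x + (0, ((n : ℝ) + 1)⁻¹ • c)) ω - F x ω)]
      rw [Metric.tendsto_atTop]
      intro e he
      obtain ⟨δ, hδ, H⟩ := Fp_UC (γ := γ) hf (e / 4) (by positivity)
      have ht : ∀ i, ∀ᶠ n : ℕ in atTop, |γ i (0, ((n : ℝ) + 1)⁻¹ • c)| < δ := by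
        intro i
        have e1 : ∀ n : ℕ, |γ i (0, ((n : ℝ) + 1)⁻¹ • c)| = ((n : ℝ) + 1)⁻¹ * |γ i (0, c)| := by
          intro n
          have : ((0, ((n : ℝ) + 1)⁻¹ • c) : E × (Fin (q + 1) → ℝ)) = ((n : ℝ) + 1)⁻¹ • (0, c) := by
            simp
          rw [this, map_smul, smul_eq_mul, abs_mul, abs_of_pos (by positivity)]
        simp only [e1]
        have : Tendsto (fun n : ℕ => ((n : ℝ) + 1)⁻¹ * |γ i (0, c)|) atTop (nhds (0 * |γ i (0, c)|)) := by
          refine Tendsto.mul_const _ ?_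
          simpa using tendsto_one_div_add_atTop_nhds_zero_nat (𝕜 := ℝ)
        rw [zero_mul] at this
        exact this.eventually_lt_const hδ
      obtain ⟨N, hN⟩ := eventually_atTop.1 (eventually_all.2 ht)
      refine ⟨N, fun n hn => ?_⟩
      have h1 : M0 (fun x => Y.φ (fun ω => |F (x + (0, ((n : ℝ) + 1)⁻¹ • c)) ω - F x ω|)) ≤ e / 4 := by
        refine hM0.le_const (hMb (H := fun z => |F (z.1 + (0, ((n : ℝ) + 1)⁻¹ • c)) z.2 - F z.1 z.2|)
            (((hFM.comp (fun z : (E × (Fin (q + 1) → ℝ)) × Ω =>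
              (z.1 + (0, ((n : ℝ) + 1)⁻¹ • c), z.2))).sub hFM).abs)) fun x => H (x + (0, ((n : ℝ) + 1)⁻¹ • c)) x fun i => ?_
        rw [add_sub_cancel_left]; exact hN n hn i
      have h2 : 0 ≤ M (fun x => (F (x.1 + (0, ((n : ℝ) + 1)⁻¹ • c)) x.2 - F x.1 x.2) ^ 2) :=
        hM.nonneg (((hFM.comp (fun z : (E × (Fin (q + 1) → ℝ)) × Ω =>
              (z.1 + (0, ((n : ℝ) + 1)⁻¹ • c), z.2))).sub hFM).sq) fun x => sq_nonneg _
      rw [Real.dist_eq, sub_zero]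
      show |M (fun x => (F (x.1 + (0, ((n : ℝ) + 1)⁻¹ • c)) x.2 - F x.1 x.2) ^ 2)| < e
      rw [abs_of_nonneg h2]
      linarith [key n])
    (w.map (io q)) (by
      intro c hc
      simp only [Wt.map, List.mem_map] at hc
      obtain ⟨t, _, rfl⟩ := hc
      rfl) ε hε
  simp only [V_iter, avg_map] at hR
  refine ⟨R, w, ?_⟩
  set K : (((E × (Fin q → ℝ)) × (Fin (q + 1) → ℝ)) × Ω → ℝ) → ℝ :=
    fun H => m (fun x => Y.φ (fun ω => H (x, ω))) with hKdef
  set K' : (((E × (Fin q → ℝ)) × (Fin (q + 1) → ℝ)) × Ω → ℝ) → ℝ :=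
    fun H => m' (fun x => Y.φ (fun ω => H (x, ω))) with hK'def
  have hK : IsMean K := hm.mean.bind_pair (k := fun _ => Y.φ) fun _ => Y.mean
  have hKK : ∀ k k', K (fun z => XF Y γ f k z * XF Y γ f k' z)
      = K' (fun z => XF Y γ f k z * XF Y γ f k' z) := fun k k' =>
    X_pair hlow hf hc hc0 k k' hm hm' ht'
  have v1 : ∀ r r' : ℕ, K' (fun z => XF Y γ f (Sum.inl r) z * XF Y γ f (Sum.inl r') z)
      = M (fun z => F (z.1.1, (Um q)^[r] z.1.2) z.2 * F (z.1.1, (Um q)^[r'] z.1.2) z.2) := by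
    intro r r'
    show M0 _ = M0 _
    congr 1; funext x
    simp only [XF_inl]
    exact h0.const _
  have v2 : ∀ (r : ℕ) u, K' (fun z => XF Y γ f (Sum.inl r) z * XF Y γ f (Sum.inr u) z) = p := by
    intro r u
    set Hp : E × (Fin (q + 1) → ℝ) → ℝ :=
      fun x => m0 (fun t => Y.φ (fun ω => F x ω * F (x + (0, io q t)) ω)) with hHp
    have hHb : Bdd Hp := ⟨1, fun x => h0.abs_le fun t => Y.mean.abs_le fun ω => by
      rw [abs_mul]
      exact mul_le_one₀ (Fp_abs hf _ _) (abs_nonneg _) (Fp_abs hf _ _)⟩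
    have hUr : ∀ r : ℕ, M0 (fun x => Hp (x.1, (Um q)^[r] x.2)) = p := by
      intro r
      induction r with
      | zero => rfl
      | succ r ih =>
        rw [← ih, ← hM0U (fun x => Hp (x.1, (Um q)^[r] x.2)) (hHb.comp _)]
        rfl
    rw [← hUr r]
    show M0 _ = M0 _
    congr 1; funext x
    obtain ⟨s, c⟩ := x
    simp only [XF_inl, XF_inr]
    obtain ⟨t', ht'⟩ := exists_io (Um_it_zero r c).symm
    rw [hHp]
    simp only
    rw [← h0t (fun t => Y.φ (fun ω => F (s, (Um q)^[r] c) ω * F ((s, (Um q)^[r] c) + (0, io q t)) ω))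
      (hφb _ _) (t' + u)]
    congr 1; funext t; congr 1; funext ω; congr 2
    refine Prod.ext (by simp) ?_
    simp only [Prod.snd_add, map_add]
    generalize (Um q)^[r] c = d at ht'
    rw [ht']; abel
  have v3 : ∀ u u', K' (fun z => XF Y γ f (Sum.inr u) z * XF Y γ f (Sum.inr u') z)
      = h (u' - u) := by
    intro u u'
    rw [← hτ u u']
    have e : ∀ x : E × (Fin (q + 1) → ℝ), Y.φ (fun ω => F (x + (0, io q u)) ω * F (x + (0, io q u')) ω)
        = Corr Y (Sum.elim (fun i => (γ i).comp LinearMap.id) (fun i => (γ i).comp LinearMap.id))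
          (Sum.elim (fun i ω => f i (Y.S (γ i (0, io q u)) ω))
            (fun i ω => f i (Y.S (γ i (0, io q u')) ω))) x := by
      intro x
      unfold Corr
      congr 1; funext ω
      rw [← Fp_mul, ← Fp_affine, ← Fp_affine]; rfl
    have hg := good_sum (fun i => (hf i).shift (γ i (0, io q u)))
      (fun i => (hf i).shift (γ i (0, io q u')))
    have e2 : K' (fun z => XF Y γ f (Sum.inr u) z * XF Y γ f (Sum.inr u') z)
        = M0 (fun x => m0 (fun t => (fun x => Y.φ (fun ω => F (x + (0, io q u)) ω *
          F (x + (0, io q u')) ω)) (x + (0, io q t)))) := by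
      show M0 _ = M0 _
      congr 1; funext x; congr 1; funext t
      show Y.φ _ = Y.φ _
      congr 1; funext ω
      show XF Y γ f (Sum.inr u) (((x.1, t), x.2), ω) * XF Y γ f (Sum.inr u') (((x.1, t), x.2), ω) = _
      rw [XF_inr, XF_inr, add_assoc, add_assoc]
      obtain ⟨x1, x2⟩ := x
      simp only [map_add, Prod.mk_add_mk, add_zero]
      rfl
    rw [e2]
    simp only [e]
    have e3 : M (fun z => F (z.1 + (0, io q u)) z.2 * F (z.1 + (0, io q u')) z.2)
        = M0 (fun x => Y.φ (fun ω => F (x + (0, io q u)) ω * F (x + (0, io q u')) ω)) := rfl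
    rw [e3]
    simp only [e]
    refine Corr_means (m := fun G => M0 (fun x => m0 (fun t => G (x + (0, io q t))))) hg
      (hM0.bind (k := fun x G => m0 (fun t => G (x + (0, io q t)))) fun x => h0.map _) hM0 ?_ hM0t
    intro G hG b
    show M0 _ = M0 _
    rw [← hM0t (fun x => m0 (fun t => G (x + (0, io q t)))) (by
        obtain ⟨C, hC⟩ := hG
        exact ⟨C, fun x => h0.abs_le fun t => hC _⟩) b]
    congr 1; funext x; congr 1; funext t; exact congrArg G (by abel)
  have key := diff_expand hK (prog (1 : ℤ) R) w (fun r z => XF Y γ f (Sum.inl r.toNat) z)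
    (fun u z => XF Y γ f (Sum.inr u) z) (fun _ => XF_bdd hf _) (fun _ => XF_bdd hf _)
  refine (le_of_eq key).trans ?_
  simp only [hKK, v1, v2, v3, (avg_isMean _).const]
  rw [sq_expand hM (prog (1 : ℤ) R) (fun r z => F (z.1.1, (Um q)^[r.toNat] z.1.2) z.2)
    fun r => ⟨1, fun z => Fp_abs hf _ _⟩] at hR
  have hbw' := hbw
  rw [sq_expand hM w (fun u z => F (z.1 + (0, io q u)) z.2) fun u => ⟨1, fun z => Fp_abs hf _ _⟩]
    at hbw'
  simp only [hτ] at hbw'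
  linarith
end

end P13

set_option linter.unusedVariables false
set_option linter.unusedSectionVars false

namespace P13
universe u

section
variable {q : ℕ} {E : Type} [AddCommGroup E] [Module ℝ E] {Ω : Type u}
variable {Y : Sys ℝ Ω} {κ : Type} [Fintype κ] {γ : κ → E × (Fin (q + 1) → ℝ) →ₗ[ℝ] ℝ}
  {f : κ → Ω → ℝ}

theorem m_Ur (hf : ∀ i, GoodF Y (f i)) {m : (E × (Fin (q + 1) → ℝ) → ℝ) → ℝ} (hm : PM m) (r : ℕ) :
    m (fun x => Corr Y γ f (x.1, (Um q)^[r] x.2)) = m (Corr Y γ f) := by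
  induction r with
  | zero => rfl
  | succ r ih =>
    rw [← ih]
    set l : E × (Fin (q + 1) → ℝ) →ₗ[ℝ] E × (Fin (q + 1) → ℝ) :=
      LinearMap.prodMap LinearMap.id ((Um q) ^ r : Module.End ℝ (Fin (q + 1) → ℝ)) with hl
    have e : (fun x : E × (Fin (q + 1) → ℝ) => Corr Y γ f (x.1, (Um q)^[r] x.2))
        = Corr Y (fun i => (γ i).comp l) f := by
      funext x
      unfold Corr
      congr 1; funext ω
      rw [← Fp_lin]; congr 1
      simp [hl, Module.End.pow_apply]
    have h2 := hm.U (Corr Y (fun i => (γ i).comp l) f) (Corr_bdd hf) (Corr_UCl hf)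
    rw [← e] at h2
    rw [← h2]; rfl

theorem Fp_zero_inv (h : ∀ i, cls (γ i) = 0) (x : E × (Fin (q + 1) → ℝ)) (t : Fin q → ℝ) (ω : Ω) :
    Fp Y γ f (x + (0, io q t)) ω = Fp Y γ f x ω := by
  unfold Fp; simp only [cls_zero_inv (h _)]

theorem St_step (Y : Sys ℝ Ω) (B : Set ((Fin q → ℝ) →ₗ[ℝ] ℝ)) (a : (Fin q → ℝ) →ₗ[ℝ] ℝ)
    (hlow : ∀ r r' : ℕ, St Y q {l | ∃ l' ∈ B, l' ≠ 0 ∧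
      (l = l'.comp (UT q ^ r) - a ∨ l = l'.comp (UT q ^ r') - a)}) : St Y q B := by
  classical
  intro E _ _ κ _ γ f hf hc m hm L hL
  set G := Fp Y (fun i : {i // cls (γ i) = 0} => γ i) (fun i => f i) with hG
  set F := Fp Y (fun i : {i // ¬ cls (γ i) = 0} => γ i) (fun i => f i) with hF
  have hGF : ∀ x ω, Fp Y γ f x ω = G x ω * F x ω := by
    intro x ω
    rw [hG, hF]; unfold Fp
    rw [Fintype.prod_subtype_mul_prod_subtype (fun i => cls (γ i) = 0)
      (fun i => f i (Y.S (γ i x) ω))]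
  have hGi : ∀ x t ω, G (x + (0, io q t)) ω = G x ω := fun x t ω =>
    Fp_zero_inv (fun i => i.2) x t ω
  obtain ⟨m0, h0, ht⟩ := exists_invMean (Fin q → ℝ)
  have hmh := PM_hat hm h0 ht
  set mh := (fun Ψ : (E × (Fin q → ℝ)) × (Fin (q + 1) → ℝ) → ℝ =>
    m (fun x => m0 (fun t => Ψ ((x.1, t), x.2)))) with hmhd
  have hfG : ∀ i : {i // cls (γ i) = 0}, GoodF Y (f i) := fun i => hf i
  have hfF : ∀ i : {i // ¬ cls (γ i) = 0}, GoodF Y (f i) := fun i => hf i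
  set K : (((E × (Fin q → ℝ)) × (Fin (q + 1) → ℝ)) × Ω → ℝ) → ℝ :=
    fun H => mh (fun x => Y.φ (fun ω => H (x, ω))) with hKdef
  have hK : IsMean K := hmh.mean.bind_pair (k := fun _ => Y.φ) fun _ => Y.mean
  set Gh : ((E × (Fin q → ℝ)) × (Fin (q + 1) → ℝ)) × Ω → ℝ :=
    fun z => G (z.1.1.1, z.1.2) z.2 with hGh
  have hGb : Bdd Gh := ⟨1, fun z => Fp_abs hfG _ _⟩
  set X := XF Y (fun i : {i // ¬ cls (γ i) = 0} => γ i) (fun i => f i) with hX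
  have hXb : ∀ k, Bdd (X k) := XF_bdd hfF
  have vA : ∀ r : ℕ, K (fun z => Gh z * X (Sum.inl r) z) = m (Corr Y γ f) := by
    intro r
    rw [← m_Ur hf hm r]
    show m _ = m _
    congr 1; funext x
    rw [← h0.const (Corr Y γ f (x.1, (Um q)^[r] x.2))]
    congr 1; funext t
    show Y.φ _ = Y.φ _
    congr 1; funext ω
    rw [hGF]
    show G x ω * X (Sum.inl r) (((x.1, t), x.2), ω) = _
    rw [hX, XF_inl]
    congr 1
    obtain ⟨t', h'⟩ := exists_io (Um_it_zero r x.2)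
    rw [h', ← hGi x t' ω]
    congr 1
    refine Prod.ext (by simp) ?_
    simp
  have vB : ∀ u, K (fun z => Gh z * X (Sum.inr u) z) = L := by
    intro u
    rw [← n_eq hm h0 ht (Corr_bdd hf) (Corr_UCl hf) hL]
    show m _ = m _
    congr 1; funext x
    rw [← ht (fun t => Corr Y γ f (x + (0, io q t))) ((Corr_bdd hf).comp _) u]
    congr 1; funext t
    show Y.φ _ = Y.φ _
    congr 1; funext ω
    rw [hGF]
    show G x ω * X (Sum.inr u) (((x.1, t), x.2), ω) = _
    rw [hX, XF_inr, hGi]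
  have key : ∀ ε : ℝ, 0 < ε → (m (Corr Y γ f) - L) ^ 2 ≤ 3 * ε := by
    intro ε hε
    obtain ⟨R, w, hRw⟩ := step_core (γ := fun i : {i // ¬ cls (γ i) = 0} => γ i)
      (f := fun i => f i) hlow hfF (fun i => (hc i).resolve_right i.2) (fun i => i.2) hmh ε hε
    have hb1 : Bdd (fun z => avg (prog (1 : ℤ) R) (fun r => X (Sum.inl r.toNat) z)) :=
      Bdd.avg _ fun r => hXb _
    have hb2 : Bdd (fun z => avg w (fun u => X (Sum.inr u) z)) := Bdd.avg _ fun r => hXb _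
    have hcs := hK.cauchy hGb (hb1.sub hb2)
    have e : K (fun z => Gh z * (avg (prog (1 : ℤ) R) (fun r => X (Sum.inl r.toNat) z)
        - avg w (fun u => X (Sum.inr u) z))) = m (Corr Y γ f) - L := by
      simp only [mul_sub]
      rw [hK.sub (hGb.mul hb1) (hGb.mul hb2)]
      simp only [← avg_smul]
      rw [avg_comm_mean hK (prog (1 : ℤ) R) (F := fun (r : ℤ) z => Gh z * X (Sum.inl r.toNat) z)
          fun r => hGb.mul (hXb _),
        avg_comm_mean hK w (F := fun u z => Gh z * X (Sum.inr u) z) fun r => hGb.mul (hXb _)]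
      simp only [vA, vB, (avg_isMean _).const]
    rw [e] at hcs
    refine hcs.trans ?_
    have h1 : K (fun z => Gh z ^ 2) ≤ 1 := by
      refine hK.le_const hGb.sq fun z => ?_
      have := Fp_abs (γ := fun i : {i // cls (γ i) = 0} => γ i) hfG (z.1.1.1, z.1.2) z.2
      rw [← sq_abs]
      exact pow_le_one₀ (abs_nonneg _) this
    have h2 : 0 ≤ K (fun z => (avg (prog (1 : ℤ) R) (fun r => X (Sum.inl r.toNat) z)
        - avg w (fun u => X (Sum.inr u) z)) ^ 2) := hK.nonneg (hb1.sub hb2).sq fun _ => sq_nonneg _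
    calc _ ≤ 1 * _ := mul_le_mul_of_nonneg_right h1 h2
      _ ≤ 3 * ε := by rw [one_mul]; exact hRw
  have h0' : (m (Corr Y γ f) - L) ^ 2 ≤ 0 := by
    refine le_of_forall_pos_le_add fun ε hε => ?_
    have := key (ε / 3) (by positivity)
    linarith
  have := pow_eq_zero_iff (two_ne_zero) |>.1 (le_antisymm h0' (sq_nonneg _))
  linarith

/-- reducible systems of classes -/
inductive Red (q : ℕ) : Set ((Fin q → ℝ) →ₗ[ℝ] ℝ) → Prop
  | base (B : Set ((Fin q → ℝ) →ₗ[ℝ] ℝ)) (h : ∀ l ∈ B, l = 0) : Red q B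
  | step (B : Set ((Fin q → ℝ) →ₗ[ℝ] ℝ)) (a : (Fin q → ℝ) →ₗ[ℝ] ℝ)
    (h : ∀ r r' : ℕ, Red q {l | ∃ l' ∈ B, l' ≠ 0 ∧
      (l = l'.comp (UT q ^ r) - a ∨ l = l'.comp (UT q ^ r') - a)}) : Red q B

theorem Red.st {B : Set ((Fin q → ℝ) →ₗ[ℝ] ℝ)} (h : Red q B) (Y : Sys ℝ Ω) : St Y q B := by
  induction h with
  | base B h => exact St_base Y B h
  | step B a h ih => exact St_step Y B a ih

end
end P13

set_option linter.unusedVariables false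
set_option linter.unusedSectionVars false

namespace P13
universe u

section
variable {q : ℕ}

/-- vanishing above `p` -/
def Hi (l : (Fin q → ℝ) →ₗ[ℝ] ℝ) (p : Fin q) : Prop := ∀ j, p < j → l (Pi.single j 1) = 0

/-- leading coefficient -/
def Ld (l : (Fin q → ℝ) →ₗ[ℝ] ℝ) (p : Fin q) (c : ℝ) : Prop :=
  c ≠ 0 ∧ l (Pi.single p 1) = c ∧ Hi l p

theorem UT_lead (l : (Fin q → ℝ) →ₗ[ℝ] ℝ) (j : Fin q) (h : Hi l j) :
    l (UT q (Pi.single j 1)) = l (Pi.single j 1) := by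
  have e : UT q (Pi.single j 1) = Pi.single j 1
      + fun i : Fin q => io q (Pi.single j 1) i.castSucc := by
    funext i
    show Um q (io q (Pi.single j 1)) i.succ = _
    rw [Um_succ]; rfl
  rw [e, map_add, LinearMap.pi_apply_eq_sum_univ l (fun i : Fin q => io q (Pi.single j 1) i.castSucc)]
  rw [Finset.sum_eq_zero, add_zero]
  intro i _
  have e2 : (fun k => if i = k then (1 : ℝ) else 0) = Pi.single i 1 := by
    funext k; rw [Pi.single_apply]; simp [eq_comm]
  rw [e2]
  by_cases hij : j < i
  · rw [h i hij, smul_zero]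
  · have : io q (Pi.single j (1 : ℝ)) i.castSucc = 0 := by
      have : i.castSucc ≠ j.succ := by
        intro h'
        apply hij
        have := congrArg Fin.val h'
        simp at this
        rw [Fin.lt_def]; omega
      generalize i.castSucc = z at this
      revert this
      refine Fin.cases ?_ (fun z => ?_) z
      · simp
      · intro hz
        rw [io_succ, Pi.single_apply, if_neg]
        rintro rfl; exact hz rfl
    rw [this, zero_smul]

theorem Hi_comp {l : (Fin q → ℝ) →ₗ[ℝ] ℝ} {p : Fin q} (h : Hi l p) (r : ℕ) :
    Hi (l.comp (UT q ^ r)) p ∧ l.comp (UT q ^ r) (Pi.single p 1) = l (Pi.single p 1) := by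
  induction r with
  | zero => exact ⟨h, rfl⟩
  | succ r ih =>
    have e : l.comp (UT q ^ (r + 1)) = (l.comp (UT q ^ r)).comp (UT q) := by
      rw [pow_succ]; rfl
    rw [e]
    constructor
    · intro j hj
      rw [LinearMap.comp_apply, UT_lead _ _ fun k hk => ih.1 k (hj.trans hk), ih.1 j hj]
    · rw [LinearMap.comp_apply, UT_lead _ _ ih.1, ih.2]

theorem Ld_unique {l : (Fin q → ℝ) →ₗ[ℝ] ℝ} {p p' : Fin q} {c c' : ℝ} (h : Ld l p c)
    (h' : Ld l p' c') : p = p' ∧ c = c' := by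
  have : p = p' := by
    rcases lt_trichotomy p p' with hh | hh | hh
    · exact absurd (h'.2.1.symm.trans (h.2.2 _ hh)) h'.1
    · exact hh
    · exact absurd (h.2.1.symm.trans (h'.2.2 _ hh)) h.1
  subst this
  exact ⟨rfl, h.2.1.symm.trans h'.2.1⟩

theorem exists_Ld {l : (Fin q → ℝ) →ₗ[ℝ] ℝ} (h : l ≠ 0) : ∃ p c, Ld l p c := by
  classical
  have hne : (Finset.univ.filter fun j => l (Pi.single j 1) ≠ 0).Nonempty := by
    by_contra hn
    rw [Finset.not_nonempty_iff_eq_empty, Finset.filter_eq_empty_iff] at hn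
    apply h
    refine LinearMap.pi_ext' fun i => LinearMap.ext_ring ?_
    have := hn (Finset.mem_univ i)
    simpa using this
  refine ⟨_, _, (Finset.mem_filter.1 (Finset.max'_mem _ hne)).2, rfl, fun j hj => ?_⟩
  by_contra hc
  exact absurd (Finset.le_max' _ j (Finset.mem_filter.2 ⟨Finset.mem_univ _, hc⟩)) (not_le.2 hj)

/-- leading coefficients at `p` -/
def Sp (B : Set ((Fin q → ℝ) →ₗ[ℝ] ℝ)) (p : Fin q) : Set ℝ := {c | ∃ l ∈ B, Ld l p c}

theorem Sp_finite {B : Set ((Fin q → ℝ) →ₗ[ℝ] ℝ)} (hB : B.Finite) (p : Fin q) : (Sp B p).Finite := by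
  refine (hB.image fun l => l (Pi.single p 1)).subset ?_
  rintro c ⟨l, hl, h⟩
  exact ⟨l, hl, h.2.1⟩

theorem Red_all (B : Set ((Fin q → ℝ) →ₗ[ℝ] ℝ)) (hB : B.Finite) : Red q B := by
  classical
  have wf : WellFounded (Pi.Lex (β := fun _ : Fin q => ℕ) (fun i j => j < i) (fun {i} a b => a < b)) :=
    Pi.Lex.wellFounded _ fun i => wellFounded_lt
  have hind : ∀ N : Fin q → ℕ, ∀ B : Set ((Fin q → ℝ) →ₗ[ℝ] ℝ), B.Finite →
      (fun p => (Sp B p).ncard) = N → Red q B := by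
    intro N
    induction N using wf.induction with
    | h N ih =>
    intro B hB hN
    by_cases hz : ∀ l ∈ B, l = 0
    · exact Red.base B hz
    push Not at hz
    obtain ⟨l0, hl0, hl0n⟩ := hz
    have hne : (Finset.univ.filter fun p => (Sp B p).Nonempty).Nonempty := by
      obtain ⟨p, c, h⟩ := exists_Ld hl0n
      exact ⟨p, Finset.mem_filter.2 ⟨Finset.mem_univ _, c, l0, hl0, h⟩⟩
    set p := Finset.min' _ hne with hp
    obtain ⟨ca, a, haB, ha⟩ := (Finset.mem_filter.1 (Finset.min'_mem _ hne)).2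
    rw [← hp] at ha
    have hmin : ∀ l ∈ B, ∀ p' c, Ld l p' c → p ≤ p' := fun l hl p' c h =>
      Finset.min'_le _ _ (Finset.mem_filter.2 ⟨Finset.mem_univ _, c, l, hl, h⟩)
    refine Red.step B a fun r r' => ?_
    set B' : Set ((Fin q → ℝ) →ₗ[ℝ] ℝ) := {l | ∃ l' ∈ B, l' ≠ 0 ∧
      (l = l'.comp (UT q ^ r) - a ∨ l = l'.comp (UT q ^ r') - a)} with hB'
    have hB'f : B'.Finite := by
      refine ((hB.image fun l => l.comp (UT q ^ r) - a).union
        (hB.image fun l => l.comp (UT q ^ r') - a)).subset ?_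
      rintro l ⟨l', hl', _, h | h⟩
      · exact Or.inl ⟨l', hl', h.symm⟩
      · exact Or.inr ⟨l', hl', h.symm⟩
    have hgt : ∀ l' ∈ B, ∀ p' c, p < p' → Ld l' p' c → ∀ s : ℕ, Ld (l'.comp (UT q ^ s) - a) p' c := by
      intro l' hl' p' c hpp h s
      obtain ⟨h1, h2⟩ := Hi_comp h.2.2 s
      refine ⟨h.1, ?_, fun j hj => ?_⟩
      · rw [LinearMap.sub_apply, h2, h.2.1, ha.2.2 p' hpp, sub_zero]
      · rw [LinearMap.sub_apply, h1 j hj, ha.2.2 j (hpp.trans hj), sub_zero]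
    have heq : ∀ l' ∈ B, ∀ c, Ld l' p c → ∀ s : ℕ, Hi (l'.comp (UT q ^ s) - a) p ∧
        (l'.comp (UT q ^ s) - a) (Pi.single p 1) = c - ca := by
      intro l' hl' c h s
      obtain ⟨h1, h2⟩ := Hi_comp h.2.2 s
      refine ⟨fun j hj => ?_, ?_⟩
      · rw [LinearMap.sub_apply, h1 j hj, ha.2.2 j hj, sub_zero]
      · rw [LinearMap.sub_apply, h2, h.2.1, ha.2.1]
    have hrep : ∀ l ∈ B', ∃ l' ∈ B, l' ≠ 0 ∧ ∃ s : ℕ, l = l'.comp (UT q ^ s) - a := by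
      rintro l ⟨l', hl', hn, h | h⟩
      · exact ⟨l', hl', hn, r, h⟩
      · exact ⟨l', hl', hn, r', h⟩
    refine ih (fun p => (Sp B' p).ncard) ⟨p, fun j hj => ?_, ?_⟩ B' hB'f rfl
    · rw [← hN]
      show (Sp B' j).ncard = (Sp B j).ncard
      congr 1
      ext c
      constructor
      · rintro ⟨l, hl, h⟩
        obtain ⟨l', hl', hn, s, rfl⟩ := hrep l hl
        obtain ⟨p', c', h'⟩ := exists_Ld hn
        rcases (hmin l' hl' p' c' h').lt_or_eq with hlt | he
        · obtain ⟨rfl, rfl⟩ := Ld_unique h (hgt l' hl' p' c' hlt h' s)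
          exact ⟨l', hl', h'⟩
        · rw [← he] at h'
          exact absurd (h.2.1.symm.trans ((heq l' hl' c' h' s).1 j hj)) h.1
      · rintro ⟨l', hl', h⟩
        refine ⟨_, ⟨l', hl', ?_, Or.inl rfl⟩, hgt l' hl' j c hj h r⟩
        rintro rfl
        exact h.1 h.2.1.symm
    · rw [← hN]
      show (Sp B' p).ncard < (Sp B p).ncard
      have hsub : Sp B' p ⊆ (fun c => c - ca) '' (Sp B p \ {ca}) := by
        rintro c ⟨l, hl, h⟩
        obtain ⟨l', hl', hn, s, rfl⟩ := hrep l hl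
        obtain ⟨p', c', h'⟩ := exists_Ld hn
        rcases (hmin l' hl' p' c' h').lt_or_eq with hlt | he
        · obtain ⟨h1, _⟩ := Ld_unique h (hgt l' hl' p' c' hlt h' s)
          exact absurd h1 hlt.ne
        · rw [← he] at h'
          have h2 := (heq l' hl' c' h' s).2
          rw [h.2.1] at h2
          refine ⟨c', ⟨⟨l', hl', h'⟩, ?_⟩, h2.symm⟩
          rintro rfl
          exact h.1 (by rw [h2]; simp)
      have hf1 : (Sp B p \ {ca}).Finite := (Sp_finite hB p).subset Set.diff_subset
      calc (Sp B' p).ncard ≤ ((fun c => c - ca) '' (Sp B p \ {ca})).ncard :=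
            Set.ncard_le_ncard hsub (hf1.image _)
        _ ≤ (Sp B p \ {ca}).ncard := Set.ncard_image_le hf1
        _ < (Sp B p).ncard := Set.ncard_diff_singleton_lt_of_mem ⟨a, haB, ha⟩ (Sp_finite hB p)
  exact hind _ B hB rfl

/-- **Path theorem.** -/
theorem path_main {Ω : Type u} (Y : Sys ℝ Ω) {E : Type} [AddCommGroup E] [Module ℝ E] {κ : Type}
    [Fintype κ] {γ : κ → E × (Fin (q + 1) → ℝ) →ₗ[ℝ] ℝ} {f : κ → Ω → ℝ} (hf : ∀ i, GoodF Y (f i))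
    {m : (E × (Fin (q + 1) → ℝ) → ℝ) → ℝ} (hm : PM m) {L : ℝ} (hL : MU (Corr Y γ f) L) :
    m (Corr Y γ f) = L :=
  (Red_all (Set.range fun i => cls (γ i)) (Set.finite_range _)).st Y E κ γ f hf
    (fun i => Or.inl ⟨i, rfl⟩) m hm L hL

end
end P13

set_option linter.unusedVariables false
set_option linter.unusedSectionVars false

namespace P13

/-! uniform averages over finite types -/

/-- uniform average -/
noncomputable def ex {X : Type*} [Finite X] (f : X → ℝ) : ℝ :=
  (∑ x ∈ (Set.finite_univ (α := X)).toFinset, f x) / Nat.card X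

theorem ex_eq {X : Type*} [Fintype X] (f : X → ℝ) : ex f = (∑ x, f x) / Fintype.card X := by
  unfold ex
  rw [Nat.card_eq_fintype_card]
  congr 2
  ext x; simp

theorem bdd_fin {X : Type*} [Finite X] (f : X → ℝ) : Bdd f := by
  obtain ⟨C, hC⟩ := (Set.finite_range fun x => |f x|).bddAbove
  exact ⟨C, fun x => hC ⟨x, rfl⟩⟩

theorem ex_isMean {X : Type*} [Finite X] [Nonempty X] : IsMean (ex (X := X)) where
  add _ _ := by unfold ex; rw [Finset.sum_add_distrib, add_div]
  smul c _ _ := by unfold ex; rw [← Finset.mul_sum, mul_div_assoc]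
  nonneg _ h := div_nonneg (Finset.sum_nonneg fun x _ => h x) (Nat.cast_nonneg _)
  one := by
    letI := Fintype.ofFinite X
    rw [ex_eq]; simp

theorem ex_equiv {X X' : Type*} [Finite X] [Finite X'] (e : X ≃ X') (f : X' → ℝ) :
    ex (fun x => f (e x)) = ex f := by
  letI := Fintype.ofFinite X
  letI := Fintype.ofFinite X'
  rw [ex_eq, ex_eq, Equiv.sum_comp e f, Fintype.card_congr e]

theorem ex_prod {X X' : Type*} [Finite X] [Finite X'] (f : X × X' → ℝ) :
    ex f = ex (fun x => ex (fun y => f (x, y))) := by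
  letI := Fintype.ofFinite X
  letI := Fintype.ofFinite X'
  simp only [ex_eq]
  rw [Fintype.sum_prod_type, Fintype.card_prod, ← Finset.sum_div, div_div]
  push_cast
  rw [mul_comm]

theorem ex_comm {X X' : Type*} [Finite X] [Finite X'] (f : X → X' → ℝ) :
    ex (fun x => ex (fun y => f x y)) = ex (fun y => ex (fun x => f x y)) := by
  have h1 := ex_prod (fun p : X × X' => f p.1 p.2)
  have h2 := ex_prod (fun p : X' × X => f p.2 p.1)
  have h3 := ex_equiv (Equiv.prodComm X X') (fun p : X' × X => f p.2 p.1)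
  simp only at h1 h2 h3
  rw [← h1, ← h2, ← h3]; rfl

theorem exists_ge_of_ex {X : Type*} [Finite X] [Nonempty X] {f : X → ℝ} {c : ℝ} (h : c ≤ ex f) :
    ∃ x, c ≤ f x := by
  by_contra hn
  push Not at hn
  letI := Fintype.ofFinite X
  rw [ex_eq, le_div_iff₀ (by exact_mod_cast Fintype.card_pos)] at h
  have : ∑ x, f x < ∑ _x : X, c := Finset.sum_lt_sum_of_nonempty Finset.univ_nonempty fun x _ => hn x
  rw [Finset.sum_const, Finset.card_univ, nsmul_eq_mul] at this
  linarith [mul_comm c (Fintype.card X : ℝ)]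

theorem ex_mono {X : Type*} [Finite X] {f g : X → ℝ} (h : ∀ x, f x ≤ g x) : ex f ≤ ex g := by
  unfold ex
  exact div_le_div_of_nonneg_right (Finset.sum_le_sum fun x _ => h x) (Nat.cast_nonneg _)

theorem ex_add {X : Type*} [Finite X] (f g : X → ℝ) : ex (fun x => f x + g x) = ex f + ex g := by
  unfold ex; rw [Finset.sum_add_distrib, add_div]
theorem ex_sub {X : Type*} [Finite X] (f g : X → ℝ) : ex (fun x => f x - g x) = ex f - ex g := by
  unfold ex; rw [Finset.sum_sub_distrib, sub_div]
theorem ex_smul {X : Type*} [Finite X] (c : ℝ) (f : X → ℝ) : ex (fun x => c * f x) = c * ex f := by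
  unfold ex; rw [← Finset.mul_sum, mul_div_assoc]
theorem ex_const {X : Type*} [Finite X] [Nonempty X] (c : ℝ) : ex (fun _ : X => c) = c :=
  ex_isMean.const c
theorem ex_nonneg {X : Type*} [Finite X] {f : X → ℝ} (h : ∀ x, 0 ≤ f x) : 0 ≤ ex f :=
  div_nonneg (Finset.sum_nonneg fun x _ => h x) (Nat.cast_nonneg _)
theorem ex_sum {X I : Type*} [Finite X] (s : Finset I) (F : I → X → ℝ) :
    ex (fun x => ∑ i ∈ s, F i x) = ∑ i ∈ s, ex (F i) := by
  unfold ex; rw [Finset.sum_comm, Finset.sum_div]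

/-- a single point has mass at least `1/card` -/
theorem single_le_ex {X : Type*} [Finite X] {f : X → ℝ} (h : ∀ x, 0 ≤ f x) (x : X) :
    f x / Nat.card X ≤ ex f := by
  unfold ex
  refine div_le_div_of_nonneg_right ?_ (Nat.cast_nonneg _)
  exact Finset.single_le_sum (f := f) (fun x _ => h x) (by simp)

open Classical in
/-- indicator of a proposition -/
noncomputable def ind (p : Prop) : ℝ := if p then 1 else 0

theorem ind_true {p : Prop} (h : p) : ind p = 1 := if_pos h
theorem ind_false {p : Prop} (h : ¬ p) : ind p = 0 := if_neg h
theorem ind_nonneg (p : Prop) : 0 ≤ ind p := by unfold ind; split_ifs <;> simp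
theorem ind_le_one (p : Prop) : ind p ≤ 1 := by unfold ind; split_ifs <;> simp
theorem ind_and (p r : Prop) : ind (p ∧ r) = ind p * ind r := by
  by_cases hp : p <;> by_cases hr : r <;> simp [ind, hp, hr]
theorem ind_mono {p r : Prop} (h : p → r) : ind p ≤ ind r := by
  by_cases hp : p
  · rw [ind_true hp, ind_true (h hp)]
  · rw [ind_false hp]; exact ind_nonneg _
theorem ind_not (p : Prop) : ind (¬ p) = 1 - ind p := by
  by_cases hp : p <;> simp [ind, hp]
theorem ind_ex_le_one {X : Type*} [Finite X] [Nonempty X] (P : X → Prop) : ex (fun x => ind (P x)) ≤ 1 :=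
  ex_isMean.le_const (bdd_fin _) fun x => ind_le_one _

/-- Markov: proportion of sections of density at least half -/
theorem markov {X : Type*} [Finite X] [Nonempty X] {f : X → ℝ} {c : ℝ} (h1 : ∀ x, f x ≤ 1)
    (hc : 0 ≤ c) (h : c ≤ ex f) : c / 2 ≤ ex (fun x => ind (c / 2 ≤ f x)) := by
  have : ex f ≤ ex (fun x => c / 2 + ind (c / 2 ≤ f x)) := by
    refine ex_mono fun x => ?_
    by_cases hx : c / 2 ≤ f x
    · rw [ind_true hx]; linarith [h1 x]
    · rw [ind_false hx]; linarith [not_le.1 hx]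
  rw [ex_add, ex_const] at this
  linarith

/-! words and subspaces -/
section words
variable {ι ι₁ ι₂ η ζ β : Type}

/-- properness of a variable word -/
def Proper (v : ι → β ⊕ η) : Prop := ∀ e, ∃ i, v i = Sum.inr e

/-- substitution -/
def act (v : ι → β ⊕ η) (z : η → β) : ι → β := fun i => Sum.elim id z (v i)

/-- composition of variable words -/
def compW (v : ι → β ⊕ η) (w : η → β ⊕ ζ) : ι → β ⊕ ζ := fun i => Sum.elim Sum.inl w (v i)

theorem act_comp (v : ι → β ⊕ η) (w : η → β ⊕ ζ) (z : ζ → β) :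
    act (compW v w) z = act v (act w z) := by
  funext i; unfold act compW; rcases v i with b | e <;> rfl

theorem Proper.comp {v : ι → β ⊕ η} {w : η → β ⊕ ζ} (hv : Proper v) (hw : Proper w) :
    Proper (compW v w) := by
  intro e
  obtain ⟨j, hj⟩ := hw e
  obtain ⟨i, hi⟩ := hv j
  exact ⟨i, by unfold compW; rw [hi]; exact hj⟩

/-- gluing of words -/
def glue {γ : Type} (e : ι ≃ ι₁ ⊕ ι₂) (x : ι₁ → γ) (y : ι₂ → γ) : ι → γ := fun i => Sum.elim x y (e i)

theorem glue_inl {γ : Type} (e : ι ≃ ι₁ ⊕ ι₂) (x : ι₁ → γ) (y : ι₂ → γ) (i : ι₁) :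
    glue e x y (e.symm (Sum.inl i)) = x i := by simp [glue]
theorem glue_inr {γ : Type} (e : ι ≃ ι₁ ⊕ ι₂) (x : ι₁ → γ) (y : ι₂ → γ) (i : ι₂) :
    glue e x y (e.symm (Sum.inr i)) = y i := by simp [glue]

theorem act_glue (e : ι ≃ ι₁ ⊕ ι₂) (v : ι₁ → β ⊕ η) (w : ι₂ → β ⊕ η) (z : η → β) :
    act (glue e v w) z = glue e (act v z) (act w z) := by
  funext i; unfold act glue; rcases e i with b | e <;> rfl

theorem Proper.glue_left (e : ι ≃ ι₁ ⊕ ι₂) {v : ι₁ → β ⊕ η} (hv : Proper v) (w : ι₂ → β ⊕ η) :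
    Proper (glue e v w) := by
  intro j
  obtain ⟨i, hi⟩ := hv j
  exact ⟨e.symm (Sum.inl i), by rw [glue_inl, hi]⟩

theorem Proper.glue_right (e : ι ≃ ι₁ ⊕ ι₂) (v : ι₁ → β ⊕ η) {w : ι₂ → β ⊕ η} (hw : Proper w) :
    Proper (glue e v w) := by
  intro j
  obtain ⟨i, hi⟩ := hw j
  exact ⟨e.symm (Sum.inr i), by rw [glue_inr, hi]⟩

/-- constant variable word -/
def constW (η : Type) (x : ι → β) : ι → β ⊕ η := fun i => Sum.inl (x i)

@[simp] theorem act_constW (x : ι → β) (z : η → β) : act (constW η x) z = x := rfl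

/-- gluing as an equivalence -/
def glueEquiv (γ : Type) (e : ι ≃ ι₁ ⊕ ι₂) : (ι₁ → γ) × (ι₂ → γ) ≃ (ι → γ) where
  toFun p := glue e p.1 p.2
  invFun x := (fun i => x (e.symm (Sum.inl i)), fun i => x (e.symm (Sum.inr i)))
  left_inv p := by
    refine Prod.ext (funext fun i => ?_) (funext fun i => ?_)
    · exact glue_inl e _ _ i
    · exact glue_inr e _ _ i
  right_inv x := by
    funext i
    show Sum.elim (fun i => x (e.symm (Sum.inl i))) (fun i => x (e.symm (Sum.inr i))) (e i) = x i
    rcases h : e i with j | j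
    · simp only [Sum.elim_inl]; rw [← h, e.symm_apply_apply]
    · simp only [Sum.elim_inr]; rw [← h, e.symm_apply_apply]

theorem ex_glue [Finite ι] [Finite ι₁] [Finite ι₂] [Finite β] (e : ι ≃ ι₁ ⊕ ι₂) (f : (ι → β) → ℝ) :
    ex f = ex (fun x => ex (fun y => f (glue e x y))) := by
  rw [← ex_equiv (glueEquiv β e) f, ex_prod]; rfl

theorem exists_split [Finite ι] (n : ℕ) (h : n ≤ Nat.card ι) :
    ∃ e : ι ≃ Fin n ⊕ Fin (Nat.card ι - n), True := by
  refine ⟨(Finite.equivFin ι).trans ((finCongr (by omega)).trans finSumFinEquiv.symm), trivial⟩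

end words

/-- density Hales-Jewett for alphabet `α` -/
def DHJ (α : Type) [Finite α] : Prop := ∀ δ : ℝ, 0 < δ → ∃ N : ℕ, ∀ (ι : Type) [Finite ι],
  N ≤ Nat.card ι → ∀ A : (ι → α) → Prop, δ ≤ ex (fun x => ind (A x)) →
    ∃ v : ι → α ⊕ Unit, Proper v ∧ ∀ z, A (act v z)

/-- multidimensional version -/
theorem mdhj {α : Type} [Finite α] [Nonempty α] (H : DHJ α) (m : ℕ) : ∀ δ : ℝ, 0 < δ → ∃ N : ℕ,
    ∀ (ι : Type) [Finite ι], N ≤ Nat.card ι → ∀ A : (ι → α) → Prop, δ ≤ ex (fun x => ind (A x)) →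
    ∃ v : ι → α ⊕ Fin m, Proper v ∧ ∀ z, A (act v z) := by
  induction m with
  | zero =>
    intro δ hδ
    refine ⟨0, fun ι _ _ A hA => ?_⟩
    obtain ⟨x, hx⟩ := exists_ge_of_ex hA
    refine ⟨constW _ x, fun e => e.elim0, fun z => ?_⟩
    rw [act_constW]
    by_contra hn
    rw [ind_false hn] at hx; linarith
  | succ m ih =>
    intro δ hδ
    obtain ⟨n, hn⟩ := H (δ / 2) (by positivity)
    set c : ℝ := (Nat.card (Fin n → α ⊕ Unit) : ℝ) + 1 with hc
    have hc0 : 0 < c := by positivity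
    obtain ⟨N', hN'⟩ := ih (δ / 2 / c) (by positivity)
    refine ⟨n + N', fun ι _ hι A hA => ?_⟩
    obtain ⟨e, -⟩ := exists_split (ι := ι) n (by omega)
    rw [ex_glue e, ex_comm] at hA
    have h1 := markov (fun y => ind_ex_le_one _) hδ.le hA
    letI := Fintype.ofFinite (Fin n → α ⊕ Unit)
    set Q : (Fin n → α ⊕ Unit) → (Fin (Nat.card ι - n) → α) → Prop :=
      fun v y => Proper v ∧ ∀ z, A (glue e (act v z) y) with hQ
    have h2 : ex (fun y => ind (δ / 2 ≤ ex (fun x => ind (A (glue e x y)))))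
        ≤ ∑ v, ex (fun y => ind (Q v y)) := by
      rw [← ex_sum]
      refine ex_mono fun y => ?_
      by_cases hy : δ / 2 ≤ ex (fun x => ind (A (glue e x y)))
      · rw [ind_true hy]
        obtain ⟨v, hv, hvA⟩ := hn (Fin n) (by simp) (fun x => A (glue e x y)) hy
        have h3 : ind (Q v y) = 1 := ind_true ⟨hv, hvA⟩
        rw [← h3]
        exact Finset.single_le_sum (f := fun v => ind (Q v y)) (fun v _ => ind_nonneg _)
          (Finset.mem_univ v)
      · rw [ind_false hy]; exact Finset.sum_nonneg fun v _ => ind_nonneg _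
    have h3 : ∃ v, δ / 2 / c ≤ ex (fun y => ind (Q v y)) := by
      by_contra hcon
      push Not at hcon
      have h4 : ∑ v, ex (fun y => ind (Q v y)) ≤ ∑ _v : Fin n → α ⊕ Unit, δ / 2 / c :=
        Finset.sum_le_sum fun v _ => (hcon v).le
      rw [Finset.sum_const, Finset.card_univ, nsmul_eq_mul, ← Nat.card_eq_fintype_card] at h4
      have h5 : (Nat.card (Fin n → α ⊕ Unit) : ℝ) * (δ / 2 / c) < c * (δ / 2 / c) :=
        mul_lt_mul_of_pos_right (by rw [hc]; linarith) (by positivity)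
      rw [mul_div_cancel₀ _ hc0.ne'] at h5
      linarith
    obtain ⟨v, hv⟩ := h3
    obtain ⟨w, hw, hwQ⟩ := hN' (Fin (Nat.card ι - n)) (by simp; omega) (Q v) hv
    have hvp : Proper v := (hwQ fun _ => Classical.arbitrary α).1
    refine ⟨glue e (fun i => Sum.map id (fun _ => (0 : Fin (m + 1))) (v i))
      (fun i => Sum.map id Fin.succ (w i)), ?_, fun z => ?_⟩
    · intro j
      refine Fin.cases ?_ (fun j => ?_) j
      · obtain ⟨i, hi⟩ := hvp ()
        exact ⟨e.symm (Sum.inl i), by rw [glue_inl, hi]; rfl⟩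
      · obtain ⟨i, hi⟩ := hw j
        exact ⟨e.symm (Sum.inr i), by rw [glue_inr, hi]; rfl⟩
    · have := (hwQ (fun j => z j.succ)).2 (fun _ => z 0)
      convert this using 1
      rw [act_glue]
      congr 1
      · funext i
        show Sum.elim id z (Sum.map id _ (v i)) = Sum.elim id _ (v i)
        rcases v i with b | b <;> rfl
      · funext i
        show Sum.elim id z (Sum.map id _ (w i)) = Sum.elim id _ (w i)
        rcases w i with b | b <;> rfl

theorem dhj_unit : DHJ Unit := by
  intro δ hδ
  refine ⟨1, fun ι _ hι A hA => ?_⟩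
  obtain ⟨x, hx⟩ := exists_ge_of_ex hA
  have hne : Nonempty ι := by
    by_contra hn
    rw [not_nonempty_iff] at hn
    rw [Nat.card_of_isEmpty] at hι
    omega
  refine ⟨fun _ => Sum.inr (), fun e => ⟨Classical.arbitrary ι, rfl⟩, fun z => ?_⟩
  have : act (fun _ : ι => (Sum.inr () : Unit ⊕ Unit)) z = x := Subsingleton.elim _ _
  rw [this]
  by_contra hn
  rw [ind_false hn] at hx; linarith

end P13

set_option linter.unusedVariables false
set_option linter.unusedSectionVars false

namespace P13

section lemE
variable {ι ι₁ ι₂ η ζ α β : Type}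

/-- insensitivity: replacing `none` by `a` and conversely does not matter -/
def Ins (a : α) (E : (ι → Option α) → Prop) : Prop :=
  ∀ x y, (∀ i, (x i).getD a = (y i).getD a) → E x → E y

theorem ex_pi [Finite ι] [Finite β] (g : β → ℝ) :
    ex (fun s : ι → β => ∏ᶠ i, g (s i)) = (ex g) ^ Nat.card ι := by
  classical
  letI := Fintype.ofFinite ι
  letI := Fintype.ofFinite β
  simp only [finprod_eq_prod_of_fintype]
  rw [ex_eq, ex_eq, div_pow]
  congr 1
  · have := Finset.prod_univ_sum (fun _ : ι => (Finset.univ : Finset β)) (fun _ b => g b)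
    rw [Finset.prod_const, Finset.card_univ, Fintype.piFinset_univ] at this
    rw [Nat.card_eq_fintype_card, this]
  · rw [Fintype.card_fun, Nat.card_eq_fintype_card]; push_cast; rfl

/-- mixing -/
def mix (s : ι → Option α) (w : ι → α) : ι → Option α := fun i => (s i).map (fun _ => w i)

/-- swap involution -/
def swp (α : Type) : Option α × α ≃ Option α × α where
  toFun p := match p with
    | (none, w) => (none, w)
    | (some b, w) => (some w, b)
  invFun p := match p with
    | (none, w) => (none, w)
    | (some b, w) => (some w, b)
  left_inv p := by rcases p with ⟨_ | b, w⟩ <;> rfl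
  right_inv p := by rcases p with ⟨_ | b, w⟩ <;> rfl

theorem swp_fst (p : Option α × α) : (swp α p).1 = p.1.map (fun _ => p.2) := by
  rcases p with ⟨_ | b, w⟩ <;> rfl

theorem ex_mix [Finite ι] [Finite α] [Nonempty α] (G : (ι → Option α) → ℝ) :
    ex G = ex (fun s : ι → Option α => ex (fun w : ι → α => G (mix s w))) := by
  let e := Equiv.arrowProdEquivProdArrow ι (fun _ => Option α) (fun _ => α)
  have h1 : ex G = ex (fun p : (ι → Option α) × (ι → α) => G p.1) := by
    rw [ex_prod]
    exact congrArg ex (funext fun x => (ex_const _).symm)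
  have h2 := ex_equiv e (fun p : (ι → Option α) × (ι → α) => G p.1)
  have h3 := ex_equiv (Equiv.piCongrRight fun _ : ι => swp α)
    (fun f : ι → Option α × α => G (fun i => (f i).1))
  have h4 := ex_equiv e (fun p : (ι → Option α) × (ι → α) => G (mix p.1 p.2))
  rw [h1, ← h2]
  rw [ex_prod] at h4
  rw [← h4]
  refine Eq.trans h3.symm (congrArg ex (funext fun f => congrArg G (funext fun i => ?_)))
  exact swp_fst (f i)

theorem small_tail [Finite α] [Nonempty α] (N0 : ℕ) {ε : ℝ} (hε : 0 < ε) : ∃ N, ∀ (ι : Type) [Finite ι],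
    N ≤ Nat.card ι → ex (fun s : ι → Option α => ind (Nat.card {i // s i ≠ none} < N0)) < ε := by
  classical
  set g : Option α → ℝ := fun b => if b = none then 1 else 1 / 2 with hg
  have hg1 : ex g < 1 := by
    obtain ⟨a⟩ := ‹Nonempty α›
    by_contra hn
    push Not at hn
    have h1 := single_le_ex (f := fun b => 1 - g b)
      (fun b => by simp only [hg]; split_ifs <;> norm_num) (some a)
    rw [ex_sub, ex_const] at h1
    have h2 : 0 < (1 - g (some a)) / (Nat.card (Option α) : ℝ) := by
      refine div_pos (by simp [hg]; norm_num) (by exact_mod_cast Nat.card_pos)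
    linarith
  have hg0 : 0 ≤ ex g := ex_nonneg fun b => by simp only [hg]; split_ifs <;> norm_num
  obtain ⟨N, hN⟩ := exists_pow_lt_of_lt_one (show 0 < ε / 2 ^ N0 by positivity) hg1
  refine ⟨N, fun ι _ hι => ?_⟩
  have h1 : ex (fun s : ι → Option α => ind (Nat.card {i // s i ≠ none} < N0))
      ≤ ex (fun s : ι → Option α => 2 ^ N0 * ∏ᶠ i, g (s i)) := by
    refine ex_mono fun s => ?_
    letI := Fintype.ofFinite ι
    rw [finprod_eq_prod_of_fintype]
    have h2 : ∏ i, g (s i) = (1 / 2) ^ Nat.card {i // s i ≠ none} := by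
      simp only [hg]
      rw [Finset.prod_ite, Finset.prod_const, Finset.prod_const, one_pow, one_mul,
        Nat.card_eq_fintype_card, Fintype.card_subtype]
    rw [h2]
    by_cases hs : Nat.card {i // s i ≠ none} < N0
    · rw [ind_true hs]
      have : (1 / 2 : ℝ) ^ N0 ≤ (1 / 2) ^ Nat.card {i // s i ≠ none} :=
        pow_le_pow_of_le_one (by norm_num) (by norm_num) hs.le
      calc (1 : ℝ) = 2 ^ N0 * (1 / 2) ^ N0 := by rw [← mul_pow]; norm_num
        _ ≤ _ := by gcongr
    · rw [ind_false hs]; positivity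
  refine lt_of_le_of_lt h1 ?_
  rw [ex_smul, ex_pi]
  have h3 : ex g ^ Nat.card ι ≤ ex g ^ N := pow_le_pow_of_le_one hg0 hg1.le hι
  calc 2 ^ N0 * ex g ^ Nat.card ι < 2 ^ N0 * (ε / 2 ^ N0) := by
        apply mul_lt_mul_of_pos_left (lt_of_le_of_lt h3 hN) (by positivity)
    _ = ε := by field_simp

theorem lemE [Finite α] [Nonempty α] (H : DHJ α) (a : α) (M : ℕ) {δ : ℝ} (hδ : 0 < δ) : ∃ N, ∀ (ι : Type)
    [Finite ι], N ≤ Nat.card ι → ∀ E : (ι → Option α) → Prop, Ins a E → δ ≤ ex (fun x => ind (E x)) →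
    ∃ v : ι → Option α ⊕ Fin M, Proper v ∧ ∀ z, E (act v z) := by
  classical
  obtain ⟨N0, hN0⟩ := mdhj H M (δ / 2) (by positivity)
  obtain ⟨N, hN⟩ := small_tail (α := α) N0 (show 0 < δ / 2 by positivity)
  refine ⟨N, fun ι _ hι E hE hd => ?_⟩
  rw [ex_mix] at hd
  have hs : ∃ s : ι → Option α, N0 ≤ Nat.card {i // s i ≠ none} ∧
      δ / 2 ≤ ex (fun w : ι → α => ind (E (mix s w))) := by
    by_contra hn
    push Not at hn
    have h1 : ex (fun s : ι → Option α => ex (fun w : ι → α => ind (E (mix s w))))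
        ≤ ex (fun s : ι → Option α => δ / 2 + ind (Nat.card {i // s i ≠ none} < N0)) := by
      refine ex_mono fun s => ?_
      by_cases hs : Nat.card {i // s i ≠ none} < N0
      · rw [ind_true hs]; linarith [ind_ex_le_one (fun w : ι → α => E (mix s w))]
      · rw [ind_false hs, add_zero]; exact (hn s (not_lt.1 hs)).le
    rw [ex_add, ex_const] at h1
    linarith [hN ι hι]
  obtain ⟨s, hs, hsd⟩ := hs
  let e := (Equiv.sumCompl (fun i => s i ≠ none)).symm
  have hel : ∀ j : {i // s i ≠ none}, e.symm (Sum.inl j) = j.1 := fun j => rfl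
  have her : ∀ j : {i // ¬ (s i ≠ none)}, e.symm (Sum.inr j) = j.1 := fun j => rfl
  rw [ex_glue e] at hsd
  have hmix : ∀ (w₁ : {i // s i ≠ none} → α) (w₂ w₂' : {i // ¬ (s i ≠ none)} → α),
      mix s (glue e w₁ w₂) = mix s (glue e w₁ w₂') := by
    intro w₁ w₂ w₂'
    funext i
    obtain ⟨j, rfl⟩ := e.symm.surjective i
    rcases j with j | j
    · unfold mix; rw [glue_inl, glue_inl]
    · unfold mix
      have : s (e.symm (Sum.inr j)) = none := by rw [her]; exact not_not.1 j.2
      rw [this]; rfl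
  have hsd' : δ / 2 ≤ ex (fun w₁ => ind (E (mix s (glue e w₁ (fun _ => a))))) := by
    refine hsd.trans (ex_mono fun w₁ => ?_)
    refine le_of_eq (Eq.trans (congrArg ex (funext fun w₂ => ?_)) (ex_const _))
    rw [hmix w₁ w₂ (fun _ => a)]
  obtain ⟨v, hv, hvE⟩ := hN0 {i // s i ≠ none} hs _ hsd'
  refine ⟨glue e (fun i => Sum.map some id (v i)) (fun _ => Sum.inl none), ?_, fun z => ?_⟩
  · refine Proper.glue_left e ?_ _
    intro j
    obtain ⟨i, hi⟩ := hv j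
    exact ⟨i, by show Sum.map some id (v i) = _; rw [hi]; rfl⟩
  · refine hE _ _ ?_ (hvE (fun j => (z j).getD a))
    intro i
    rw [act_glue]
    obtain ⟨j, rfl⟩ := e.symm.surjective i
    rcases j with j | j
    · rw [glue_inl]
      unfold mix
      rw [glue_inl]
      obtain ⟨b, hb⟩ := Option.ne_none_iff_exists'.1 j.2
      have : s (e.symm (Sum.inl j)) = some b := by rw [hel, hb]
      rw [this]
      show (some (Sum.elim id _ (v j))).getD a = (Sum.elim id z (Sum.map some id (v j))).getD a
      rcases v j with c | c <;> rfl
    · rw [glue_inr]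
      unfold mix
      have : s (e.symm (Sum.inr j)) = none := by rw [her]; exact not_not.1 j.2
      rw [this]; rfl

end lemE

end P13

set_option linter.unusedVariables false
set_option linter.unusedSectionVars false

namespace P13

section lemS
variable {ι ι₁ ι₂ η ζ α β : Type}

theorem act_inj {v : ι → β ⊕ η} (hv : Proper v) : Function.Injective (act v) := by
  intro z z' h
  funext j
  obtain ⟨i, hi⟩ := hv j
  have := congrFun h i
  unfold act at this
  rwa [hi] at this

theorem ex_range {X Z : Type*} [Finite X] [Finite Z] [Nonempty Z] {p : Z → X} (hp : Function.Injective p) (g : X → ℝ) :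
    ex (fun x => g x * ind (∃ z, x = p z)) = (Nat.card Z : ℝ) / Nat.card X * ex (fun z => g (p z)) := by
  classical
  letI := Fintype.ofFinite X
  letI := Fintype.ofFinite Z
  rw [ex_eq, ex_eq, Nat.card_eq_fintype_card, Nat.card_eq_fintype_card]
  have h1 : ∑ x, g x * ind (∃ z, x = p z) = ∑ z, g (p z) := by
    have : ∑ z, g (p z) = ∑ x ∈ Finset.univ.image p, g x :=
      (Finset.sum_image (fun a _ b _ h => hp h)).symm
    rw [this, ← Finset.sum_subset (Finset.subset_univ (Finset.univ.image p))]
    · refine Finset.sum_congr rfl fun x hx => ?_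
      rw [ind_true, mul_one]
      obtain ⟨z, -, hz⟩ := Finset.mem_image.1 hx
      exact ⟨z, hz.symm⟩
    · intro x _ hx
      rw [ind_false, mul_zero]
      rintro ⟨z, hz⟩
      exact hx (Finset.mem_image.2 ⟨z, Finset.mem_univ _, hz.symm⟩)
  rw [h1]
  have h2 : (Fintype.card Z : ℝ) ≠ 0 := by exact_mod_cast Fintype.card_ne_zero
  field_simp

theorem Ins.act {a : α} {E : (ι → Option α) → Prop} (hE : Ins a E) (W : ι → Option α ⊕ η) :
    Ins a (fun z => E (act W z)) := by
  intro x y h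
  refine hE _ _ fun i => ?_
  unfold P13.act
  rcases W i with b | j
  · rfl
  · exact h j

theorem Ins.glue_left {a : α} {E : (ι → Option α) → Prop} (hE : Ins a E) (e : ι ≃ ι₁ ⊕ ι₂) (y : ι₂ → Option α) :
    Ins a (fun x => E (glue e x y)) := by
  intro x x' h
  refine hE _ _ fun i => ?_
  unfold glue
  rcases e i with j | j
  · exact h j
  · rfl

theorem Ins.glue_iff {a : α} {E : (ι → Option α) → Prop} (hE : Ins a E) (e : ι ≃ ι₁ ⊕ ι₂)
    {y y' : ι₂ → Option α} (h : ∀ i, (y i).getD a = (y' i).getD a) (x : ι₁ → Option α) :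
    E (glue e x y) → E (glue e x y') := by
  refine hE _ _ fun i => ?_
  unfold glue
  rcases e i with j | j
  · rfl
  · exact h j

theorem lemS_aux [Finite α] [Nonempty α] (H : DHJ α) (a : α) (M : ℕ) {ξ : ℝ} (hξ : 0 < ξ) :
    ∃ θ : ℝ, 0 < θ ∧ θ ≤ 1 / 2 ∧ ∀ t : ℕ, ∃ N, ∀ (ι : Type) [Finite ι], N ≤ Nat.card ι →
    ∀ h : (ι → Option α) → ℝ, (∀ x, h x ≤ 1) →
    (∀ W : ι → Option α ⊕ Fin M, Proper W → ex (fun z => h (act W z)) ≤ 0) →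
    ∀ D : (ι → Option α) → Prop, Ins a D →
    ex (fun x => h x * ind (D x)) ≤ ξ + (1 - θ) ^ t * ex (fun x => ind (D x)) := by
  classical
  obtain ⟨n0, hn0⟩ := lemE H a M (show 0 < ξ / 2 by positivity)
  set c : ℝ := (Nat.card (Fin n0 → Option α) : ℝ) with hc
  have hc1 : (1 : ℝ) ≤ c := by rw [hc]; exact_mod_cast Nat.card_pos
  set θ : ℝ := min (ξ / 2) (1 / 2) / c with hθ
  have hθ0 : 0 < θ := by
    rw [hθ]; refine div_pos (lt_min (by positivity) (by norm_num)) (by linarith)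
  have hθ1 : θ ≤ 1 / 2 := by
    rw [hθ, div_le_iff₀ (by linarith)]
    have := min_le_right (ξ / 2) (1 / 2 : ℝ)
    linarith
  have hθ2 : θ ≤ ξ / 2 * (1 / c) := by
    rw [hθ, mul_one_div]
    gcongr
    exact min_le_left _ _
  refine ⟨θ, hθ0, hθ1, fun t => ?_⟩
  induction t with
  | zero =>
    refine ⟨0, fun ι _ _ h h1 _ D _ => ?_⟩
    have : ex (fun x => h x * ind (D x)) ≤ ex (fun x => ind (D x)) := ex_mono fun x => by
      nlinarith [ind_nonneg (D x), h1 x]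
    rw [pow_zero, one_mul]; linarith
  | succ t ih =>
    obtain ⟨N', hN'⟩ := ih
    refine ⟨n0 + N', fun ι _ hι h h1 hW D hD => ?_⟩
    have hdD0 : 0 ≤ ex (fun x => ind (D x)) := ex_nonneg fun x => ind_nonneg _
    by_cases hd : ex (fun x => ind (D x)) < ξ
    · have h2 : ex (fun x => h x * ind (D x)) ≤ ex (fun x => ind (D x)) := ex_mono fun x => by
        nlinarith [ind_nonneg (D x), h1 x]
      have h3 : 0 ≤ (1 - θ) ^ (t + 1) * ex (fun x => ind (D x)) :=
        mul_nonneg (pow_nonneg (by linarith) _) hdD0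
      linarith
    push Not at hd
    obtain ⟨e, -⟩ := exists_split (ι := ι) n0 (by omega)
    -- choice of subspaces
    have hch : ∀ S : (Fin n0 → Option α) → Prop, ∃ W : Fin n0 → Option α ⊕ Fin M,
        Ins a S → ξ / 2 ≤ ex (fun x => ind (S x)) → Proper W ∧ ∀ z, S (act W z) := by
      intro S
      by_cases hS : Ins a S ∧ ξ / 2 ≤ ex (fun x => ind (S x))
      · obtain ⟨W, hW⟩ := hn0 (Fin n0) (by simp) S hS.1 hS.2
        exact ⟨W, fun _ _ => hW⟩
      · exact ⟨fun _ => Sum.inl none, fun h1 h2 => absurd ⟨h1, h2⟩ hS⟩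
    choose Wf hWf using hch
    set sec : (Fin (Nat.card ι - n0) → Option α) → (Fin n0 → Option α) → Prop :=
      fun y x => D (glue e x y) with hsec
    have hsecI : ∀ y, Ins a (sec y) := fun y => hD.glue_left e y
    have hsecE : ∀ y y', (∀ i, (y i).getD a = (y' i).getD a) → sec y = sec y' := by
      intro y y' hy
      funext x
      exact propext ⟨hD.glue_iff e hy x, hD.glue_iff e (fun i => (hy i).symm) x⟩
    set big : ((Fin n0 → Option α) → Prop) → Prop := fun S => ξ / 2 ≤ ex (fun x => ind (S x)) with hbig
    set R : (Fin n0 → Option α) → (Fin (Nat.card ι - n0) → Option α) → Prop :=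
      fun x y => big (sec y) ∧ ∃ z, x = act (Wf (sec y)) z with hR
    have hRD : ∀ x y, R x y → D (glue e x y) := by
      rintro x y ⟨hb, z, rfl⟩
      exact (hWf (sec y) (hsecI y) hb).2 z
    have hindD : ∀ x y, ind (D (glue e x y)) = ind (R x y) + ind (D (glue e x y) ∧ ¬ R x y) := by
      intro x y
      by_cases hr : R x y
      · rw [ind_true (hRD x y hr), ind_true hr, ind_false (fun h => h.2 hr), add_zero]
      · rw [ind_false hr, zero_add]
        by_cases hdd : D (glue e x y)
        · rw [ind_true hdd, ind_true ⟨hdd, hr⟩]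
        · rw [ind_false hdd, ind_false (fun h => hdd h.1)]
    -- the removed part
    have hexR : ∀ g : (Fin n0 → Option α) → (Fin (Nat.card ι - n0) → Option α) → ℝ, ∀ y, big (sec y) →
        ex (fun x => g x y * ind (R x y))
        = (Nat.card (Fin M → Option α) : ℝ) / c * ex (fun z => g (act (Wf (sec y)) z) y) := by
      intro g y hb
      rw [hc, ← ex_range (act_inj (hWf (sec y) (hsecI y) hb).1) (fun x => g x y)]
      refine congrArg ex (funext fun x => ?_)
      congr 2
      exact propext ⟨fun h => h.2, fun h => ⟨hb, h⟩⟩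
    have hexR0 : ∀ g : (Fin n0 → Option α) → (Fin (Nat.card ι - n0) → Option α) → ℝ, ∀ y, ¬ big (sec y) →
        ex (fun x => g x y * ind (R x y)) = 0 := by
      intro g y hb
      refine Eq.trans (congrArg ex (funext fun x => ?_)) (ex_const 0)
      rw [ind_false (fun h => hb h.1), mul_zero]
    have hneg : ex (fun x => ex (fun y => h (glue e x y) * ind (R x y))) ≤ 0 := by
      rw [ex_comm]
      refine (ex_mono (g := fun _ => 0) fun y => ?_).trans_eq (ex_const 0)
      by_cases hb : big (sec y)
      · rw [hexR (fun x y => h (glue e x y)) y hb]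
        refine mul_nonpos_of_nonneg_of_nonpos (by positivity) ?_
        have := hW (glue e (Wf (sec y)) (constW _ y)) ((hWf (sec y) (hsecI y) hb).1.glue_left e _)
        simpa only [act_glue, act_constW] using this
      · rw [hexR0 (fun x y => h (glue e x y)) y hb]
    have hRbig : ξ / 2 * (1 / c) ≤ ex (fun x => ex (fun y => ind (R x y))) := by
      rw [ex_comm]
      have hm := hd
      rw [ex_glue e, ex_comm] at hm
      have h2 := markov (fun y => ind_ex_le_one _) hξ.le hm
      have h3 : ex (fun y => (1 / c) * ind (big (sec y))) ≤ ex (fun y => ex (fun x => ind (R x y))) := by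
        refine ex_mono fun y => ?_
        by_cases hb : big (sec y)
        · rw [ind_true hb, mul_one]
          have h4 := single_le_ex (f := fun x => ind (R x y)) (fun x => ind_nonneg _)
            (act (Wf (sec y)) (fun _ => none))
          rwa [ind_true (show R (act (Wf (sec y)) (fun _ => none)) y from ⟨hb, _, rfl⟩)] at h4
        · rw [ind_false hb, mul_zero]; exact ex_nonneg fun x => ind_nonneg _
      rw [ex_smul] at h3
      refine le_trans ?_ h3
      rw [mul_comm]
      exact mul_le_mul_of_nonneg_left h2 (by positivity)
    -- induction hypothesis on the rest
    have hrest : ∀ x, ex (fun y => h (glue e x y) * ind (D (glue e x y) ∧ ¬ R x y))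
        ≤ ξ + (1 - θ) ^ t * ex (fun y => ind (D (glue e x y) ∧ ¬ R x y)) := by
      intro x
      refine hN' (Fin (Nat.card ι - n0)) (by simp; omega) (fun y => h (glue e x y)) (fun y => h1 _)
        ?_ (fun y => D (glue e x y) ∧ ¬ R x y) ?_
      · intro W hWp
        have := hW (glue e (constW _ x) W) (hWp.glue_right e _)
        simpa only [act_glue, act_constW] using this
      · rintro y y' hy ⟨hd1, hr⟩
        refine ⟨hD.glue_iff e hy x hd1, ?_⟩
        simp only [hR] at hr ⊢
        rwa [← hsecE y y' hy]
    have e1 : ex (fun x => h x * ind (D x)) = ex (fun x => ex (fun y => h (glue e x y) * ind (R x y)))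
        + ex (fun x => ex (fun y => h (glue e x y) * ind (D (glue e x y) ∧ ¬ R x y))) := by
      rw [ex_glue e, ← ex_add]
      refine congrArg ex (funext fun x => ?_)
      rw [← ex_add]
      refine congrArg ex (funext fun y => ?_)
      rw [hindD x y]; ring
    have e2 : ex (fun x => ind (D x)) = ex (fun x => ex (fun y => ind (R x y)))
        + ex (fun x => ex (fun y => ind (D (glue e x y) ∧ ¬ R x y))) := by
      rw [ex_glue e, ← ex_add]
      refine congrArg ex (funext fun x => ?_)
      rw [← ex_add]
      exact congrArg ex (funext fun y => hindD x y)
    have e3 : ex (fun x => ex (fun y => h (glue e x y) * ind (D (glue e x y) ∧ ¬ R x y)))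
        ≤ ξ + (1 - θ) ^ t * ex (fun x => ex (fun y => ind (D (glue e x y) ∧ ¬ R x y))) := by
      refine (ex_mono hrest).trans_eq ?_
      rw [ex_add, ex_const, ex_smul]
    have e4 : ex (fun x => ex (fun y => ind (D (glue e x y) ∧ ¬ R x y)))
        ≤ (1 - θ) * ex (fun x => ind (D x)) := by
      have h5 : ex (fun x => ind (D x)) ≤ 1 := ind_ex_le_one _
      nlinarith
    have e5 : (1 - θ) ^ t * ex (fun x => ex (fun y => ind (D (glue e x y) ∧ ¬ R x y)))
        ≤ (1 - θ) ^ t * ((1 - θ) * ex (fun x => ind (D x))) :=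
      mul_le_mul_of_nonneg_left e4 (pow_nonneg (by linarith) _)
    rw [pow_succ]
    linarith [mul_assoc ((1 - θ) ^ t) (1 - θ) (ex (fun x => ind (D x)))]

theorem lemS [Finite α] [Nonempty α] (H : DHJ α) (a : α) (M : ℕ) {ξ : ℝ} (hξ : 0 < ξ) :
    ∃ N, ∀ (ι : Type) [Finite ι], N ≤ Nat.card ι →
    ∀ h : (ι → Option α) → ℝ, (∀ x, h x ≤ 1) →
    (∀ W : ι → Option α ⊕ Fin M, Proper W → ex (fun z => h (act W z)) ≤ 0) →
    ∀ D : (ι → Option α) → Prop, Ins a D → ex (fun x => h x * ind (D x)) ≤ ξ := by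
  obtain ⟨θ, h0, h1, hh⟩ := lemS_aux H a M (show 0 < ξ / 2 by positivity)
  obtain ⟨t, ht⟩ := exists_pow_lt_of_lt_one (show 0 < ξ / 2 by positivity) (show 1 - θ < 1 by linarith)
  obtain ⟨N, hN⟩ := hh t
  refine ⟨N, fun ι _ hι h hh1 hW D hD => ?_⟩
  have h2 := hN ι hι h hh1 hW D hD
  have h3 : (1 - θ) ^ t * ex (fun x => ind (D x)) ≤ (1 - θ) ^ t * 1 :=
    mul_le_mul_of_nonneg_left (ind_ex_le_one _) (pow_nonneg (by linarith) _)
  linarith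

theorem S_list [Finite α] [Nonempty α] (H : DHJ α) (J : Finset α) : ∀ (M : ℕ) {ξ : ℝ} (hξ : 0 < ξ),
    ∃ N, ∀ (ι : Type) [Finite ι], N ≤ Nat.card ι →
    ∀ g : (ι → Option α) → ℝ, (∀ x, g x ≤ 1) → ∀ c : ℝ, 0 ≤ c →
    (∀ W : ι → Option α ⊕ Fin M, Proper W → ex (fun z => g (act W z)) ≤ c) →
    ∀ D : α → (ι → Option α) → Prop, (∀ a, Ins a (D a)) →
      ex (fun x => g x * ind (∀ a ∈ J, D a x)) ≤ c + ξ := by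
  classical
  induction J using Finset.induction_on with
  | empty =>
    intro M ξ hξ
    refine ⟨M, fun ι _ hι g hg c hc hW D hD => ?_⟩
    obtain ⟨e, -⟩ := exists_split (ι := ι) M hι
    have h1 : ex (fun x => g x * ind (∀ a ∈ (∅ : Finset α), D a x)) = ex g := by
      refine congrArg ex (funext fun x => ?_)
      rw [ind_true (by simp), mul_one]
    rw [h1, ex_glue e, ex_comm]
    have : ex (fun y => ex (fun x => g (glue e x y))) ≤ ex (fun _ : Fin (Nat.card ι - M) → Option α => c) := by
      refine ex_mono fun y => ?_
      have := hW (glue e (fun i => Sum.inr i) (constW _ y)) (Proper.glue_left e (fun j => ⟨j, rfl⟩) _)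
      simp only [act_glue, act_constW] at this
      exact this
    rw [ex_const] at this
    linarith
  | insert a J ha ih =>
    intro M ξ hξ
    obtain ⟨M', hM'⟩ := ih M (show 0 < ξ / 2 by positivity)
    obtain ⟨N, hN⟩ := lemS H a M' (show 0 < ξ / 2 by positivity)
    refine ⟨N, fun ι _ hι g hg c hc hW D hD => ?_⟩
    have h1 := hN ι hι (fun x => g x * ind (∀ a ∈ J, D a x) - (c + ξ / 2)) ?_ ?_ (D a) (hD a)
    · have h2 : ex (fun x => g x * ind (∀ b ∈ insert a J, D b x))
          = ex (fun x => (g x * ind (∀ a ∈ J, D a x) - (c + ξ / 2)) * ind (D a x))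
            + (c + ξ / 2) * ex (fun x => ind (D a x)) := by
        rw [← ex_smul, ← ex_add]
        refine congrArg ex (funext fun x => ?_)
        simp only [Finset.forall_mem_insert]
        rw [ind_and]; ring
      have h3 : (c + ξ / 2) * ex (fun x => ind (D a x)) ≤ (c + ξ / 2) * 1 :=
        mul_le_mul_of_nonneg_left (ind_ex_le_one _) (by linarith)
      rw [h2]; linarith
    · intro x
      have : g x * ind (∀ a ∈ J, D a x) ≤ 1 := by
        nlinarith [ind_nonneg (∀ a ∈ J, D a x), ind_le_one (∀ a ∈ J, D a x), hg x]
      linarith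
    · intro W hWp
      have := hM' (Fin M') (by simp) (fun z => g (act W z)) (fun z => hg _) c hc ?_
        (fun b z => D b (act W z)) (fun b => (hD b).act W)
      · rw [ex_sub, ex_const]; linarith
      · intro W' hW'
        have := hW (compW W W') (hWp.comp hW')
        simpa only [act_comp] using this

end lemS

end P13

set_option linter.unusedVariables false
set_option linter.unusedSectionVars false

namespace P13

section ramsey
variable {ι ι₁ ι₂ η ζ α β : Type}

theorem hjm (α κ η : Type) [Finite α] [Finite κ] [Finite η] : ∃ (ι : Type) (_ : Finite ι),
    ∀ C : (ι → α) → κ, ∃ l : ι → α ⊕ η, Proper l ∧ ∃ c, ∀ z, C (act l z) = c := by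
  obtain ⟨ι, hf, h⟩ := Combinatorics.Subspace.exists_mono_in_high_dimension α κ η
  refine ⟨ι, inferInstance, fun C => ?_⟩
  obtain ⟨l, c, hc⟩ := h C
  exact ⟨l.idxFun, l.proper, c, hc⟩

/-- lifting words over `α` to words over `Option α` -/
def lft (V : ι → α ⊕ η) : ι → Option α ⊕ η := fun i => Sum.map some id (V i)

theorem Proper.lft {V : ι → α ⊕ η} (h : Proper V) : Proper (lft V) := by
  intro j
  obtain ⟨i, hi⟩ := h j
  exact ⟨i, by unfold P13.lft; rw [hi]; rfl⟩

theorem lft_some (V : ι → α ⊕ η) (z : η → α) :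
    act (lft V) (fun j => some (z j)) = fun i => some (act V z i) := by
  funext i; unfold act lft; rcases V i with b | b <;> rfl

theorem fuse (α : Type) [Finite α] [Nonempty α] (M : ℕ) : ∀ (κ : Type) [Finite κ], ∃ (ι : Type) (_ : Finite ι),
    ∀ c : (ι → Option α) → κ, ∃ V : ι → α ⊕ Fin M, Proper V ∧ ∀ z z' : Fin M → Option α,
      (∀ j, z j = none ↔ z' j = none) → c (act (lft V) z) = c (act (lft V) z') := by
  classical
  induction M with
  | zero =>
    intro κ _
    refine ⟨Unit, inferInstance, fun c => ⟨fun _ => Sum.inl (Classical.arbitrary α), fun j => j.elim0,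
      fun z z' _ => ?_⟩⟩
    rw [Subsingleton.elim z z']
  | succ M ih =>
    intro κ _
    obtain ⟨ι₂, hf2, h2⟩ := ih (κ × κ)
    obtain ⟨ι₁, hf1, h1⟩ := hjm α ((ι₂ → Option α) → κ) Unit
    refine ⟨ι₁ ⊕ ι₂, inferInstance, fun c => ?_⟩
    let e := Equiv.refl (ι₁ ⊕ ι₂)
    obtain ⟨l, hl, d, hd⟩ := h1 (fun x y => c (glue e (fun i => some (x i)) y))
    obtain ⟨V, hV, hc⟩ := h2 (fun y => (c (glue e (act (lft l) (fun _ => none)) y), d y))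
    refine ⟨glue e (fun i => Sum.map id (fun _ => (0 : Fin (M + 1))) (l i))
      (fun i => Sum.map id Fin.succ (V i)), ?_, fun z z' hz => ?_⟩
    · intro j
      refine Fin.cases ?_ (fun j => ?_) j
      · obtain ⟨i, hi⟩ := hl ()
        exact ⟨e.symm (Sum.inl i), by rw [glue_inl, hi]; rfl⟩
      · obtain ⟨i, hi⟩ := hV j
        exact ⟨e.symm (Sum.inr i), by rw [glue_inr, hi]; rfl⟩
    · have key : ∀ z : Fin (M + 1) → Option α, act (lft (glue e (fun i => Sum.map id (fun _ => (0 : Fin (M + 1))) (l i))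
          (fun i => Sum.map id Fin.succ (V i)))) z
          = glue e (act (lft l) (fun _ => z 0)) (act (lft V) (fun j => z j.succ)) := by
        intro z
        funext i
        rcases i with i | i
        · show Sum.elim id z (Sum.map some id (Sum.map id _ (l i))) = Sum.elim id _ (Sum.map some id (l i))
          rcases l i with b | b <;> rfl
        · show Sum.elim id z (Sum.map some id (Sum.map id _ (V i))) = Sum.elim id _ (Sum.map some id (V i))
          rcases V i with b | b <;> rfl
      rw [key z, key z']
      have h3 := hc (fun j => z j.succ) (fun j => z' j.succ) (fun j => hz j.succ)
      have h4 := congrArg Prod.fst h3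
      have h5 := congrArg Prod.snd h3
      simp only at h4 h5
      have hd' : ∀ (b : α) (y : ι₂ → Option α), c (glue e (act (lft l) (fun _ => some b)) y) = d y := by
        intro b y
        rw [lft_some l (fun _ => b)]
        exact congrFun (hd fun _ => b) y
      rcases h0 : z 0 with _ | b
      · rw [(hz 0).1 h0]; exact h4
      · rcases h0' : z' 0 with _ | b'
        · rw [(hz 0).2 h0'] at h0; cases h0
        · rw [hd', hd', h5]

/-- evaluating a union pattern -/
def app {m : ℕ} (w : ι → Option (Fin m)) (S : Fin m → Bool) : ι → Bool := fun i => (w i).elim false S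

theorem fu1 (κ : Type) [Finite κ] (m : ℕ) : ∃ (ι : Type) (_ : Finite ι), ∀ c : (ι → Bool) → κ,
    ∃ w : ι → Option (Fin m), (∀ j, ∃ i, w i = some j) ∧ ∃ d : Fin m → κ, ∀ S j, S j = true →
      (∀ i < j, S i = false) → c (app w S) = d j := by
  classical
  induction m with
  | zero =>
    exact ⟨Unit, inferInstance, fun c => ⟨fun _ => none, fun j => j.elim0, fun j => j.elim0,
      fun S j => j.elim0⟩⟩
  | succ m ih =>
    obtain ⟨ι', hf', h'⟩ := ih
    obtain ⟨ι₂, hf2, h2⟩ := hjm Bool κ ι'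
    refine ⟨Option ι₂, inferInstance, fun c => ?_⟩
    obtain ⟨l, hl, d0, hd0⟩ := h2 (fun y => c (fun o => o.elim true y))
    obtain ⟨w, hw, d, hd⟩ := h' (fun z => c (fun o => o.elim false
      (act (fun i => Sum.map (fun _ => false) id (l i)) z)))
    refine ⟨fun o => o.elim (some 0) (fun i => Sum.elim (fun b => if b then some 0 else none)
      (fun j => (w j).map Fin.succ) (l i)), ?_, Fin.cons d0 d, ?_⟩
    · intro j
      refine Fin.cases ⟨none, rfl⟩ (fun j => ?_) j
      obtain ⟨j', hj'⟩ := hw j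
      obtain ⟨i, hi⟩ := hl j'
      exact ⟨some i, by simp [hi, hj']⟩
    · intro S j hS hSj
      have key1 : S 0 = true → app (fun o => o.elim (some 0) (fun i => Sum.elim (fun b => if b then some 0 else none)
        (fun j => (w j).map Fin.succ) (l i))) S = fun o : Option ι₂ => o.elim true (act l (app w (fun j => S j.succ))) := by
        intro h0
        funext o
        rcases o with _ | i
        · exact h0
        · unfold app act
          show Option.elim (Sum.elim _ _ (l i)) false S = Sum.elim id _ (l i)
          rcases l i with b | j
          · rcases b with _ | _
            · rfl
            · exact h0
          · show Option.elim ((w j).map Fin.succ) false S = (w j).elim false _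
            rcases w j with _ | j <;> rfl
      have key2 : S 0 = false → app (fun o => o.elim (some 0) (fun i => Sum.elim (fun b => if b then some 0 else none)
        (fun j => (w j).map Fin.succ) (l i))) S = fun o : Option ι₂ => o.elim false
          (act (fun i => Sum.map (fun _ => false) id (l i)) (app w (fun j => S j.succ))) := by
        intro h0
        funext o
        rcases o with _ | i
        · exact h0
        · unfold app act
          show Option.elim (Sum.elim _ _ (l i)) false S = Sum.elim id _ (Sum.map _ id (l i))
          rcases l i with b | j
          · rcases b with _ | _
            · rfl
            · exact h0
          · show Option.elim ((w j).map Fin.succ) false S = (w j).elim false _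
            rcases w j with _ | j <;> rfl
      revert hS hSj
      refine Fin.cases (fun hS hSj => ?_) (fun j hS hSj => ?_) j
      · rw [key1 hS]; exact hd0 _
      · rw [key2 (hSj 0 (Fin.succ_pos j))]
        rw [Fin.cons_succ]
        exact hd (fun j => S j.succ) j hS (fun i hi => hSj i.succ (Fin.succ_lt_succ_iff.2 hi))

theorem fu (κ : Type) [Finite κ] (m : ℕ) : ∃ (ι : Type) (_ : Finite ι), ∀ c : (ι → Bool) → κ,
    ∃ w : ι → Option (Fin m), (∀ j, ∃ i, w i = some j) ∧ ∃ d : κ, ∀ S, (∃ j, S j = true) →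
      c (app w S) = d := by
  classical
  letI := Fintype.ofFinite κ
  obtain ⟨ι, hf, h⟩ := fu1 κ (Fintype.card κ * m)
  refine ⟨ι, hf, fun c => ?_⟩
  haveI : Nonempty κ := ⟨c fun _ => false⟩
  obtain ⟨w, hw, d, hd⟩ := h c
  obtain ⟨y, hy⟩ := Fintype.exists_le_card_fiber_of_mul_le_card (f := d) (n := m) (by simp)
  obtain ⟨t, hts, htc⟩ := Finset.exists_subset_card_eq hy
  let p : Fin m → Fin (Fintype.card κ * m) := fun l => (t.orderIsoOfFin htc l : _)
  have hp : Function.Injective p := fun a b hab => (t.orderIsoOfFin htc).injective (Subtype.ext hab)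
  have hpd : ∀ l, d (p l) = y := fun l => by
    have := hts (t.orderIsoOfFin htc l).2
    exact (Finset.mem_filter.1 this).2
  refine ⟨fun i => (w i).bind (Function.partialInv p), fun j => ?_, y, fun S hS => ?_⟩
  · obtain ⟨i, hi⟩ := hw (p j)
    exact ⟨i, by
      show (w i).bind (Function.partialInv p) = some j
      rw [hi]; exact Function.partialInv_left hp j⟩
  · set S' : Fin (Fintype.card κ * m) → Bool := fun j => (Function.partialInv p j).elim false S with hS'
    have e1 : app (fun i => (w i).bind (Function.partialInv p)) S = app w S' := by
      funext i
      show ((w i).bind (Function.partialInv p)).elim false S = (w i).elim false S'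
      rcases w i with _ | j <;> rfl
    rw [e1]
    obtain ⟨l0, hl0⟩ := hS
    have hne : (Finset.univ.filter fun j => S' j = true).Nonempty := ⟨p l0, by
      simp [hS', Function.partialInv_left hp, hl0]⟩
    set j0 := Finset.min' _ hne with hj0
    have hj1 : S' j0 = true := (Finset.mem_filter.1 (Finset.min'_mem _ hne)).2
    rw [hd S' j0 hj1 (fun i hi => ?_)]
    · have : ∃ l, Function.partialInv p j0 = some l := by
        rcases hq : Function.partialInv p j0 with _ | l
        · simp [hS', hq] at hj1
        · exact ⟨l, rfl⟩
      obtain ⟨l, hl⟩ := this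
      rw [← (hp.isPartialInv l j0).1 hl, hpd]
    · by_contra hn
      rw [Bool.not_eq_false] at hn
      exact absurd (Finset.min'_le _ i (Finset.mem_filter.2 ⟨Finset.mem_univ _, hn⟩)) (not_le.2 hi)

/-- the Graham-Rothschild type statement -/
theorem gr (α : Type) [Finite α] [Nonempty α] (m : ℕ) : ∃ N : ℕ, ∀ (ι : Type) [Finite ι], N ≤ Nat.card ι →
    ∀ c : (ι → Option α) → Prop, ∃ V : ι → α ⊕ Fin m, Proper V ∧ ∀ z z' : Fin m → Option α,
      (∃ j, z j = none) → (∃ j, z' j = none) → c (act (lft V) z) → c (act (lft V) z') := by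
  classical
  obtain ⟨ι₁, hf1, h1⟩ := fu Prop m
  letI := Fintype.ofFinite ι₁
  let e1 := Fintype.equivFin ι₁
  obtain ⟨ι₂, hf2, h2⟩ := fuse α (Fintype.card ι₁) Prop
  refine ⟨Nat.card ι₂, fun ι _ hι c => ?_⟩
  let a : α := Classical.arbitrary α
  obtain ⟨e0, -⟩ := exists_split (ι := ι) _ hι
  let e : ι ≃ ι₂ ⊕ Fin (Nat.card ι - Nat.card ι₂) :=
    e0.trans (Equiv.sumCongr (Finite.equivFin ι₂).symm (Equiv.refl _))
  obtain ⟨V, hV, hc⟩ := h2 (fun x => c (glue e x (fun _ => some a)))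
  obtain ⟨w, hw, d, hd⟩ := h1 (fun S => c (glue e (act (lft V)
    (fun j => if S (e1.symm j) then none else some a)) (fun _ => some a)))
  refine ⟨glue e (compW V (fun j => (w (e1.symm j)).elim (Sum.inl a) Sum.inr)) (fun _ => Sum.inl a), ?_, ?_⟩
  · refine Proper.glue_left e (hV.comp fun j => ?_) _
    obtain ⟨i, hi⟩ := hw j
    exact ⟨e1 i, by simp [hi]⟩
  · have key : ∀ z : Fin m → Option α, (∃ j, z j = none) →
        c (act (lft (glue e (compW V (fun j => (w (e1.symm j)).elim (Sum.inl a) Sum.inr)) (fun _ => Sum.inl a))) z) = d := by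
      intro z hz
      have e2 : act (lft (glue e (compW V (fun j => (w (e1.symm j)).elim (Sum.inl a) Sum.inr))
          (fun _ => Sum.inl a))) z
          = glue e (act (lft V) (fun j => (w (e1.symm j)).elim (some a) z)) (fun _ => some a) := by
        funext i
        unfold act lft glue
        rcases e i with i | i
        · show Sum.elim id z (Sum.map some id (Sum.elim Sum.inl _ (V i))) = Sum.elim id _ (Sum.map some id (V i))
          rcases V i with b | j
          · rfl
          · show Sum.elim id z (Sum.map some id (Option.elim (w (e1.symm j)) _ _)) = Option.elim (w (e1.symm j)) _ _
            rcases w (e1.symm j) with _ | l <;> rfl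
        · rfl
      rw [e2]
      refine (hc _ (fun j => if app w (fun l => decide (z l = none)) (e1.symm j) then none else some a) ?_).trans
        (hd (fun l => decide (z l = none)) ?_)
      · intro j
        unfold app
        rcases w (e1.symm j) with _ | l
        · simp
        · by_cases hl : z l = none <;> simp [hl]
      · obtain ⟨j, hj⟩ := hz
        exact ⟨j, by simp [hj]⟩
    intro z z' hz hz'
    rw [key z hz, key z' hz']
    exact id

end ramsey

end P13

set_option linter.unusedVariables false
set_option linter.unusedSectionVars false

namespace P13

section extremal
variable {ι ι₁ ι₂ η ζ α β : Type}

/-- contains a combinatorial line -/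
def HasLine (A : (ι → β) → Prop) : Prop := ∃ v : ι → β ⊕ Unit, Proper v ∧ ∀ z, A (act v z)

/-- density `δ` forces lines -/
def GoodD (β : Type) [Finite β] (δ : ℝ) : Prop := ∃ N : ℕ, ∀ (ι : Type) [Finite ι], N ≤ Nat.card ι →
  ∀ A : (ι → β) → Prop, δ ≤ ex (fun x => ind (A x)) → HasLine A

/-- fill the holes -/
def fil (a : α) (x : ι → Option α) : ι → Option α := fun i => some ((x i).getD a)

theorem fil_act (a : α) (V : ι → α ⊕ η) (z : η → Option α) :
    fil a (act (lft V) z) = act (lft V) (fil a z) := by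
  funext i; unfold fil act lft; rcases V i with b | b <;> rfl

theorem HasLine.of_act {A : (ι → β) → Prop} {W : ι → β ⊕ η} (hW : Proper W)
    (h : HasLine (fun z => A (act W z))) : HasLine A := by
  obtain ⟨v, hv, hA⟩ := h
  exact ⟨compW W v, hW.comp hv, fun z => by rw [act_comp]; exact hA z⟩

theorem pigeon {L Y : Type} [Finite L] [Finite Y] [Nonempty Y] {G : Y → Prop} {Q : L → Y → Prop}
    (h : ∀ y, G y → ∃ l, Q l y) {δ : ℝ} (hδ : 0 < δ) (hG : δ ≤ ex (fun y => ind (G y))) :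
    ∃ l, δ / ((Nat.card L : ℝ) + 1) ≤ ex (fun y => ind (Q l y)) := by
  letI := Fintype.ofFinite L
  have h2 : ex (fun y => ind (G y)) ≤ ∑ l, ex (fun y => ind (Q l y)) := by
    rw [← ex_sum]
    refine ex_mono fun y => ?_
    by_cases hy : G y
    · rw [ind_true hy]
      obtain ⟨l, hl⟩ := h y hy
      rw [← ind_true hl]
      exact Finset.single_le_sum (f := fun v => ind (Q v y)) (fun v _ => ind_nonneg _)
        (Finset.mem_univ l)
    · rw [ind_false hy]; exact Finset.sum_nonneg fun v _ => ind_nonneg _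
  by_contra hcon
  push Not at hcon
  have h4 : ∑ l, ex (fun y => ind (Q l y)) ≤ ∑ _l : L, δ / ((Nat.card L : ℝ) + 1) :=
    Finset.sum_le_sum fun v _ => (hcon v).le
  rw [Finset.sum_const, Finset.card_univ, nsmul_eq_mul, ← Nat.card_eq_fintype_card] at h4
  have h5 : (Nat.card L : ℝ) * (δ / ((Nat.card L : ℝ) + 1)) < ((Nat.card L : ℝ) + 1) * (δ / ((Nat.card L : ℝ) + 1)) :=
    mul_lt_mul_of_pos_right (by linarith) (by positivity)
  rw [mul_div_cancel₀ _ (by positivity)] at h5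
  linarith

theorem upper_sum [Finite α] [Finite ι] {ξ : ℝ} {g : (ι → Option α) → ℝ}
    (hS : ∀ D : α → (ι → Option α) → Prop, (∀ a, Ins a (D a)) → ex (fun x => g x * ind (∀ a, D a x)) ≤ ξ)
    (D : α → (ι → Option α) → Prop) (hD : ∀ a, Ins a (D a)) (J : Finset α) :
    ex (fun x => g x * ind (¬ ∀ a ∈ J, D a x)) ≤ J.card * ξ := by
  classical
  induction J using Finset.induction_on with
  | empty =>
    simp only [Finset.card_empty, Nat.cast_zero, zero_mul]
    refine (ex_mono (g := fun _ => 0) fun x => ?_).trans ?_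
    · rw [ind_false (by simp), mul_zero]
    · have := ex_smul 0 (fun _ : ι → Option α => (0 : ℝ))
      simp only [mul_zero, zero_mul] at this
      exact this.le
  | insert b J hb ih =>
    have h1 := hS (fun a x => if a = b then ¬ D a x else (a ∈ J → D a x)) (fun a => by
      intro x y hxy
      by_cases hab : a = b
      · simp only [if_pos hab]
        exact fun h h' => h (hD a y x (fun i => (hxy i).symm) h')
      · simp only [if_neg hab]
        exact fun h h' => hD a x y hxy (h h'))
    have h2 : ex (fun x => g x * ind (¬ ∀ a ∈ insert b J, D a x)) =
        ex (fun x => g x * ind (¬ ∀ a ∈ J, D a x)) +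
        ex (fun x => g x * ind (∀ a, if a = b then ¬ D a x else (a ∈ J → D a x))) := by
      rw [← ex_add]
      refine congrArg ex (funext fun x => ?_)
      rw [← mul_add]
      congr 1
      have h3 : (∀ a, if a = b then ¬ D a x else (a ∈ J → D a x)) ↔ (¬ D b x ∧ ∀ a ∈ J, D a x) := by
        constructor
        · intro h
          refine ⟨by simpa using h b, fun a ha => ?_⟩
          have := h a
          rw [if_neg (fun hab : a = b => hb (hab ▸ ha))] at this
          exact this ha
        · rintro ⟨h1, h2⟩ a
          split_ifs with hab
          · rw [hab]; exact h1
          · exact h2 a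
      rw [propext h3, Finset.forall_mem_insert]
      by_cases p : D b x <;> by_cases r : ∀ a ∈ J, D a x
      · rw [ind_false (by tauto), ind_false (by tauto), ind_false (by tauto)]; norm_num
      · rw [ind_true (by tauto), ind_true (by tauto), ind_false (by tauto)]; norm_num
      · rw [ind_true (by tauto), ind_false (by tauto), ind_true (by tauto)]; norm_num
      · rw [ind_true (by tauto), ind_true (by tauto), ind_false (by tauto)]; norm_num
    rw [h2, Finset.card_insert_of_notMem hb]
    push_cast
    linarith

theorem ext_upper [Finite α] [Nonempty α] [Finite ι] {ξ c : ℝ} {M : ℕ} (hc : 0 ≤ c)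
    (hM : ∀ B : (Fin M → Option α) → Prop, c ≤ ex (fun x => ind (B x)) → HasLine B)
    (hS : ∀ g : (ι → Option α) → ℝ, (∀ x, g x ≤ 1) →
      (∀ W : ι → Option α ⊕ Fin M, Proper W → ex (fun z => g (act W z)) ≤ 0) →
      ∀ D : α → (ι → Option α) → Prop, (∀ a, Ins a (D a)) → ex (fun x => g x * ind (∀ a, D a x)) ≤ ξ)
    (A : (ι → Option α) → Prop) (hA : ¬ HasLine A) :
    ex (fun x => ind (A x)) + c * ex (fun x => ind (∀ a, A (fil a x)))
      ≤ c + ex (fun x : ι → Option α => ind (∀ i, x i ≠ none)) + Nat.card α * ξ := by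
  classical
  letI := Fintype.ofFinite α
  have h1 := upper_sum (g := fun x => ind (A x) - c) (hS _ (fun x => by linarith [ind_le_one (A x)]) (by
    intro W hW
    rw [ex_sub, ex_const]
    by_contra hn
    push Not at hn
    exact hA (HasLine.of_act hW (hM _ (by linarith))))) (fun a x => A (fil a x)) (by
      intro a x y hxy h
      have : fil a x = fil a y := funext fun i => by unfold fil; rw [hxy i]
      rwa [← this]) Finset.univ
  simp only [Finset.mem_univ, forall_const] at h1
  rw [Finset.card_univ, ← Nat.card_eq_fintype_card] at h1
  have h2 : ex (fun x => ind (A x)) + c * ex (fun x => ind (∀ a, A (fil a x)))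
      ≤ ex (fun x => (ind (A x) - c) * ind (¬ ∀ a, A (fil a x)))
        + ex (fun x : ι → Option α => c + ind (∀ i, x i ≠ none)) := by
    rw [← ex_smul, ← ex_add, ← ex_add]
    refine ex_mono fun x => ?_
    rw [ind_not]
    by_cases hd : ∀ a, A (fil a x)
    · rw [ind_true hd]
      by_cases hx : A x
      · rw [ind_true hx, ind_true]
        · linarith
        · by_contra hn
          push Not at hn
          obtain ⟨i0, hi0⟩ := hn
          refine hA ⟨fun i => (x i).elim (Sum.inr ()) (fun b => Sum.inl (some b)), fun j => ⟨i0, ?_⟩, fun z => ?_⟩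
          · show (x i0).elim (Sum.inr ()) (fun b => Sum.inl (some b)) = _
            rw [hi0]; rfl
          · rcases hz : z () with _ | a
            · convert hx using 1
              funext i
              show Sum.elim id z ((x i).elim _ _) = x i
              rcases x i with _ | b
              · exact hz
              · rfl
            · convert hd a using 1
              funext i
              show Sum.elim id z ((x i).elim _ _) = some ((x i).getD a)
              rcases x i with _ | b
              · exact hz
              · rfl
      · rw [ind_false hx]
        linarith [ind_nonneg (∀ i, x i ≠ none)]
    · rw [ind_false hd]
      linarith [ind_nonneg (∀ i, x i ≠ none)]
  rw [ex_add, ex_const] at h2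
  linarith

theorem no_none_small (α : Type) [Finite α] {ε : ℝ} (hε : 0 < ε) : ∃ N, ∀ m : ℕ, N ≤ m →
    ex (fun x : Fin m → Option α => ind (∀ i, x i ≠ none)) < ε := by
  have hg1 : ex (fun b : Option α => ind (b ≠ none)) < 1 := by
    have h1 := single_le_ex (f := fun b : Option α => 1 - ind (b ≠ none))
      (fun b => by linarith [ind_le_one (b ≠ none)]) none
    rw [ex_sub, ex_const, ind_false (by simp)] at h1
    have h2 : 0 < (1 - 0) / (Nat.card (Option α) : ℝ) :=
      div_pos (by norm_num) (by exact_mod_cast Nat.card_pos)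
    linarith
  have hg0 : 0 ≤ ex (fun b : Option α => ind (b ≠ none)) := ex_nonneg fun b => ind_nonneg _
  obtain ⟨N, hN⟩ := exists_pow_lt_of_lt_one hε hg1
  refine ⟨N, fun m hm => ?_⟩
  have h1 := ex_pi (ι := Fin m) (fun b : Option α => ind (b ≠ none))
  rw [Nat.card_eq_fintype_card, Fintype.card_fin] at h1
  have h2 : (fun x : Fin m → Option α => ind (∀ i, x i ≠ none)) = fun s => ∏ᶠ i, ind (s i ≠ none) := by
    funext s
    rw [finprod_eq_prod_of_fintype]
    by_cases h : ∀ i, s i ≠ none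
    · rw [ind_true h]
      exact (Finset.prod_eq_one fun i _ => ind_true (h i)).symm
    · rw [ind_false h]
      push Not at h
      obtain ⟨i, hi⟩ := h
      exact (Finset.prod_eq_zero (Finset.mem_univ i) (ind_false (by simp [hi]))).symm
  rw [h2, h1]
  exact lt_of_le_of_lt (pow_le_pow_of_le_one hg0 hg1.le hm) hN

/-- the lower bound: a good fibre -/
theorem ext_lower [Finite α] [Nonempty α] [Finite ι] {n m m0 : ℕ} {c θ δ : ℝ} (hδ : 0 < δ)
    (hm0 : ∀ B : (Fin m0 → α) → Prop, δ / 2 ≤ ex (fun x => ind (B x)) → HasLine B)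
    (hθ : θ ≤ δ / 2 / ((Nat.card (Fin m0 → α ⊕ Unit) : ℝ) + 1)) (hm : m0 ≤ m)
    (hgr : ∀ c : (Fin n → Option α) → Prop, ∃ V : Fin n → α ⊕ Fin m, Proper V ∧ ∀ z z' : Fin m → Option α,
      (∃ j, z j = none) → (∃ j, z' j = none) → c (act (lft V) z) → c (act (lft V) z'))
    (A : (Fin n → Option α) → (ι → Option α) → Prop) (hδc : δ ≤ c)
    (hA : ∀ x, c ≤ ex (fun y => ind (A x y))) :
    ∃ V : Fin n → α ⊕ Fin m, Proper V ∧ ∀ z : Fin m → Option α, (∃ j, z j = none) →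
      θ ≤ ex (fun y => ind (∀ a, A (act (lft V) (fil a z)) y)) := by
  classical
  obtain ⟨V, hV, hc⟩ := hgr (fun x => θ ≤ ex (fun y => ind (∀ a, A (fil a x) y)))
  refine ⟨V, hV, ?_⟩
  let a0 : α := Classical.arbitrary α
  -- extension of words
  let ext' : (Fin m0 → Option α) → Fin m → Option α := fun u j =>
    if h : (j : ℕ) < m0 then u ⟨j, h⟩ else some a0
  have h1 : δ ≤ ex (fun y => ex (fun u : Fin m0 → α => ind (A (act (lft V) (ext' fun i => some (u i))) y))) := by
    rw [ex_comm]
    refine hδc.trans ?_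
    rw [← ex_const (X := Fin m0 → α) c]
    exact ex_mono fun u => hA _
  have h2 := markov (fun y => ind_ex_le_one _) hδ.le h1
  obtain ⟨l, hl⟩ := pigeon (L := Fin m0 → α ⊕ Unit)
    (Q := fun l y => Proper l ∧ ∀ z : Unit → α, A (act (lft V) (ext' fun i => some (act l z i))) y)
    (fun y hy => hm0 (fun u => A (act (lft V) (ext' fun i => some (u i))) y) hy) (by positivity) h2
  have hlp : Proper l := by
    by_contra hn
    have : ex (fun y : ι → Option α => ind (Proper l ∧ ∀ z : Unit → α, A (act (lft V) (ext' fun i => some (act l z i))) y)) ≤ 0 := by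
      refine (ex_mono (g := fun _ => 0) fun y => ?_).trans_eq (ex_const 0)
      rw [ind_false (fun h => hn h.1)]
    have h3 : 0 < δ / 2 / ((Nat.card (Fin m0 → α ⊕ Unit) : ℝ) + 1) := by positivity
    linarith
  intro z hz
  have h4 := hc (ext' (act (lft l) fun _ => none)) z ?_ hz ?_
  · simpa only [fil_act] using h4
  · obtain ⟨i, hi⟩ := hlp ()
    refine ⟨⟨i, lt_of_lt_of_le i.2 hm⟩, ?_⟩
    show (if h : (i : ℕ) < m0 then _ else _) = _
    rw [dif_pos i.2]
    unfold act lft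
    rw [hi]; rfl
  · refine hθ.trans (hl.trans (ex_mono fun y => ind_mono ?_))
    rintro ⟨-, h5⟩ a
    have h6 := h5 (fun _ => a)
    rw [fil_act]
    convert h6 using 2
    funext j
    show some ((if h : (j : ℕ) < m0 then _ else _ : Option α).getD a) = (if h : (j : ℕ) < m0 then _ else _)
    split_ifs with hj
    · show some ((Sum.elim id (fun _ => none) (Sum.map some id (l ⟨j, hj⟩))).getD a)
        = some (Sum.elim id (fun _ => a) (l ⟨j, hj⟩))
      rcases l ⟨j, hj⟩ with b | b <;> rfl
    · rfl

theorem goodD_mono {β : Type} [Finite β] {δ δ' : ℝ} (h : GoodD β δ) (hd : δ ≤ δ') : GoodD β δ' := by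
  obtain ⟨N, hN⟩ := h
  exact ⟨N, fun ι _ hι A hA => hN ι hι A (hd.trans hA)⟩

theorem goodD_two {β : Type} [Finite β] [Nonempty β] : GoodD β 2 :=
  ⟨0, fun ι _ hι A hA => by linarith [ind_ex_le_one A]⟩

theorem dhj_step [Finite α] [Nonempty α] (H : DHJ α) : DHJ (Option α) := by
  classical
  by_contra hcon
  have hcon' : ∃ δ0 : ℝ, 0 < δ0 ∧ ¬ GoodD (Option α) δ0 := by
    by_contra hn
    push Not at hn
    exact hcon fun δ hδ => hn δ hδ
  obtain ⟨δ0, hδ0, hbad⟩ := hcon'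
  set δs : ℝ := sInf {δ | GoodD (Option α) δ} with hδs
  have hlb : ∀ δ, GoodD (Option α) δ → δ0 ≤ δ := fun δ h => by
    by_contra hn
    exact hbad (goodD_mono h (not_le.1 hn).le)
  have hbdd : BddBelow {δ | GoodD (Option α) δ} := ⟨δ0, fun δ h => hlb δ h⟩
  have hpos : 0 < δs := lt_of_lt_of_le hδ0 (le_csInf ⟨2, goodD_two⟩ fun δ h => hlb δ h)
  have hgood : ∀ e > 0, GoodD (Option α) (δs + e) := by
    intro e he
    obtain ⟨δ, hδ, hlt⟩ := exists_lt_of_csInf_lt ⟨2, goodD_two⟩ (show sInf {δ | GoodD (Option α) δ} < δs + e by linarith)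
    exact goodD_mono hδ hlt.le
  have hnot : ∀ e > 0, ¬ GoodD (Option α) (δs - e) := fun e he h => by
    have := csInf_le hbdd h
    linarith
  obtain ⟨m0, hm0⟩ := H (δs / 2 / 2) (by positivity)
  set θ : ℝ := δs / 2 / 2 / ((Nat.card (Fin m0 → α ⊕ Unit) : ℝ) + 1) with hθ
  have hθ0 : 0 < θ := by positivity
  have hk : (1 : ℝ) ≤ Nat.card α := by exact_mod_cast Nat.card_pos
  obtain ⟨M, hM⟩ := hgood (δs * θ / 8) (by positivity)
  letI := Fintype.ofFinite α
  obtain ⟨N2, hN2⟩ := S_list H Finset.univ M (show 0 < δs * θ / 8 / Nat.card α by positivity)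
  obtain ⟨N4, hN4⟩ := no_none_small α (show 0 < min (δs * θ / 8) (1 / 4) by positivity)
  set m := max m0 (max N2 N4) with hm
  obtain ⟨n, hn⟩ := gr α m
  set ε : ℝ := min (δs * θ / 8) (δs / 2) with hε
  have hε0 : 0 < ε := by positivity
  set B : ℝ := (Nat.card (Fin n → Option α) : ℝ) with hB
  have hB1 : 1 ≤ B := by rw [hB]; exact_mod_cast Nat.card_pos
  set e' : ℝ := ε / (2 * B) with he'
  have he0 : 0 < e' := by positivity
  have heB : e' * B = ε / 2 := by rw [he']; field_simp
  obtain ⟨N3, hN3⟩ := hgood e' he0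
  have hex : ∃ (ι : Type) (_ : Finite ι), n + N3 ≤ Nat.card ι ∧ ∃ A : (ι → Option α) → Prop,
      δs - e' ≤ ex (fun x => ind (A x)) ∧ ¬ HasLine A := by
    by_contra hno
    refine hnot e' he0 ⟨n + N3, fun ι _ hι A hA => ?_⟩
    by_contra hl
    exact hno ⟨ι, inferInstance, hι, A, hA, hl⟩
  obtain ⟨ι, hfin, hι, A, hAd, hAl⟩ := hex
  obtain ⟨e, -⟩ := exists_split (ι := ι) n (by omega)
  have hsecU : ∀ x : Fin n → Option α, ex (fun y => ind (A (glue e x y))) ≤ δs + e' := by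
    intro x
    by_contra hgt
    push Not at hgt
    obtain ⟨v, hv, hvA⟩ := hN3 (Fin (Nat.card ι - n)) (by simp; omega) (fun y => A (glue e x y)) hgt.le
    refine hAl ⟨glue e (constW _ x) v, hv.glue_right e _, fun z => ?_⟩
    rw [act_glue, act_constW]; exact hvA z
  have hsecL : ∀ x : Fin n → Option α, δs - ε ≤ ex (fun y => ind (A (glue e x y))) := by
    intro x
    have h1 := single_le_ex (f := fun x : Fin n → Option α => δs + e' - ex (fun y => ind (A (glue e x y))))
      (fun x => by linarith [hsecU x]) x
    rw [ex_sub, ex_const, ← ex_glue e (fun x => ind (A x)), div_le_iff₀ (by linarith)] at h1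
    have h2 : (δs + e' - ex (fun x => ind (A x))) * B ≤ (2 * e') * B :=
      mul_le_mul_of_nonneg_right (by linarith) (by linarith)
    have : (2 * e') * B = ε := by rw [mul_assoc, heB]; ring
    linarith
  have hεδ : ε ≤ δs / 2 := min_le_right _ _
  have hεθ : ε ≤ δs * θ / 8 := min_le_left _ _
  obtain ⟨V, hV, hVθ⟩ := ext_lower (θ := θ) (δ := δs / 2) (c := δs - ε) (by positivity)
    (fun B hB => hm0 (Fin m0) (by simp) B hB) le_rfl (le_max_left m0 (max N2 N4)) (hn (Fin n) (by simp))
    (fun x y => A (glue e x y)) (by linarith) hsecL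
  set τ : ℝ := ex (fun x : Fin m → Option α => ind (∀ i, x i ≠ none)) with hτ
  have hτs : τ < min (δs * θ / 8) (1 / 4) := hN4 m (le_trans (le_max_right _ _) (le_max_right _ _))
  have hτ1 : τ < δs * θ / 8 := hτs.trans_le (min_le_left _ _)
  have hτ2 : τ < 1 / 4 := hτs.trans_le (min_le_right _ _)
  -- choose y
  have hy : δs - ε + δs * (θ * (1 - τ)) ≤ ex (fun y => ex (fun z : Fin m → Option α => ind (A (glue e (act (lft V) z) y)))
      + δs * ex (fun z : Fin m → Option α => ind (∀ a, A (glue e (act (lft V) (fil a z)) y)))) := by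
    rw [ex_add, ex_smul, ex_comm, ex_comm (fun y z => ind (∀ a, A (glue e (act (lft V) (fil a z)) y)))]
    have h1 : δs - ε ≤ ex (fun z : Fin m → Option α => ex (fun y => ind (A (glue e (act (lft V) z) y)))) := by
      rw [← ex_const (X := Fin m → Option α) (δs - ε)]
      exact ex_mono fun z => hsecL _
    have h2 : θ * (1 - τ) ≤ ex (fun z : Fin m → Option α => ex (fun y => ind (∀ a, A (glue e (act (lft V) (fil a z)) y)))) := by
      rw [hτ, ← ex_const (X := Fin m → Option α) 1, ← ex_sub, ← ex_smul]
      refine ex_mono fun z => ?_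
      by_cases hz : ∀ i, z i ≠ none
      · rw [ind_true hz, sub_self, mul_zero]; exact ex_nonneg fun y => ind_nonneg _
      · rw [ind_false hz, sub_zero, mul_one]
        push Not at hz
        exact hVθ z hz
    have h3 := mul_le_mul_of_nonneg_left h2 hpos.le
    linarith
  obtain ⟨y, hy⟩ := exists_ge_of_ex hy
  have hup := ext_upper (ι := Fin m) (ξ := δs * θ / 8 / Nat.card α) (c := δs + δs * θ / 8) (M := M) (by positivity)
    (fun B hB => hM (Fin M) (by simp) B hB) (fun g hg hW D hD => by
      have := hN2 (Fin m) (by simp [hm]) g hg 0 le_rfl hW D hD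
      simpa using this)
    (fun z => A (glue e (act (lft V) z) y)) (by
      rintro ⟨v, hv, hvA⟩
      refine hAl ⟨glue e (compW (lft V) v) (constW _ y), (hV.lft.comp hv).glue_left e _, fun z => ?_⟩
      rw [act_glue, act_constW, act_comp]; exact hvA z)
  have e1 : (Nat.card α : ℝ) * (δs * θ / 8 / Nat.card α) = δs * θ / 8 := by field_simp
  rw [e1] at hup
  have hDn : 0 ≤ ex (fun z : Fin m → Option α => ind (∀ a, A (glue e (act (lft V) (fil a z)) y))) :=
    ex_nonneg fun _ => ind_nonneg _
  have e2 : 0 ≤ δs * θ / 8 * ex (fun z : Fin m → Option α => ind (∀ a, A (glue e (act (lft V) (fil a z)) y))) :=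
    mul_nonneg (by positivity) hDn
  have e3 : 0 < δs * θ := by positivity
  have e4 : δs * θ * τ ≤ δs * θ * (1 / 4) := mul_le_mul_of_nonneg_left hτ2.le e3.le
  rw [← hτ] at hup
  nlinarith

/-- alphabets -/
def Alph : ℕ → Type
  | 0 => Unit
  | n + 1 => Option (Alph n)

theorem alph_inst : ∀ n, ∃ (_ : Finite (Alph n)), Nonempty (Alph n) ∧ Nat.card (Alph n) = n + 1 ∧ DHJ (Alph n) := by
  intro n
  induction n with
  | zero => exact ⟨inferInstanceAs (Finite Unit), ⟨()⟩, Nat.card_unique (α := Unit), dhj_unit⟩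
  | succ n ih =>
    obtain ⟨h1, h2, h3, h4⟩ := ih
    refine ⟨inferInstanceAs (Finite (Option (Alph n))), ⟨(none : Option (Alph n))⟩, ?_, dhj_step h4⟩
    show Nat.card (Option (Alph n)) = _
    rw [Finite.card_option, h3]

/-- density Hales-Jewett for the alphabet `Fin (k+1)` -/
theorem dhj_fin (k : ℕ) : DHJ (Fin (k + 1)) := by
  obtain ⟨h1, h2, h3, h4⟩ := alph_inst k
  let e : Alph k ≃ Fin (k + 1) := (Finite.equivFin (Alph k)).trans (finCongr h3)
  intro δ hδ
  obtain ⟨N, hN⟩ := h4 δ hδ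
  refine ⟨N, fun ι _ hι A hA => ?_⟩
  have h5 := ex_equiv (Equiv.arrowCongr (Equiv.refl ι) e) (fun x => ind (A x))
  rw [← h5] at hA
  obtain ⟨v, hv, hvA⟩ := hN ι hι _ hA
  refine ⟨fun i => Sum.map e id (v i), fun j => ?_, fun z => ?_⟩
  · obtain ⟨i, hi⟩ := hv j
    exact ⟨i, by show Sum.map e id (v i) = _; rw [hi]; rfl⟩
  · have := hvA (fun j => e.symm (z j))
    convert this using 1
    funext i
    show Sum.elim id z (Sum.map e id (v i)) = e (Sum.elim id _ (v i))
    rcases v i with b | b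
    · rfl
    · exact (e.apply_symm_apply (z b)).symm

end extremal

end P13

set_option linter.unusedVariables false
set_option linter.unusedSectionVars false

namespace P13

/-- Cesaro averages -/
noncomputable def ces (a : ℕ → ℝ) (N : ℕ) : ℝ := (N : ℝ)⁻¹ * ∑ n ∈ Finset.Icc 1 N, a n

theorem sum_Icc_range (a : ℕ → ℝ) (N : ℕ) :
    ∑ n ∈ Finset.Icc 1 N, a n = ∑ n ∈ Finset.range N, a (n + 1) := by
  rw [Finset.range_eq_Ico, Finset.sum_Ico_add' a 0 N 1]
  rfl

theorem ces_add (a b : ℕ → ℝ) (N : ℕ) : ces (fun n => a n + b n) N = ces a N + ces b N := by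
  unfold ces; rw [Finset.sum_add_distrib, mul_add]

theorem ces_sub (a b : ℕ → ℝ) (N : ℕ) : ces (fun n => a n - b n) N = ces a N - ces b N := by
  unfold ces; rw [Finset.sum_sub_distrib, mul_sub]

theorem ces_smul (c : ℝ) (a : ℕ → ℝ) (N : ℕ) : ces (fun n => c * a n) N = c * ces a N := by
  unfold ces; rw [← Finset.mul_sum]; ring

theorem ces_const (c : ℝ) (N : ℕ) (hN : 1 ≤ N) : ces (fun _ => c) N = c := by
  unfold ces
  have : (N : ℝ) ≠ 0 := by positivity
  simp; field_simp

theorem ces_nonneg {a : ℕ → ℝ} (h : ∀ n, 0 ≤ a n) (N : ℕ) : 0 ≤ ces a N := by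
  unfold ces
  exact mul_nonneg (by positivity) (Finset.sum_nonneg fun n _ => h n)

theorem ces_mono {a b : ℕ → ℝ} (h : ∀ n, a n ≤ b n) (N : ℕ) : ces a N ≤ ces b N := by
  have := ces_nonneg (a := fun n => b n - a n) (fun n => sub_nonneg.2 (h n)) N
  rw [ces_sub] at this; linarith

theorem ces_abs (a : ℕ → ℝ) (N : ℕ) : |ces a N| ≤ ces (fun n => |a n|) N := by
  unfold ces
  rw [abs_mul, abs_of_nonneg (by positivity : (0:ℝ) ≤ (N:ℝ)⁻¹)]
  gcongr
  exact Finset.abs_sum_le_sum_abs _ _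

theorem ces_le {a : ℕ → ℝ} {C : ℝ} (hC : 0 ≤ C) (h : ∀ n, |a n| ≤ C) (N : ℕ) : |ces a N| ≤ C := by
  rcases Nat.eq_zero_or_pos N with rfl | hN
  · simpa [ces] using hC
  · exact (ces_abs a N).trans ((ces_mono h N).trans (ces_const C N hN).le)

theorem ces_bdd {a : ℕ → ℝ} (h : Bdd a) : Bdd (ces a) := by
  obtain ⟨C, hC, h⟩ := h.exists_pos
  exact ⟨C, ces_le hC.le h⟩

theorem ces_zero {a : ℕ → ℝ} (h : Tendsto a atTop (nhds 0)) : Tendsto (ces a) atTop (nhds 0) := by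
  have := ((tendsto_add_atTop_iff_nat 1).2 h).cesaro
  refine this.congr fun N => ?_
  unfold ces; rw [sum_Icc_range]

theorem ces_shift1 {a : ℕ → ℝ} (h : Bdd a) :
    Tendsto (fun N => ces (fun n => a (n + 1)) N - ces a N) atTop (nhds 0) := by
  obtain ⟨C, hC, h⟩ := h.exists_pos
  have e : ∀ N : ℕ, ces (fun n => a (n + 1)) N - ces a N = (N : ℝ)⁻¹ * (a (N + 1) - a 1) := by
    intro N
    unfold ces
    rw [← mul_sub, ← Finset.sum_sub_distrib, sum_Icc_range (fun n => a (n + 1) - a n) N,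
      Finset.sum_range_sub (fun n => a (n + 1))]
  simp only [e]
  refine squeeze_zero_norm (a := fun N : ℕ => (N : ℝ)⁻¹ * (2 * C)) (fun N => ?_) ?_
  · rw [Real.norm_eq_abs, abs_mul, abs_of_nonneg (by positivity : (0:ℝ) ≤ (N:ℝ)⁻¹)]
    gcongr
    have h1 := abs_le.1 (h (N + 1)); have h2 := abs_le.1 (h 1)
    rw [abs_le]; constructor <;> linarith [h1.1, h1.2, h2.1, h2.2]
  · simpa using (tendsto_inv_atTop_nhds_zero_nat (𝕜 := ℝ)).mul_const (2 * C)

theorem ces_shift {a : ℕ → ℝ} (h : Bdd a) (s : ℕ) :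
    Tendsto (fun N => ces (fun n => a (n + s)) N - ces a N) atTop (nhds 0) := by
  induction s with
  | zero => simp
  | succ s ih =>
    have := (ces_shift1 (h.comp fun n => n + s)).add ih
    rw [add_zero] at this
    refine this.congr fun N => ?_
    have e : (fun n => a (n + 1 + s)) = fun n => a (n + (s + 1)) := by
      funext n; congr 1; omega
    rw [e]; ring

theorem abel_bound {G b : ℕ → ℝ} {B : ℝ} (hB : 0 ≤ B) (hG : ∀ n, |G n| ≤ B) (hb : ∀ n, 0 ≤ b n)
    (hm : Monotone b) (N : ℕ) :
    |∑ n ∈ Finset.range (N + 1), (G (n + 1) - G n) * b n| ≤ 2 * B * b N := by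
  have key : |∑ n ∈ Finset.range (N + 1), (G (n + 1) - G n) * b n - G (N + 1) * b N| ≤ B * b N := by
    induction N with
    | zero =>
      simp only [zero_add, Finset.sum_range_one]
      have : (G 1 - G 0) * b 0 - G 1 * b 0 = - (G 0 * b 0) := by ring
      rw [this, abs_neg, abs_mul, abs_of_nonneg (hb 0)]
      exact mul_le_mul_of_nonneg_right (hG 0) (hb 0)
    | succ N ih =>
      rw [Finset.sum_range_succ]
      have e : ∑ n ∈ Finset.range (N + 1), (G (n + 1) - G n) * b n
          + (G (N + 1 + 1) - G (N + 1)) * b (N + 1) - G (N + 1 + 1) * b (N + 1)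
          = (∑ n ∈ Finset.range (N + 1), (G (n + 1) - G n) * b n - G (N + 1) * b N)
            - G (N + 1) * (b (N + 1) - b N) := by ring
      rw [e]
      have h0 : 0 ≤ b (N + 1) - b N := sub_nonneg.2 (hm (Nat.le_succ N))
      calc _ ≤ B * b N + |G (N + 1) * (b (N + 1) - b N)| := (abs_sub _ _).trans (by gcongr)
        _ ≤ B * b N + B * (b (N + 1) - b N) := by
            rw [abs_mul, abs_of_nonneg h0]
            gcongr
            exact hG _
        _ = _ := by ring
  have h2 : |G (N + 1) * b N| ≤ B * b N := by
    rw [abs_mul, abs_of_nonneg (hb N)]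
    exact mul_le_mul_of_nonneg_right (hG _) (hb N)
  rw [abs_le] at *
  constructor <;> linarith [key.1, key.2, h2.1, h2.2]

theorem thinv_core {θ : ℕ → ℝ} (hpos : ∀ n, 0 < θ (n + 1) - θ n)
    (hanti : Antitone fun n => θ (n + 1) - θ n)
    (h0 : Tendsto (fun n => θ (n + 1) - θ n) atTop (nhds 0))
    (hinf : Tendsto (fun n : ℕ => (n : ℝ) * (θ (n + 1) - θ n)) atTop atTop)
    {ψ : ℝ → ℝ} (hb : Bdd ψ) (hu : ∀ ε > 0, ∃ δ > 0, ∀ x y, |x - y| < δ → |ψ x - ψ y| ≤ ε) (a : ℝ) :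
    Tendsto (fun N => ces (fun n => ψ (θ n + a)) N - ces (fun n => ψ (θ n)) N) atTop (nhds 0) := by
  obtain ⟨C, hC, hψ⟩ := hb.exists_pos
  have hc : Continuous ψ := by
    rw [Metric.continuous_iff]
    intro x ε hε
    obtain ⟨δ, hδ, H⟩ := hu (ε / 2) (by linarith)
    refine ⟨δ, hδ, fun y hy => ?_⟩
    rw [Real.dist_eq] at *
    have := H y x hy
    linarith
  set g : ℝ → ℝ := fun x => ψ (x + a) - ψ x with hg
  have hgc : Continuous g := (hc.comp (continuous_id.add continuous_const)).sub hc
  set G : ℝ → ℝ := fun x => ∫ t in (0:ℝ)..x, g t with hG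
  have hi : ∀ x y, IntervalIntegrable ψ volume x y := fun x y => hc.intervalIntegrable x y
  have hig : ∀ x y, IntervalIntegrable g volume x y := fun x y => hgc.intervalIntegrable x y
  have hGb : ∀ x, |G x| ≤ 2 * (C * |a|) := by
    intro x
    have e : G x = (∫ t in x..(x + a), ψ t) - ∫ t in (0:ℝ)..a, ψ t := by
      have e1 : G x = (∫ t in (0:ℝ)..x, ψ (t + a)) - ∫ t in (0:ℝ)..x, ψ t :=
        intervalIntegral.integral_sub
          ((hc.comp (continuous_id.add continuous_const)).intervalIntegrable _ _) (hi _ _)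
      rw [e1, intervalIntegral.integral_comp_add_right (fun t => ψ t) a]
      have e2 := intervalIntegral.integral_add_adjacent_intervals (hi 0 a) (hi a (x + a))
      have e3 := intervalIntegral.integral_add_adjacent_intervals (hi 0 x) (hi x (x + a))
      rw [zero_add]; linarith
    have b1 : ‖∫ t in x..(x + a), ψ t‖ ≤ C * |x + a - x| :=
      intervalIntegral.norm_integral_le_of_norm_le_const fun t _ => hψ t
    have b2 : ‖∫ t in (0:ℝ)..a, ψ t‖ ≤ C * |a - 0| :=
      intervalIntegral.norm_integral_le_of_norm_le_const fun t _ => hψ t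
    rw [Real.norm_eq_abs] at b1 b2
    rw [add_sub_cancel_left] at b1
    rw [sub_zero] at b2
    rw [e]
    exact (abs_sub _ _).trans (by linarith)
  have hgu : ∀ ε > 0, ∃ δ > 0, ∀ x y, |x - y| < δ → |g x - g y| ≤ ε := by
    intro ε hε
    obtain ⟨δ, hδ, H⟩ := hu (ε / 2) (by linarith)
    refine ⟨δ, hδ, fun x y hxy => ?_⟩
    have h1 := H (x + a) (y + a) (by simpa using hxy)
    have h2 := H x y hxy
    have : g x - g y = (ψ (x + a) - ψ (y + a)) - (ψ x - ψ y) := by simp only [hg]; ring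
    rw [this]
    exact (abs_sub _ _).trans (by linarith)
  -- the main approximation
  have h1 : Tendsto (fun n => g (θ n) - (G (θ (n + 1)) - G (θ n)) * (θ (n + 1) - θ n)⁻¹)
      atTop (nhds 0) := by
    rw [Metric.tendsto_atTop]
    intro ε hε
    obtain ⟨δ, hδ, H⟩ := hgu (ε / 2) (by linarith)
    obtain ⟨n0, hn0⟩ := Metric.tendsto_atTop.1 h0 δ hδ
    refine ⟨n0, fun n hn => ?_⟩
    have hd := hn0 n hn
    rw [Real.dist_eq, sub_zero, abs_of_pos (hpos n)] at hd
    rw [Real.dist_eq, sub_zero]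
    have e1 : G (θ (n + 1)) - G (θ n) = ∫ t in (θ n)..(θ (n + 1)), g t :=
      intervalIntegral.integral_interval_sub_left (hig _ _) (hig _ _)
    have e2 : (∫ t in (θ n)..(θ (n + 1)), g (θ n) - g t)
        = (θ (n + 1) - θ n) * g (θ n) - ∫ t in (θ n)..(θ (n + 1)), g t := by
      rw [intervalIntegral.integral_sub (by simp) (hig _ _)]
      simp
    have b : ‖∫ t in (θ n)..(θ (n + 1)), g (θ n) - g t‖ ≤ ε / 2 * |θ (n + 1) - θ n| := by
      refine intervalIntegral.norm_integral_le_of_norm_le_const fun t ht => ?_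
      rw [Set.uIoc_of_le (by linarith [hpos n])] at ht
      refine H _ _ ?_
      rw [abs_lt]; constructor <;> linarith [ht.1, ht.2]
    rw [Real.norm_eq_abs, e2, abs_of_pos (hpos n)] at b
    have hp := hpos n
    have e3 : g (θ n) - (G (θ (n + 1)) - G (θ n)) * (θ (n + 1) - θ n)⁻¹
        = (θ (n + 1) - θ n)⁻¹ * ((θ (n + 1) - θ n) * g (θ n) - ∫ t in (θ n)..(θ (n + 1)), g t) := by
      rw [e1]; field_simp
    rw [e3, abs_mul, abs_of_pos (inv_pos.2 hp)]
    calc _ ≤ (θ (n + 1) - θ n)⁻¹ * (ε / 2 * (θ (n + 1) - θ n)) := by gcongr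
      _ = ε / 2 := by field_simp
      _ < ε := by linarith
  have h2 : Tendsto (ces fun n => (G (θ (n + 1)) - G (θ n)) * (θ (n + 1) - θ n)⁻¹)
      atTop (nhds 0) := by
    set B := 2 * (C * |a|) with hB
    have hB0 : 0 ≤ B := by positivity
    refine squeeze_zero_norm' (a := fun N : ℕ => 2 * B * ((N : ℝ) * (θ (N + 1) - θ N))⁻¹) ?_ ?_
    · filter_upwards [eventually_ge_atTop 1] with N hN
      obtain ⟨M, rfl⟩ : ∃ M, N = M + 1 := ⟨N - 1, by omega⟩
      rw [Real.norm_eq_abs]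
      unfold ces
      rw [sum_Icc_range, abs_mul, abs_of_nonneg (by positivity : (0:ℝ) ≤ ((M+1 : ℕ):ℝ)⁻¹), mul_inv,
        mul_left_comm]
      gcongr
      refine abel_bound (G := fun n => G (θ (n + 1))) (b := fun n => (θ (n + 1 + 1) - θ (n + 1))⁻¹)
        hB0 (fun n => hGb _) (fun n => (inv_pos.2 (hpos _)).le) ?_ M
      intro i j hij
      exact inv_anti₀ (hpos _) (hanti (by omega : i + 1 ≤ j + 1))
    · simpa using (tendsto_inv_atTop_zero.comp hinf).const_mul (2 * B)
  have := (ces_zero h1).add h2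
  rw [add_zero] at this
  refine this.congr fun N => ?_
  rw [← ces_add, ← ces_sub]
  congr 1; funext n; simp only [hg]; ring

/-- weak form along a tail -/
theorem thinv_tail {θ : ℕ → ℝ} (s : ℕ) (hpos : ∀ n, s ≤ n → 0 < θ (n + 1) - θ n)
    (hanti : ∀ m n, s ≤ m → m ≤ n → θ (n + 1) - θ n ≤ θ (m + 1) - θ m)
    (h0 : Tendsto (fun n => θ (n + 1) - θ n) atTop (nhds 0))
    (hinf : Tendsto (fun n : ℕ => (n : ℝ) * (θ (n + 1) - θ n)) atTop atTop)
    {ψ : ℝ → ℝ} (hb : Bdd ψ) (hu : ∀ ε > 0, ∃ δ > 0, ∀ x y, |x - y| < δ → |ψ x - ψ y| ≤ ε) (a : ℝ) :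
    Tendsto (fun N => ces (fun n => ψ (θ n + a)) N - ces (fun n => ψ (θ n)) N) atTop (nhds 0) := by
  have e : ∀ n, θ (n + 1 + s) = θ (n + s + 1) := fun n => by congr 1; omega
  have h := thinv_core (θ := fun n => θ (n + s)) (ψ := ψ) (fun n => by
      rw [e]; exact hpos _ (by omega)) (fun m n hmn => by
      simp only [e]; exact hanti _ _ (by omega) (by omega)) (by
      simp only [e]; exact (tendsto_add_atTop_iff_nat (f := fun n => θ (n + 1) - θ n) s).2 h0) (by
      simp only [e]
      have h1 := (tendsto_add_atTop_iff_nat s).2 hinf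
      refine tendsto_atTop_mono' (f₁ := fun n : ℕ => (1 + s : ℝ)⁻¹ *
        (((n + s : ℕ) : ℝ) * (θ (n + s + 1) - θ (n + s)))) _ ?_
        (h1.const_mul_atTop (by positivity))
      filter_upwards [eventually_ge_atTop 1] with n hn
      rw [← mul_assoc]
      refine mul_le_mul_of_nonneg_right ?_ (hpos _ (by omega)).le
      rw [inv_mul_le_iff₀ (by positivity)]
      have : (1 : ℝ) ≤ n := by exact_mod_cast hn
      push_cast
      nlinarith [(Nat.cast_nonneg s : (0:ℝ) ≤ s)]) hb hu a
  have h1 := ces_shift (a := fun n => ψ (θ n + a)) (hb.comp fun n => θ n + a) s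
  have h2 := ces_shift (a := fun n => ψ (θ n)) (hb.comp fun n => θ n) s
  have := (h.sub h1).add h2
  simp only [sub_zero, add_zero] at this
  refine this.congr fun N => ?_
  ring

end P13

set_option linter.unusedVariables false
set_option linter.unusedSectionVars false

namespace P13
universe u

/-- sequences moving along the unipotent flow -/
structure Path (q : ℕ) (d : ℕ → Fin (q + 1) → ℝ) : Prop where
  hU : ∀ n, 1 ≤ n → ∀ i : Fin q, d (n + 1) i.succ = d n i.succ + d n i.castSucc
  h0 : Tendsto (fun n => d (n + 1) 0 - d n 0) atTop (nhds 0)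
  hth : ∀ ψ : ℝ → ℝ, Bdd ψ → (∀ ε > 0, ∃ δ > 0, ∀ x y, |x - y| < δ → |ψ x - ψ y| ≤ ε) → ∀ a : ℝ,
    Tendsto (fun N => ces (fun n => ψ (d n 0 + a)) N - ces (fun n => ψ (d n 0)) N) atTop (nhds 0)

section
variable {q : ℕ} {d : ℕ → Fin (q + 1) → ℝ}

/-- the path mean -/
noncomputable def pmean (U : Ultrafilter ℕ) (d : ℕ → Fin (q + 1) → ℝ)
    (Ψ : PUnit.{1} × (Fin (q + 1) → ℝ) → ℝ) : ℝ := ulim U (ces fun n => Ψ (0, d n))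

theorem ulim_congr_zero (U : Ultrafilter ℕ) (hU : (U : Filter ℕ) ≤ atTop) {a b : ℕ → ℝ}
    (ha : Bdd a) (hb : Bdd b) (h : Tendsto (fun n => a n - b n) atTop (nhds 0)) :
    ulim U a = ulim U b := by
  have h1 := (ulim_isMean U).sub ha hb
  rw [ulim_eq U (h.mono_left hU)] at h1
  linarith

theorem cons_self (c : Fin (q + 1) → ℝ) : Fin.cons (c 0) (fun i : Fin q => c i.succ) = c := by
  funext i; refine Fin.cases ?_ (fun i => ?_) i <;> simp

theorem pmean_mean (U : Ultrafilter ℕ) (hU : (U : Filter ℕ) ≤ atTop) : IsMean (pmean U d) where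
  add := fun {f g} hf hg => by
    unfold pmean
    rw [← (ulim_isMean U).add (ces_bdd (hf.comp _)) (ces_bdd (hg.comp _))]
    congr 1; funext N; exact ces_add _ _ N
  smul := fun c {f} hf => by
    unfold pmean
    rw [← (ulim_isMean U).smul c (ces_bdd (hf.comp _))]
    congr 1; funext N; exact ces_smul _ _ N
  nonneg := fun {f} hf h => (ulim_isMean U).nonneg (ces_bdd (hf.comp _)) fun N =>
    ces_nonneg (fun n => h _) N
  one := by
    unfold pmean
    refine ulim_eq U (Tendsto.congr' ?_ tendsto_const_nhds)
    filter_upwards [hU (eventually_ge_atTop 1)] with N hN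
    exact (ces_const 1 N hN).symm

theorem um_path (hd : Path q d) (n : ℕ) (hn : 1 ≤ n) :
    (Fin.cons (d n 0) (fun i => d (n + 1) i.succ) : Fin (q + 1) → ℝ) = Um q (d n) := by
  funext i; refine Fin.cases ?_ (fun i => ?_) i
  · rw [Fin.cons_zero, Um_zero]
  · rw [Fin.cons_succ, Um_succ, hd.hU n hn]

theorem um_tendsto (hd : Path q d) (Ψ : PUnit.{1} × (Fin (q + 1) → ℝ) → ℝ) (hc : UCl Ψ) :
    Tendsto (fun n => Ψ (0, Um q (d n)) - Ψ (0, d (n + 1))) atTop (nhds 0) := by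
  rw [Metric.tendsto_atTop]
  intro ε hε
  obtain ⟨δ, hδ, H⟩ := hc (ε / 2) (by linarith)
  obtain ⟨n0, hn0⟩ := Metric.tendsto_atTop.1 hd.h0 δ hδ
  refine ⟨max n0 1, fun n hn => ?_⟩
  have h1 := hn0 n (le_of_max_le_left hn)
  rw [Real.dist_eq, sub_zero] at h1
  rw [Real.dist_eq, sub_zero]
  have h2 := H 0 (d n 0) (d (n + 1) 0) (fun i => d (n + 1) i.succ) (by rwa [abs_sub_comm])
  rw [cons_self, um_path hd n (le_of_max_le_right hn)] at h2
  linarith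

theorem pmean_U (hd : Path q d) (U : Ultrafilter ℕ) (hU : (U : Filter ℕ) ≤ atTop)
    (Ψ : PUnit.{1} × (Fin (q + 1) → ℝ) → ℝ) (hΨ : Bdd Ψ) (hc : UCl Ψ) :
    pmean U d (fun x => Ψ (x.1, Um q x.2)) = pmean U d Ψ := by
  have hb1 : Bdd (ces fun n => Ψ (0, d (n + 1))) := ces_bdd (hΨ.comp fun n => (0, d (n + 1)))
  have hb0 : Bdd (ces fun n => Ψ (0, d n)) := ces_bdd (hΨ.comp fun n => (0, d n))
  have hbU : Bdd (ces fun n => Ψ (0, Um q (d n))) := ces_bdd (hΨ.comp fun n => (0, Um q (d n)))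
  have s1 : ulim U (ces fun n => Ψ (0, d (n + 1))) = ulim U (ces fun n => Ψ (0, d n)) :=
    ulim_congr_zero U hU hb1 hb0 (ces_shift1 (a := fun n => Ψ (0, d n)) (hΨ.comp fun n => (0, d n)))
  have s2 : ulim U (ces fun n => Ψ (0, Um q (d n))) = ulim U (ces fun n => Ψ (0, d (n + 1))) := by
    refine ulim_congr_zero U hU hbU hb1 ?_
    refine (ces_zero (um_tendsto hd Ψ hc)).congr fun N => ?_
    exact ces_sub _ _ _
  exact s2.trans s1

theorem pmean_th (hd : Path q d) (U : Ultrafilter ℕ) (hU : (U : Filter ℕ) ≤ atTop)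
    (Ψ : PUnit.{1} × ℝ → ℝ) (hΨ : Bdd Ψ) (hc : ∀ ε > (0 : ℝ), ∃ δ > (0 : ℝ), ∀ s x y, |x - y| < δ →
    |Ψ (s, x) - Ψ (s, y)| ≤ ε) (a : ℝ) :
    pmean U d (fun x => Ψ (x.1, x.2 0 + a)) = pmean U d (fun x => Ψ (x.1, x.2 0)) := by
  unfold pmean
  refine ulim_congr_zero U hU (ces_bdd (hΨ.comp fun n => (0, d n 0 + a)))
    (ces_bdd (hΨ.comp fun n => (0, d n 0))) ?_
  exact hd.hth (fun x => Ψ (0, x)) (hΨ.comp fun x => (0, x)) (fun ε hε => by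
    obtain ⟨δ, hδ, H⟩ := hc ε hε
    exact ⟨δ, hδ, fun x y h => H 0 x y h⟩) a

theorem pmean_PM (hd : Path q d) (U : Ultrafilter ℕ) (hU : (U : Filter ℕ) ≤ atTop) :
    PM (pmean U d) where
  mean := pmean_mean U hU
  trE Ψ hΨ e := by
    have : (fun x : PUnit.{1} × (Fin (q + 1) → ℝ) => Ψ (x.1 + e, x.2)) = Ψ := by
      funext x; congr 1
    rw [this]
  U := pmean_U hd U hU
  th := pmean_th hd U hU

theorem path_iter (hd : Path q d) (i : ℕ) (j : Fin (q + 1)) :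
    Tendsto (fun n => (Um q ^ i) (d n) j - d (n + i) j) atTop (nhds 0) := by
  induction i generalizing j with
  | zero => simp
  | succ i ih =>
    refine Fin.cases ?_ (fun j => ?_) j
    · have h1 := (ih 0).sub ((tendsto_add_atTop_iff_nat i).2 hd.h0)
      rw [sub_zero] at h1
      refine h1.congr fun n => ?_
      rw [pow_succ', Module.End.mul_apply, Um_zero]
      have : n + i + 1 = n + (i + 1) := by omega
      rw [this]; ring
    · have h1 := (ih j.succ).add (ih j.castSucc)
      rw [add_zero] at h1
      refine h1.congr' ?_
      filter_upwards [eventually_ge_atTop 1] with n hn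
      rw [pow_succ', Module.End.mul_apply, Um_succ]
      have := hd.hU (n + i) (by omega) j
      have e : n + i + 1 = n + (i + 1) := by omega
      rw [e] at this
      rw [this]; ring

/-- the linear forms of the problem -/
def gam (q k : ℕ) : Fin (k + 2) → PUnit.{1} × (Fin (q + 1) → ℝ) →ₗ[ℝ] ℝ :=
  Fin.cons 0 fun i : Fin (k + 1) =>
    (LinearMap.proj (Fin.last q)).comp ((Um q ^ (i : ℕ)).comp (LinearMap.snd ℝ _ _))

/-- the times -/
def tim (f : ℕ → ℝ) (k n : ℕ) : Fin (k + 2) → ℝ := Fin.cons 0 fun i : Fin (k + 1) => f (n + (i : ℕ))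

theorem gam_tim (hd : Path q d) {f : ℕ → ℝ} (hf : ∀ n, 1 ≤ n → d n (Fin.last q) = f n) {k : ℕ}
    (i : Fin (k + 2)) :
    Tendsto (fun n => gam q k i (0, d n) - tim f k n i) atTop (nhds 0) := by
  refine Fin.cases ?_ (fun i => ?_) i
  · simp [gam, tim]
  · refine (path_iter hd (i : ℕ) (Fin.last q)).congr' ?_
    filter_upwards [eventually_ge_atTop 1] with n hn
    rw [hf _ (by omega)]
    simp [gam, tim]

/-- multicorrelation -/
def KK {Ω : Type u} (Y : Sys ℝ Ω) {κ : Type} [Fintype κ] (g : κ → Ω → ℝ) (t : κ → ℝ) : ℝ :=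
  Y.φ (fun ω => ∏ i, g i (Y.S (t i) ω))

theorem path_ces (hd : Path q d) {f : ℕ → ℝ} (hf : ∀ n, 1 ≤ n → d n (Fin.last q) = f n) {k : ℕ}
    {Ω : Type u} (Y : Sys ℝ Ω) {g : Fin (k + 2) → Ω → ℝ} (hg : ∀ i, GoodF Y (g i)) {L : ℝ}
    (hL : MU (Corr Y (gam q k) g) L) :
    Tendsto (ces fun n => KK Y g (tim f k n)) atTop (nhds L) := by
  have hb : Bdd (KK Y g) := ⟨1, fun t => Y.mean.abs_le fun ω => by
    rw [Finset.abs_prod]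
    exact Finset.prod_le_one (fun i _ => abs_nonneg _) fun i _ => (hg i).le_one _⟩
  refine tendsto_of_ulim (ces_bdd (hb.comp fun n => tim f k n)) fun U hU => ?_
  rw [← path_main Y hg (pmean_PM hd U hU) hL]
  unfold pmean
  refine (ulim_congr_zero U hU (ces_bdd ((Corr_bdd hg).comp fun n => (0, d n)))
    (ces_bdd (hb.comp fun n => tim f k n)) ?_).symm
  have key : Tendsto (fun n => Corr Y (gam q k) g (0, d n) - KK Y g (tim f k n)) atTop (nhds 0) := by
    rw [Metric.tendsto_atTop]
    intro ε hε
    -- view both as correlations for the coordinate forms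
    have e1 : ∀ n, Corr Y (gam q k) g (0, d n)
        = Corr Y (fun i => (LinearMap.proj i : (Fin (k + 2) → ℝ) →ₗ[ℝ] ℝ)) g
          (fun i => gam q k i (0, d n)) := fun n => rfl
    have e2 : ∀ t, KK Y g t
        = Corr Y (fun i => (LinearMap.proj i : (Fin (k + 2) → ℝ) →ₗ[ℝ] ℝ)) g t := fun t => rfl
    obtain ⟨δ, hδ, H⟩ := Fp_UC (γ := fun i => (LinearMap.proj i : (Fin (k + 2) → ℝ) →ₗ[ℝ] ℝ)) hg
      (ε / 2) (by linarith)
    have h1 : ∀ᶠ n in atTop, ∀ i, |gam q k i (0, d n) - tim f k n i| < δ := by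
      rw [eventually_all]
      intro i
      have := (Metric.tendsto_nhds.1 (gam_tim hd hf (k := k) i)) δ hδ
      filter_upwards [this] with n hn
      rwa [Real.dist_eq, sub_zero] at hn
    obtain ⟨n0, hn0⟩ := eventually_atTop.1 h1
    refine ⟨n0, fun n hn => ?_⟩
    rw [Real.dist_eq, sub_zero, e1, e2]
    have := H (fun i => gam q k i (0, d n)) (tim f k n) (hn0 n hn)
    have h2 := Corr_diff (γ := fun i => (LinearMap.proj i : (Fin (k + 2) → ℝ) →ₗ[ℝ] ℝ)) hg
      (fun i => gam q k i (0, d n)) (tim f k n)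
    linarith
  refine (ces_zero key).congr fun N => ?_
  rw [ces_sub]

end
end P13

set_option linter.unusedVariables false
set_option linter.unusedSectionVars false

namespace P13

theorem ddIter_dd (f : ℕ → ℝ) (l : ℕ) : ddIter (dd f) l = ddIter f (l + 1) := by
  induction l with
  | zero => rfl
  | succ l ih =>
    show dd (ddIter (dd f) l) = dd (ddIter f (l + 1))
    rw [ih]

theorem memF_inF1 (l : ℕ) (f : ℕ → ℝ) (h : memF l f) : inF1 (ddIter f l) := by
  induction l generalizing f with
  | zero => exact h
  | succ l ih =>
    have := ih (dd f) h
    rwa [ddIter_dd] at this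

theorem ddIter_step (f : ℕ → ℝ) (l n : ℕ) (hn : 1 ≤ n) :
    ddIter f (l + 1) (n + 1) = ddIter f l (n + 1) - ddIter f l n := by
  show dd (ddIter f l) (n + 1) = _
  unfold dd
  rw [if_neg (by omega)]; rfl

/-- the path attached to a function -/
noncomputable def dpath (f : ℕ → ℝ) (l : ℕ) (n : ℕ) (i : Fin (l + 1)) : ℝ :=
  ddIter f (l - (i : ℕ)) (n + (l - (i : ℕ)))

theorem dpath_last (f : ℕ → ℝ) (l n : ℕ) : dpath f l n (Fin.last l) = f n := by
  simp [dpath, ddIter]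

theorem dpath_zero (f : ℕ → ℝ) (l n : ℕ) : dpath f l n 0 = ddIter f l (n + l) := by
  simp [dpath]

theorem dpath_diff (f : ℕ → ℝ) (l n : ℕ) (hn : 1 ≤ n) :
    dpath f l (n + 1) 0 - dpath f l n 0 = ddIter f (l + 1) (n + (l + 1)) := by
  rw [dpath_zero, dpath_zero]
  have := ddIter_step f l (n + l) (by omega)
  rw [← add_assoc, this]
  have : n + 1 + l = n + l + 1 := by omega
  rw [this]

theorem dpath_Path (f : ℕ → ℝ) (l : ℕ) (hf : memF l f)
    (hf2 : Tendsto (fun n : ℕ => (n : ℝ) * ddIter f (l + 1) n) atTop atTop) :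
    Path l (dpath f l) := by
  obtain ⟨h1, h2, n0, h3⟩ := memF_inF1 l f hf
  have h2' : Tendsto (fun n => ddIter f (l + 1) (n + (l + 1))) atTop (nhds 0) :=
    (tendsto_add_atTop_iff_nat (f := ddIter f (l + 1)) (l + 1)).2 h2
  have h0 : Tendsto (fun n => dpath f l (n + 1) 0 - dpath f l n 0) atTop (nhds 0) := by
    refine h2'.congr' ?_
    filter_upwards [eventually_ge_atTop 1] with n hn
    rw [dpath_diff f l n hn]
  have hinf' := (tendsto_add_atTop_iff_nat (l + 1)).2 hf2
  have hposE : ∀ᶠ n : ℕ in atTop, 0 < ddIter f (l + 1) (n + (l + 1)) := by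
    filter_upwards [hinf'.eventually_gt_atTop 0] with n hn
    exact pos_of_mul_pos_right hn (by positivity)
  obtain ⟨n1, hn1⟩ := eventually_atTop.1 hposE
  refine ⟨fun n hn i => ?_, h0, fun ψ hb hu a => ?_⟩
  · unfold dpath
    have hi := i.2
    obtain ⟨j, hj⟩ : ∃ j, l - (i : ℕ) = j + 1 := ⟨l - i - 1, by omega⟩
    have hj' : l - ((i : ℕ) + 1) = j := by omega
    simp only [Fin.val_succ, Fin.val_castSucc, hj, hj']
    have := ddIter_step f j (n + j) (by omega)
    rw [← add_assoc, this]
    have : n + 1 + j = n + j + 1 := by omega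
    rw [this]; ring
  · refine thinv_tail (θ := fun n => dpath f l n 0) (max (max n0 n1) 1) (fun n hn => ?_)
      (fun m n hm hmn => ?_) h0 ?_ hb hu a
    · simp only [max_le_iff] at hn
      rw [dpath_diff f l n (by omega)]
      exact hn1 n (by omega)
    · simp only [max_le_iff] at hm
      rw [dpath_diff f l n (by omega), dpath_diff f l m (by omega)]
      exact h3 _ _ (by omega) (by omega)
    · refine tendsto_atTop_mono' (f₁ := fun n : ℕ => (2 + l : ℝ)⁻¹ *
        (((n + (l + 1) : ℕ) : ℝ) * ddIter f (l + 1) (n + (l + 1)))) _ ?_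
        (hinf'.const_mul_atTop (by positivity))
      filter_upwards [eventually_ge_atTop 1, hposE] with n hn hp
      rw [dpath_diff f l n hn, ← mul_assoc]
      refine mul_le_mul_of_nonneg_right ?_ hp.le
      rw [inv_mul_le_iff₀ (by positivity)]
      have : (1 : ℝ) ≤ n := by exact_mod_cast hn
      push_cast
      nlinarith [(Nat.cast_nonneg l : (0:ℝ) ≤ l)]

end P13

set_option linter.unusedVariables false
set_option linter.unusedSectionVars false

namespace P13
universe u

section
variable {Ω : Type u} (Y : Sys ℝ Ω) {k : ℕ} {W : Type} [AddCommGroup W] [Module ℝ W]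

theorem ind_bdd {α : Type*} (B : α → Prop) : Bdd (fun ω => ind (B ω)) :=
  ⟨1, fun ω => by rw [abs_of_nonneg (ind_nonneg _)]; exact ind_le_one _⟩

/-- number of wildcards -/
noncomputable def nw {ι : Type} [Fintype ι] (v : ι → Fin (k + 1) ⊕ Unit) : ℝ :=
  ∑ j, Sum.elim (fun _ => (0 : ℝ)) (fun _ => 1) (v j)

/-- the fixed part -/
noncomputable def fixp {ι : Type} [Fintype ι] (γ : Fin (k + 1) → W →ₗ[ℝ] ℝ) (c : W)
    (v : ι → Fin (k + 1) ⊕ Unit) : ℝ :=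
  ∑ j, Sum.elim (fun b => γ b c) (fun _ => (0 : ℝ)) (v j)

theorem nw_pos {ι : Type} [Fintype ι] {v : ι → Fin (k + 1) ⊕ Unit} (h : Proper v) : 0 < nw v := by
  obtain ⟨i, hi⟩ := h ()
  refine Finset.sum_pos' (fun j _ => ?_) ⟨i, Finset.mem_univ i, ?_⟩
  · rcases v j with b | b <;> simp
  · rw [hi]; simp

theorem word_sum {ι : Type} [Fintype ι] (γ : Fin (k + 1) → W →ₗ[ℝ] ℝ) (c : W)
    (v : ι → Fin (k + 1) ⊕ Unit) (a : Fin (k + 1)) :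
    ∑ j, γ (act v (fun _ => a) j) c = γ a (nw v • c) + fixp γ c v := by
  rw [map_smul, smul_eq_mul]
  unfold nw fixp
  rw [Finset.sum_mul, ← Finset.sum_add_distrib]
  refine Finset.sum_congr rfl fun j _ => ?_
  unfold act
  rcases v j with b | b <;> simp

theorem corr_pos (γ : Fin (k + 1) → W →ₗ[ℝ] ℝ) (B : Ω → Prop)
    (hg : GoodF Y fun ω => ind (B ω)) (hpos : 0 < Y.φ (fun ω => ind (B ω))) {L : ℝ}
    (hL : MU (Corr Y γ (fun _ ω => ind (B ω))) L) : 0 < L := by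
  classical
  set p := Y.φ (fun ω => ind (B ω)) with hp
  obtain ⟨N, hN⟩ := dhj_fin k (p / 2) (by linarith)
  set V : Finset (Fin N → Fin (k + 1) ⊕ Unit) := Finset.univ.filter fun v => Proper v with hV
  have hCb : Bdd (Corr Y γ (fun _ ω => ind (B ω))) := Corr_bdd fun _ => hg
  have key : ∀ c : W, p / 2 ≤ ∑ v ∈ V, Corr Y γ (fun _ ω => ind (B ω)) (nw v • c) := by
    intro c
    have e1 : ∀ v : Fin N → Fin (k + 1) ⊕ Unit, Corr Y γ (fun _ ω => ind (B ω)) (nw v • c)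
        = Y.φ (fun ω => Fp Y γ (fun _ ω => ind (B ω)) (nw v • c) (Y.S (fixp γ c v) ω)) := by
      intro v
      unfold Corr
      rw [← Y.inv _ (Fp_bdd (fun _ => hg) _) (fixp γ c v)]
    have hFb : ∀ v : Fin N → Fin (k + 1) ⊕ Unit,
        Bdd (fun ω => Fp Y γ (fun _ ω => ind (B ω)) (nw v • c) (Y.S (fixp γ c v) ω)) :=
      fun v => (Fp_bdd (fun _ => hg) _).comp _
    have e2 : Y.φ (fun ω => ex fun x : Fin N → Fin (k + 1) => ind (B (Y.S (∑ j, γ (x j) c) ω)))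
        = p := by
      simp only [ex_eq]
      rw [Y.mean.div (Bdd.sum fun x _ => (ind_bdd B).comp _),
        Y.mean.sum fun x _ => (ind_bdd B).comp _]
      have : ∀ x : Fin N → Fin (k + 1), Y.φ (fun ω => ind (B (Y.S (∑ j, γ (x j) c) ω))) = p :=
        fun x => Y.inv _ (ind_bdd B) _
      simp only [this]
      rw [Finset.sum_const, nsmul_eq_mul, Finset.card_univ]
      field_simp
    have hEb : Bdd (fun ω => ex fun x : Fin N → Fin (k + 1) => ind (B (Y.S (∑ j, γ (x j) c) ω))) := by
      refine ⟨1, fun ω => ?_⟩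
      rw [abs_of_nonneg (ex_nonneg fun x => ind_nonneg _)]
      exact ind_ex_le_one _
    have e3 : Y.φ (fun ω => (ex fun x : Fin N → Fin (k + 1) => ind (B (Y.S (∑ j, γ (x j) c) ω)))
        - p / 2) = p / 2 := by
      rw [Y.mean.sub hEb (Bdd.const _), e2, Y.mean.const]; ring
    rw [← e3]
    simp only [e1]
    rw [← Y.mean.sum fun v _ => hFb v]
    refine Y.mean.mono (hEb.sub (Bdd.const _)) (Bdd.sum fun v _ => hFb v) fun ω => ?_
    have hnn : ∀ v : Fin N → Fin (k + 1) ⊕ Unit,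
        0 ≤ Fp Y γ (fun _ ω => ind (B ω)) (nw v • c) (Y.S (fixp γ c v) ω) := fun v =>
      Finset.prod_nonneg fun i _ => ind_nonneg _
    by_cases hE : p / 2 ≤ ex fun x : Fin N → Fin (k + 1) => ind (B (Y.S (∑ j, γ (x j) c) ω))
    · obtain ⟨v, hv, hz⟩ := hN (Fin N) (by simp) _ hE
      have h1 : Fp Y γ (fun _ ω => ind (B ω)) (nw v • c) (Y.S (fixp γ c v) ω) = 1 := by
        unfold Fp
        refine Finset.prod_eq_one fun a _ => ind_true ?_
        have := hz fun _ => a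
        rwa [word_sum, Y.S_add] at this
      have h2 := Finset.single_le_sum (f := fun v : Fin N → Fin (k + 1) ⊕ Unit =>
        Fp Y γ (fun _ ω => ind (B ω)) (nw v • c) (Y.S (fixp γ c v) ω)) (s := V)
        (fun v _ => hnn v) (Finset.mem_filter.2 ⟨Finset.mem_univ v, hv⟩)
      simp only [h1] at h2
      have h3 : (ex fun x : Fin N → Fin (k + 1) => ind (B (Y.S (∑ j, γ (x j) c) ω))) ≤ 1 :=
        ind_ex_le_one _
      linarith
    · have := Finset.sum_nonneg (s := V) fun v _ => hnn v
      linarith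
  obtain ⟨m, hm, ht⟩ := exists_invMean W
  have hv : ∀ v ∈ V, m (fun c => Corr Y γ (fun _ ω => ind (B ω)) (nw v • c)) = L := by
    intro v hv
    have hn : nw v ≠ 0 := (nw_pos (Finset.mem_filter.1 hv).2).ne'
    refine hL.mean hCb (hm.map fun c => nw v • c) fun a => ?_
    have := ht (fun c => Corr Y γ (fun _ ω => ind (B ω)) (nw v • c)) (hCb.comp _) ((nw v)⁻¹ • a)
    rw [← this]
    simp only [smul_add, smul_inv_smul₀ hn]
  have h1 : p / 2 ≤ ∑ v ∈ V, L := by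
    rw [← Finset.sum_congr rfl hv, ← hm.sum fun v _ => hCb.comp _]
    exact hm.const_le (Bdd.sum fun v _ => hCb.comp _) key
  rw [Finset.sum_const, nsmul_eq_mul] at h1
  by_contra hneg
  push Not at hneg
  have : (V.card : ℝ) * L ≤ 0 := mul_nonpos_of_nonneg_of_nonpos (by positivity) hneg
  linarith

end
end P13

set_option linter.unusedVariables false
set_option linter.unusedSectionVars false

namespace P13
universe u

section ext
variable {X : Type u}

/-- bounded functions -/
def BS (X : Type u) : Submodule ℝ (X → ℝ) where
  carrier := {f | Bdd f}
  add_mem' ha hb := Bdd.add ha hb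
  zero_mem' := Bdd.const 0
  smul_mem' c f hf := Bdd.cmul c hf

/-- nonnegative functions -/
def BSpos (X : Type u) : PointedCone ℝ (BS X) where
  carrier := {f | ∀ x, 0 ≤ f.1 x}
  add_mem' ha hb x := add_nonneg (ha x) (hb x)
  zero_mem' x := le_rfl
  smul_mem' c f hf x := mul_nonneg c.2 (hf x)

variable [MeasurableSpace X] (μ : Measure X) [IsProbabilityMeasure μ]

theorem bdd_integrable {f : X → ℝ} (hb : Bdd f) (hm : Measurable f) : Integrable f μ := by
  obtain ⟨C, hC⟩ := hb
  exact Integrable.of_bound hm.aestronglyMeasurable C (Eventually.of_forall hC)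

/-- the integral as a partial functional -/
noncomputable def intP : BS X →ₗ.[ℝ] ℝ where
  domain :=
    { carrier := {f | Measurable f.1}
      add_mem' := fun ha hb => Measurable.add ha hb
      zero_mem' := measurable_const
      smul_mem' := fun c f hf => Measurable.const_smul hf c }
  toFun :=
    { toFun := fun f => ∫ x, f.1.1 x ∂μ
      map_add' := fun f g =>
        integral_add (bdd_integrable μ f.1.2 f.2) (bdd_integrable μ g.1.2 g.2)
      map_smul' := fun c f => integral_const_mul c f.1.1 }

theorem exists_ext : ∃ φ0 : (X → ℝ) → ℝ, IsMean φ0 ∧ ∀ B : Set X, MeasurableSet B →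
    φ0 (fun x => ind (x ∈ B)) = (μ B).toReal := by
  classical
  obtain ⟨g, hg, hpos⟩ := riesz_extension (BSpos X) (intP μ)
    (fun f hf => integral_nonneg fun x => hf x) (fun y => by
      obtain ⟨C, hC⟩ := y.2
      refine ⟨⟨⟨fun _ => C, Bdd.const C⟩, measurable_const⟩, fun x => ?_⟩
      have := (abs_le.1 (hC x)).1
      show 0 ≤ C + y.1 x
      linarith)
  have hmeas : ∀ (f : X → ℝ) (hb : Bdd f), Measurable f → g ⟨f, hb⟩ = ∫ x, f x ∂μ :=
    fun f hb hm => hg ⟨⟨f, hb⟩, hm⟩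
  refine ⟨fun f => if h : Bdd f then g ⟨f, h⟩ else 0, ⟨?_, ?_, ?_, ?_⟩, ?_⟩
  · intro f f' hf hf'
    simp only [dif_pos hf, dif_pos hf', dif_pos (hf.add hf')]
    exact map_add g ⟨f, hf⟩ ⟨f', hf'⟩
  · intro c f hf
    simp only [dif_pos hf, dif_pos (hf.cmul c)]
    exact map_smul g c ⟨f, hf⟩
  · intro f hf h
    simp only [dif_pos hf]
    exact hpos _ h
  · simp only [dif_pos (Bdd.const (1 : ℝ))]
    rw [hmeas _ _ measurable_const]; simp
  · intro B hB
    simp only [dif_pos (ind_bdd fun x => x ∈ B)]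
    have e : (fun x => ind (x ∈ B)) = B.indicator (fun _ => (1 : ℝ)) := by
      funext x; unfold ind; by_cases hx : x ∈ B <;> simp [hx]
    have hm : Measurable (fun x => ind (x ∈ B)) := by
      rw [e]; exact measurable_const.indicator hB
    rw [hmeas _ _ hm, e, integral_indicator hB]
    simp [Measure.real]

end ext

section sys
variable {X : Type u} {φ0 : (X → ℝ) → ℝ} {M : (ℝ → ℝ) → ℝ}

/-- the suspension -/
noncomputable def susp (h0 : IsMean φ0) (hM : IsMean M) (ht : TInv M) : Sys ℝ (X × ℝ) where
  φ G := M (fun u => φ0 (fun x => G (x, u)))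
  mean := hM.bind (k := fun u G => φ0 (fun x => G (x, u))) fun u => h0.map fun x => (x, u)
  S t ω := (ω.1, ω.2 + t)
  S_zero ω := by simp
  S_add a b ω := by simp [add_comm, add_left_comm]
  inv F hF g := by
    refine ht (fun u => φ0 (fun x => F (x, u))) ?_ g
    obtain ⟨C, hC⟩ := hF
    exact ⟨C, fun u => h0.abs_le fun x => hC (x, u)⟩

theorem sum_phase (p : ℤ) (Q : ℕ) (hQ : 0 < Q) (r : ℤ) (hr0 : 0 ≤ r) (hr : r < Q) :
    ∑ l ∈ Finset.range Q, ind ((p + l) % (Q : ℤ) = r) = 1 := by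
  have hQ' : (0 : ℤ) < Q := by exact_mod_cast hQ
  have hm0 := Int.emod_nonneg (r - p) hQ'.ne'
  have hm1 := Int.emod_lt_of_pos (r - p) hQ'
  have hkey : ∀ l ∈ Finset.range Q, ((p + (l : ℤ)) % (Q : ℤ) = r ↔ l = ((r - p) % Q).toNat) := by
    intro l hl
    rw [Finset.mem_range] at hl
    have hl' : (l : ℤ) < Q := by exact_mod_cast hl
    have hr' : r % (Q : ℤ) = r := Int.emod_eq_of_lt hr0 hr
    have hl'' : (l : ℤ) % (Q : ℤ) = l := Int.emod_eq_of_lt (by positivity) hl'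
    constructor
    · intro h
      have h1 : (p + (l : ℤ)) % Q = r % Q := by rw [h, hr']
      have h3 : (l : ℤ) % Q = (r - p) % Q := by
        have h4 : (p + (l : ℤ) - p) % Q = (r - p) % Q := Int.ModEq.sub_right p h1
        rwa [add_sub_cancel_left] at h4
      omega
    · intro h
      have h3 : (l : ℤ) = (r - p) % Q := by omega
      rw [h3, Int.add_emod_emod, add_sub_cancel, hr']
  rw [Finset.sum_eq_single_of_mem ((r - p) % (Q : ℤ)).toNat (Finset.mem_range.2 (by omega))
    (fun l hl hne => ind_false fun h => hne ((hkey l hl).1 h))]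
  exact ind_true ((hkey _ (Finset.mem_range.2 (by omega))).2 rfl)

theorem phase_mean (hM : IsMean M) (ht : TInv M) (A : ℝ) (hA : 0 < A) (Q : ℕ) (hQ : 0 < Q) (r : ℤ)
    (hr0 : 0 ≤ r) (hr : r < Q) : M (fun u => ind (⌊u * A⌋ % (Q : ℤ) = r)) = 1 / Q := by
  have hQ' : (Q : ℝ) ≠ 0 := by positivity
  have h1 : ∀ l : ℕ, M (fun u => ind ((⌊u * A⌋ + (l : ℤ)) % (Q : ℤ) = r))
      = M (fun u => ind (⌊u * A⌋ % (Q : ℤ) = r)) := by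
    intro l
    rw [← ht (fun u => ind (⌊u * A⌋ % (Q : ℤ) = r)) (ind_bdd _) (l / A)]
    congr 1; funext u
    have : (u + l / A) * A = u * A + ((l : ℤ) : ℝ) := by push_cast; field_simp
    rw [this, Int.floor_add_intCast]
  have h2 : M (fun u => ∑ l ∈ Finset.range Q, ind ((⌊u * A⌋ + (l : ℤ)) % (Q : ℤ) = r)) = 1 := by
    simp only [sum_phase _ Q hQ r hr0 hr]
    exact hM.one
  rw [hM.sum fun l _ => ind_bdd _] at h2
  simp only [h1, Finset.sum_const, Finset.card_range, nsmul_eq_mul] at h2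
  field_simp
  linarith

end sys
end P13

set_option linter.unusedVariables false
set_option linter.unusedSectionVars false

namespace P13
universe u

theorem ediv_eq_of {p Q a : ℤ} (hQ : 0 < Q) (h1 : Q * a ≤ p) (h2 : p < Q * (a + 1)) : p / Q = a := by
  apply le_antisymm
  · have : p / Q < a + 1 := (Int.ediv_lt_iff_lt_mul hQ).2 (by linarith [mul_comm Q (a + 1)])
    omega
  · exact (Int.le_ediv_iff_mul_le hQ).2 (by linarith [mul_comm Q a])

theorem ind_forall {n : ℕ} (p : Fin n → Prop) : ∏ i, ind (p i) = ind (∀ i, p i) := by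
  by_cases h : ∀ i, p i
  · rw [ind_true h, Finset.prod_eq_one fun i _ => ind_true (h i)]
  · rw [ind_false h]
    push Not at h
    obtain ⟨i, hi⟩ := h
    exact Finset.prod_eq_zero (Finset.mem_univ i) (ind_false hi)

/-- floor of sums -/
theorem floor_add_cases (x y : ℝ) : ⌊x + y⌋ = ⌊x⌋ + ⌊y⌋ ∨ ⌊x + y⌋ = ⌊x⌋ + ⌊y⌋ + 1 := by
  have h1 := Int.le_floor_add x y
  have h2 := Int.le_floor_add_floor x y
  omega

section
variable {X : Type u} {φ0 : (X → ℝ) → ℝ} {M : (ℝ → ℝ) → ℝ} (h0 : IsMean φ0) (hM : IsMean M)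
  (ht : TInv M)

theorem good_phase (J : ℕ) (hJ : 0 < J) (B : X → ℤ → Prop) :
    GoodF (susp h0 hM ht) (fun ω => ind (B ω.1 ⌊ω.2 * J⌋)) where
  le_one ω := by rw [abs_of_nonneg (ind_nonneg _)]; exact ind_le_one _
  cont ε hε := by
    obtain ⟨Q, hQ⟩ := exists_nat_gt (2 / ε)
    have hQ0 : (0 : ℝ) < Q := lt_trans (by positivity) hQ
    have hQn : 0 < Q := by exact_mod_cast hQ0
    have hJ0 : (0 : ℝ) < J := by exact_mod_cast hJ
    have hA : (0 : ℝ) < J * Q := by positivity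
    have hQz : (0 : ℤ) < Q := by exact_mod_cast hQn
    refine ⟨1 / (J * Q), by positivity, fun s hs => ?_⟩
    show M (fun u => φ0 (fun x => |ind (B x ⌊(u + s) * J⌋) - ind (B x ⌊u * J⌋)|)) ≤ ε
    have hpt : ∀ u x, |ind (B x ⌊(u + s) * J⌋) - ind (B x ⌊u * J⌋)|
        ≤ ind (⌊u * (J * Q)⌋ % (Q : ℤ) = 0) + ind (⌊u * (J * Q)⌋ % (Q : ℤ) = Q - 1) := by
      intro u x
      by_cases hp0 : ⌊u * (J * Q)⌋ % (Q : ℤ) = 0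
      · rw [ind_true hp0]
        have := ind_nonneg (⌊u * (J * Q)⌋ % (Q : ℤ) = Q - 1)
        have h1 := ind_nonneg (B x ⌊(u + s) * J⌋)
        have h2 := ind_nonneg (B x ⌊u * J⌋)
        have h3 := ind_le_one (B x ⌊(u + s) * J⌋)
        have h4 := ind_le_one (B x ⌊u * J⌋)
        rw [abs_le]; constructor <;> linarith
      by_cases hp1 : ⌊u * (J * Q)⌋ % (Q : ℤ) = Q - 1
      · rw [ind_true hp1]
        have := ind_nonneg (⌊u * (J * Q)⌋ % (Q : ℤ) = 0)
        have h1 := ind_nonneg (B x ⌊(u + s) * J⌋)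
        have h2 := ind_nonneg (B x ⌊u * J⌋)
        have h3 := ind_le_one (B x ⌊(u + s) * J⌋)
        have h4 := ind_le_one (B x ⌊u * J⌋)
        rw [abs_le]; constructor <;> linarith
      have e : ⌊(u + s) * J⌋ = ⌊u * J⌋ := by
        rw [← Int.mul_natCast_floor_div_cancel hQn.ne' ((u + s) * J),
          ← Int.mul_natCast_floor_div_cancel hQn.ne' (u * J), mul_assoc, mul_assoc]
        have hs1 := abs_lt.1 hs
        have hs2 : s * (J * Q) < 1 := by
          have := hs1.2; rwa [lt_div_iff₀ hA] at this
        have hs3 : -1 < s * (J * Q) := by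
          have := hs1.1
          rw [neg_lt, lt_div_iff₀ hA] at this
          linarith
        set p := ⌊u * (J * Q)⌋ with hp
        have b1 : ⌊(u + s) * (J * Q)⌋ ≤ p + 1 := by
          rw [← Int.lt_add_one_iff, Int.floor_lt]
          have := Int.lt_floor_add_one (u * (J * Q))
          push_cast; linarith
        have b2 : p - 1 ≤ ⌊(u + s) * (J * Q)⌋ := by
          rw [Int.le_floor]
          have := Int.floor_le (u * (J * Q))
          push_cast; linarith
        have h1 := Int.emod_nonneg p hQz.ne'
        have h2 := Int.emod_lt_of_pos p hQz
        have h3 := Int.mul_ediv_add_emod p Q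
        refine ediv_eq_of hQz ?_ ?_
        · omega
        · have : (Q : ℤ) * (p / Q + 1) = Q * (p / Q) + Q := by ring
          omega
      rw [e, sub_self, abs_zero]
      exact add_nonneg (ind_nonneg _) (ind_nonneg _)
    have hb : Bdd (fun u : ℝ => ind (⌊u * (J * Q)⌋ % (Q : ℤ) = 0)
        + ind (⌊u * (J * Q)⌋ % (Q : ℤ) = Q - 1)) := (ind_bdd _).add (ind_bdd _)
    have hd : ∀ u, Bdd (fun x => |ind (B x ⌊(u + s) * J⌋) - ind (B x ⌊u * J⌋)|) :=
      fun u => ((ind_bdd _).sub (ind_bdd _)).abs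
    have h1 : ∀ u, φ0 (fun x => |ind (B x ⌊(u + s) * J⌋) - ind (B x ⌊u * J⌋)|)
        ≤ ind (⌊u * (J * Q)⌋ % (Q : ℤ) = 0) + ind (⌊u * (J * Q)⌋ % (Q : ℤ) = Q - 1) :=
      fun u => h0.le_const (hd u) (hpt u)
    have hd' : Bdd (fun u => φ0 (fun x => |ind (B x ⌊(u + s) * J⌋) - ind (B x ⌊u * J⌋)|)) := by
      refine ⟨2, fun u => ?_⟩
      rw [abs_of_nonneg (h0.nonneg (hd u) fun x => abs_nonneg _)]
      have a1 := ind_le_one (⌊u * (J * Q)⌋ % (Q : ℤ) = 0)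
      have a2 := ind_le_one (⌊u * (J * Q)⌋ % (Q : ℤ) = Q - 1)
      linarith [h1 u]
    refine (hM.mono hd' hb h1).trans ?_
    rw [hM.add (ind_bdd _) (ind_bdd _), phase_mean hM ht _ hA Q hQn 0 le_rfl hQz,
      phase_mean hM ht _ hA Q hQn (Q - 1) (by omega) (by omega)]
    rw [div_lt_iff₀ hε] at hQ
    rw [← add_div, div_le_iff₀ hQ0]
    linarith [mul_comm (Q : ℝ) ε]

theorem KK_ind {k : ℕ} (B : Fin k → X × ℝ → Prop) (t : Fin k → ℝ) :
    KK (susp h0 hM ht) (fun i ω => ind (B i ω)) t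
      = M (fun u => φ0 (fun x => ind (∀ i, B i (x, u + t i)))) := by
  unfold KK
  simp only [ind_forall]
  rfl

theorem inner_bdd (h0 : IsMean φ0) (B : ℝ → X → Prop) : Bdd (fun u => φ0 (fun x => ind (B u x))) :=
  ⟨1, fun u => h0.abs_le fun x => by rw [abs_of_nonneg (ind_nonneg _)]; exact ind_le_one _⟩

end
end P13

set_option linter.unusedVariables false
set_option linter.unusedSectionVars false

namespace P13
universe u

section
variable {X : Type u} {φ0 : (X → ℝ) → ℝ} {M : (ℝ → ℝ) → ℝ} (h0 : IsMean φ0) (hM : IsMean M)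
  (ht : TInv M) (A : X → Prop) (P : ℤ → X → X) {k : ℕ}

/-- the sets for the sandwich -/
def Bs (k J : ℕ) : Fin (k + 2) → X × ℝ → Prop :=
  Fin.cons (fun ω => A (P ⌊ω.2⌋ ω.1) ∧ ⌊ω.2 * J⌋ % (J : ℤ) = 0) fun _ ω => A (P ⌊ω.2⌋ ω.1)

/-- the sets for the error -/
def Be (X : Type u) (k J : ℕ) (i : Fin (k + 1)) : Fin (k + 2) → X × ℝ → Prop :=
  Fin.cons (fun ω => ⌊ω.2 * J⌋ % (J : ℤ) = 0) fun j ω => j = i →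
    (⌊ω.2 * J⌋ % (J : ℤ) = 0 ∨ ⌊ω.2 * J⌋ % (J : ℤ) = J - 1)

/-- the sets for positivity -/
def Bh (k : ℕ) : Fin (k + 2) → X × ℝ → Prop :=
  Fin.cons (fun ω => A (P ⌊ω.2⌋ ω.1) ∧ ⌊ω.2 * (2 : ℕ)⌋ % ((2 : ℕ) : ℤ) = 0) fun _ ω =>
    A (P ⌊ω.2⌋ ω.1) ∧ ⌊ω.2 * (2 : ℕ)⌋ % ((2 : ℕ) : ℤ) = 1

theorem Bs_good (J : ℕ) (hJ : 0 < J) (i : Fin (k + 2)) :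
    GoodF (susp h0 hM ht) (fun ω => ind (Bs A P k J i ω)) := by
  refine Fin.cases ?_ (fun i => ?_) i
  · have := good_phase h0 hM ht J hJ (fun x p => A (P (p / J) x) ∧ p % (J : ℤ) = 0)
    simp only [Int.mul_natCast_floor_div_cancel hJ.ne'] at this
    exact this
  · have := good_phase h0 hM ht J hJ (fun x p => A (P (p / J) x))
    simp only [Int.mul_natCast_floor_div_cancel hJ.ne'] at this
    exact this

theorem Be_good (J : ℕ) (hJ : 0 < J) (j : Fin (k + 1)) (i : Fin (k + 2)) :
    GoodF (susp h0 hM ht) (fun ω => ind (Be X k J j i ω)) := by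
  refine Fin.cases ?_ (fun i => ?_) i
  · exact good_phase h0 hM ht J hJ (fun x p => p % (J : ℤ) = 0)
  · exact good_phase h0 hM ht J hJ (fun x p => i = j → (p % (J : ℤ) = 0 ∨ p % (J : ℤ) = J - 1))

theorem Bh_good (i : Fin (k + 2)) :
    GoodF (susp h0 hM ht) (fun ω => ind (Bh A P k i ω)) := by
  have h2 : (2 : ℕ) ≠ 0 := two_ne_zero
  refine Fin.cases ?_ (fun i => ?_) i
  · have := good_phase h0 hM ht 2 two_pos (fun x p => A (P (p / (2 : ℕ)) x) ∧ p % ((2 : ℕ) : ℤ) = 0)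
    simp only [Int.mul_natCast_floor_div_cancel h2] at this
    exact this
  · have := good_phase h0 hM ht 2 two_pos (fun x p => A (P (p / (2 : ℕ)) x) ∧ p % ((2 : ℕ) : ℤ) = 1)
    simp only [Int.mul_natCast_floor_div_cancel h2] at this
    exact this

/-- bad times -/
def bad (J : ℕ) (t : ℝ) : Prop := ⌊t * J⌋ % (J : ℤ) = J - 1

variable {A P}

theorem floor_good {J : ℕ} (hJ : 0 < J) {u t : ℝ} (hu : ⌊u * J⌋ % (J : ℤ) = 0) (hb : ¬ bad J t) :
    ⌊u + t⌋ = ⌊u⌋ + ⌊t⌋ := by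
  have hz : (0 : ℤ) < J := by exact_mod_cast hJ
  rw [← Int.mul_natCast_floor_div_cancel hJ.ne' u, ← Int.mul_natCast_floor_div_cancel hJ.ne' t,
    ← Int.mul_natCast_floor_div_cancel hJ.ne' (u + t), add_mul]
  unfold bad at hb
  have h := floor_add_cases (u * J) (t * J)
  have h1 := Int.emod_nonneg ⌊t * J⌋ hz.ne'
  have h2 := Int.emod_lt_of_pos ⌊t * J⌋ hz
  have h3 := Int.mul_ediv_add_emod ⌊t * J⌋ J
  have h4 := Int.mul_ediv_add_emod ⌊u * J⌋ J
  have h5 : (J : ℤ) * (⌊u * J⌋ / J + ⌊t * J⌋ / J) = J * (⌊u * J⌋ / J) + J * (⌊t * J⌋ / J) := by ring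
  have h6 : (J : ℤ) * (⌊u * J⌋ / J + ⌊t * J⌋ / J + 1)
    = J * (⌊u * J⌋ / J) + J * (⌊t * J⌋ / J) + J := by ring
  apply ediv_eq_of hz <;> omega

variable {ν : (Fin (k + 1) → ℤ) → ℝ}
  (hν : ∀ a m, φ0 (fun x => ind (A (P a x) ∧ ∀ i, A (P (a + m i) x))) = ν m)

theorem ν_nonneg (h0 : IsMean φ0)
    (hν : ∀ a m, φ0 (fun x => ind (A (P a x) ∧ ∀ i, A (P (a + m i) x))) = ν m) (m) : 0 ≤ ν m := by
  rw [← hν 0 m]; exact h0.nonneg (ind_bdd _) fun x => ind_nonneg _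

theorem ν_le (h0 : IsMean φ0)
    (hν : ∀ a m, φ0 (fun x => ind (A (P a x) ∧ ∀ i, A (P (a + m i) x))) = ν m) (m) : ν m ≤ 1 := by
  rw [← hν 0 m]; exact h0.le_const (ind_bdd _) fun x => ind_le_one _

theorem KK_Bs (J : ℕ) (t : Fin (k + 1) → ℝ) :
    KK (susp h0 hM ht) (fun i ω => ind (Bs A P k J i ω)) (Fin.cons 0 t)
      = M (fun u => φ0 (fun x => ind ((A (P ⌊u⌋ x) ∧ ⌊u * J⌋ % (J : ℤ) = 0)
        ∧ ∀ i, A (P ⌊u + t i⌋ x)))) := by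
  rw [KK_ind]
  simp only [Fin.forall_fin_succ (n := k + 1), Fin.cons_zero, Fin.cons_succ, Bs, add_zero]

theorem KK_Bs_good (J : ℕ) (hJ : 0 < J) (t : Fin (k + 1) → ℝ) (hb : ∀ i, ¬ bad J (t i))
    (hν : ∀ a m, φ0 (fun x => ind (A (P a x) ∧ ∀ i, A (P (a + m i) x))) = ν m) :
    KK (susp h0 hM ht) (fun i ω => ind (Bs A P k J i ω)) (Fin.cons 0 t)
      = 1 / J * ν (fun i => ⌊t i⌋) := by
  rw [KK_Bs]
  have hz : (0 : ℤ) < J := by exact_mod_cast hJ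
  have e : ∀ u : ℝ, φ0 (fun x => ind ((A (P ⌊u⌋ x) ∧ ⌊u * J⌋ % (J : ℤ) = 0) ∧ ∀ i, A (P ⌊u + t i⌋ x)))
      = ν (fun i => ⌊t i⌋) * ind (⌊u * J⌋ % (J : ℤ) = 0) := by
    intro u
    by_cases hu : ⌊u * J⌋ % (J : ℤ) = 0
    · rw [ind_true hu, mul_one, ← hν ⌊u⌋]
      congr 1; funext x; congr 1
      simp only [hu, and_true, floor_good hJ hu (hb _)]
    · rw [ind_false hu, mul_zero]
      have : (fun x => ind ((A (P ⌊u⌋ x) ∧ ⌊u * J⌋ % (J : ℤ) = 0) ∧ ∀ i, A (P ⌊u + t i⌋ x)))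
          = fun _ => 0 := by
        funext x; exact ind_false fun h => hu h.1.2
      rw [this, h0.const]
  simp only [e]
  rw [hM.smul _ (ind_bdd _), phase_mean hM ht J (by exact_mod_cast hJ) J hJ 0 le_rfl hz, mul_comm]

theorem KK_Bs_bounds (J : ℕ) (hJ : 0 < J) (t : Fin (k + 1) → ℝ) :
    0 ≤ KK (susp h0 hM ht) (fun i ω => ind (Bs A P k J i ω)) (Fin.cons 0 t) ∧
    KK (susp h0 hM ht) (fun i ω => ind (Bs A P k J i ω)) (Fin.cons 0 t) ≤ 1 / J := by
  rw [KK_Bs]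
  have hz : (0 : ℤ) < J := by exact_mod_cast hJ
  constructor
  · exact hM.nonneg (inner_bdd h0 _) fun u => h0.nonneg (ind_bdd _) fun x => ind_nonneg _
  · rw [← phase_mean hM ht J (by exact_mod_cast hJ) J hJ 0 le_rfl hz]
    exact hM.mono (inner_bdd h0 _) (ind_bdd _) fun u => h0.le_const (ind_bdd _) fun x =>
      ind_mono fun h => h.1.2

theorem sandwich (J : ℕ) (hJ : 0 < J) (t : Fin (k + 1) → ℝ)
    (hν : ∀ a m, φ0 (fun x => ind (A (P a x) ∧ ∀ i, A (P (a + m i) x))) = ν m) :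
    |ν (fun i => ⌊t i⌋)
      - J * KK (susp h0 hM ht) (fun i ω => ind (Bs A P k J i ω)) (Fin.cons 0 t)|
      ≤ ∑ i, ind (bad J (t i)) := by
  have hJ0 : (0 : ℝ) < J := by exact_mod_cast hJ
  by_cases h : ∀ i, ¬ bad J (t i)
  · rw [KK_Bs_good h0 hM ht J hJ t h hν, ← mul_assoc, mul_one_div_cancel hJ0.ne', one_mul, sub_self,
      abs_zero]
    exact Finset.sum_nonneg fun i _ => ind_nonneg _
  · push Not at h
    obtain ⟨i, hi⟩ := h
    have h1 := Finset.single_le_sum (f := fun i => ind (bad J (t i))) (s := Finset.univ)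
      (fun i _ => ind_nonneg _) (Finset.mem_univ i)
    simp only [ind_true hi] at h1
    refine le_trans ?_ h1
    obtain ⟨b1, b2⟩ := KK_Bs_bounds h0 hM ht (A := A) (P := P) J hJ t
    have b3 : J * KK (susp h0 hM ht) (fun i ω => ind (Bs A P k J i ω)) (Fin.cons 0 t) ≤ 1 := by
      rw [le_div_iff₀ hJ0] at b2; linarith
    have b4 : 0 ≤ J * KK (susp h0 hM ht) (fun i ω => ind (Bs A P k J i ω)) (Fin.cons 0 t) :=
      mul_nonneg hJ0.le b1
    have b5 := ν_nonneg h0 hν fun i => ⌊t i⌋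
    have b6 := ν_le h0 hν fun i => ⌊t i⌋
    rw [abs_le]; constructor <;> linarith

theorem KK_Be (J : ℕ) (i : Fin (k + 1)) (t : Fin (k + 2) → ℝ) (ht0 : t 0 = 0) :
    KK (susp h0 hM ht) (fun j ω => ind (Be X k J i j ω)) t
      = M (fun u => ind (⌊u * J⌋ % (J : ℤ) = 0 ∧ (⌊(u + t i.succ) * J⌋ % (J : ℤ) = 0
        ∨ ⌊(u + t i.succ) * J⌋ % (J : ℤ) = J - 1))) := by
  rw [KK_ind]
  simp only [Fin.forall_fin_succ (n := k + 1), Fin.cons_zero, Fin.cons_succ, Be, ht0, add_zero,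
    forall_eq]
  simp only [h0.const]

theorem err_le (J : ℕ) (hJ : 0 < J) (i : Fin (k + 1)) (t : Fin (k + 1) → ℝ) :
    ind (bad J (t i)) ≤ J * KK (susp h0 hM ht) (fun j ω => ind (Be X k J i j ω)) (Fin.cons 0 t) := by
  have hJ0 : (0 : ℝ) < J := by exact_mod_cast hJ
  have hz : (0 : ℤ) < J := by exact_mod_cast hJ
  rw [KK_Be h0 hM ht J i _ rfl, Fin.cons_succ]
  by_cases hb : bad J (t i)
  · rw [ind_true hb]
    have h1 : (1 : ℝ) / J ≤ M (fun u => ind (⌊u * J⌋ % (J : ℤ) = 0 ∧ (⌊(u + t i) * J⌋ % (J : ℤ) = 0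
        ∨ ⌊(u + t i) * J⌋ % (J : ℤ) = J - 1))) := by
      rw [← phase_mean hM ht J hJ0 J hJ 0 le_rfl hz]
      refine hM.mono (ind_bdd _) (ind_bdd _) fun u => ind_mono fun hu => ⟨hu, ?_⟩
      unfold bad at hb
      rw [add_mul]
      rcases floor_add_cases (u * J) (t i * J) with h | h
      · right
        rw [h, Int.add_emod, hu, hb, zero_add, Int.emod_eq_of_lt (by omega) (by omega)]
      · left
        rw [h, add_assoc, Int.add_emod, hu, zero_add, Int.emod_emod_of_dvd _ (dvd_refl _),
          Int.add_emod, hb]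
        rw [← Int.emod_eq_of_lt (by omega : (0:ℤ) ≤ J - 1) (by omega : (J : ℤ) - 1 < J),
          ← Int.add_emod, sub_add_cancel, Int.emod_self]
    rw [div_le_iff₀ hJ0] at h1
    linarith
  · rw [ind_false hb]
    exact mul_nonneg hJ0.le (hM.nonneg (ind_bdd _) fun u => ind_nonneg _)

end
end P13

set_option linter.unusedVariables false
set_option linter.unusedSectionVars false

namespace P13
universe u

/-- translation in the last coordinate -/
def vs (q : ℕ) (s : ℝ) : PUnit.{1} × (Fin (q + 1) → ℝ) := (0, Pi.single (Fin.last q) s)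

theorem Um_single (q : ℕ) (s : ℝ) :
    Um q (Pi.single (Fin.last q) s) = (Pi.single (Fin.last q) s : Fin (q + 1) → ℝ) := by
  funext j
  refine Fin.cases ?_ (fun j => ?_) j
  · rw [Um_zero]
  · rw [Um_succ, Pi.single_eq_of_ne (Fin.castSucc_lt_last j).ne, add_zero]

theorem Um_pow_single (q : ℕ) (s : ℝ) (i : ℕ) :
    (Um q ^ i) (Pi.single (Fin.last q) s) = (Pi.single (Fin.last q) s : Fin (q + 1) → ℝ) := by
  induction i with
  | zero => simp
  | succ i ih => rw [pow_succ', Module.End.mul_apply, ih, Um_single]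

theorem gam_vs (q k : ℕ) (s : ℝ) (i : Fin (k + 1)) : gam q k i.succ (vs q s) = s := by
  show ((Um q ^ (i : ℕ)) (Pi.single (Fin.last q) s) : Fin (q + 1) → ℝ) (Fin.last q) = s
  rw [Um_pow_single, Pi.single_eq_same]

theorem gam_zero (q k : ℕ) (x) : gam q k 0 x = 0 := rfl

section
variable {X : Type u} {φ0 : (X → ℝ) → ℝ} {M : (ℝ → ℝ) → ℝ} (h0 : IsMean φ0) (hM : IsMean M)
  (ht : TInv M) {A : X → Prop} {P : ℤ → X → X} {k : ℕ}

theorem err_sum (hM : IsMean M) (ht : TInv M) (J : ℕ) (hJ : 0 < J) (s : ℝ) :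
    ∑ l ∈ Finset.range J, M (fun u => ind (⌊u * J⌋ % (J : ℤ) = 0 ∧
      (⌊(u + (s + l / J)) * J⌋ % (J : ℤ) = 0
        ∨ ⌊(u + (s + l / J)) * J⌋ % (J : ℤ) = J - 1))) ≤ 2 / J := by
  have hJ0 : (0 : ℝ) < J := by exact_mod_cast hJ
  have hz : (0 : ℤ) < J := by exact_mod_cast hJ
  rw [← hM.sum fun l _ => ind_bdd _]
  have h2 : (2 : ℝ) / J = M (fun u => 2 * ind (⌊u * J⌋ % (J : ℤ) = 0)) := by
    rw [hM.smul _ (ind_bdd _), phase_mean hM ht J hJ0 J hJ 0 le_rfl hz]; ring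
  rw [h2]
  refine hM.mono (Bdd.sum fun l _ => ind_bdd _) ((ind_bdd _).cmul 2) fun u => ?_
  have e : ∀ l : ℕ, ⌊(u + (s + l / J)) * J⌋ = ⌊(u + s) * J⌋ + (l : ℤ) := by
    intro l
    have : (u + (s + l / J)) * J = (u + s) * J + (l : ℤ) := by
      push_cast; field_simp; ring
    rw [this, Int.floor_add_intCast]
  simp only [e]
  by_cases hu : ⌊u * J⌋ % (J : ℤ) = 0
  · simp only [hu, true_and, ind_true, mul_one]
    have a1 := sum_phase ⌊(u + s) * J⌋ J hJ 0 le_rfl hz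
    have a2 := sum_phase ⌊(u + s) * J⌋ J hJ (J - 1) (by omega) (by omega)
    calc _ ≤ ∑ l ∈ Finset.range J, (ind ((⌊(u + s) * J⌋ + (l : ℤ)) % (J : ℤ) = 0)
          + ind ((⌊(u + s) * J⌋ + (l : ℤ)) % (J : ℤ) = J - 1)) := by
          refine Finset.sum_le_sum fun l _ => ?_
          by_cases c1 : (⌊(u + s) * J⌋ + (l : ℤ)) % (J : ℤ) = 0
          · rw [ind_true c1]
            linarith [ind_le_one ((⌊(u + s) * J⌋ + (l : ℤ)) % (J : ℤ) = 0 ∨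
              (⌊(u + s) * J⌋ + (l : ℤ)) % (J : ℤ) = J - 1),
              ind_nonneg ((⌊(u + s) * J⌋ + (l : ℤ)) % (J : ℤ) = J - 1)]
          · rw [ind_false c1, zero_add]
            exact ind_mono fun h => h.resolve_left c1
      _ = 2 := by rw [Finset.sum_add_distrib, a1, a2]; norm_num
  · rw [ind_false hu, mul_zero]
    refine (Finset.sum_eq_zero fun l _ => ind_false fun h => hu h.1).le

theorem err_lim (q J : ℕ) (hJ : 0 < J) (i : Fin (k + 1)) {L : ℝ}
    (hL : MU (Corr (susp h0 hM ht) (gam q k) (fun j ω => ind (Be X k J i j ω))) L) :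
    J * L ≤ 2 / J := by
  obtain ⟨m, hm, hmt⟩ := exists_invMean (PUnit.{1} × (Fin (q + 1) → ℝ))
  have hb : Bdd (Corr (susp h0 hM ht) (gam q k) (fun j ω => ind (Be X k J i j ω))) :=
    Corr_bdd fun j => Be_good h0 hM ht J hJ i j
  have h1 := hL.mean hb hm (fun a => hmt _ hb a)
  have h2 : m (fun x => ∑ l ∈ Finset.range J,
      Corr (susp h0 hM ht) (gam q k) (fun j ω => ind (Be X k J i j ω)) (x + vs q (l / J)))
      = J * L := by
    rw [hm.sum (F := fun (l : ℕ) x => Corr (susp h0 hM ht) (gam q k)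
      (fun j ω => ind (Be X k J i j ω)) (x + vs q (l / J))) fun l _ => hb.comp _]
    simp only [hmt _ hb, h1, Finset.sum_const, Finset.card_range, nsmul_eq_mul]
  rw [← h2]
  refine hm.le_const (Bdd.sum fun l _ => hb.comp _) fun x => ?_
  refine le_trans (le_of_eq ?_) (err_sum hM ht J hJ (gam q k i.succ x))
  refine Finset.sum_congr rfl fun l _ => ?_
  refine (KK_Be h0 hM ht J i (fun j => gam q k j (x + vs q (l / J))) (gam_zero _ _ _)).trans ?_
  simp only [map_add, gam_vs]

variable {ν : (Fin (k + 1) → ℤ) → ℝ}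

theorem KK_Bh_le (t : Fin (k + 1) → ℝ)
    (hν : ∀ a m, φ0 (fun x => ind (A (P a x) ∧ ∀ i, A (P (a + m i) x))) = ν m) :
    KK (susp h0 hM ht) (fun i ω => ind (Bh A P k i ω)) (Fin.cons 0 t) ≤ ν (fun i => ⌊t i⌋) := by
  rw [KK_ind]
  refine hM.le_const (inner_bdd h0 _) fun u => ?_
  rw [← hν ⌊u⌋]
  refine h0.mono (ind_bdd _) (ind_bdd _) fun x => ind_mono fun h => ?_
  rw [Fin.forall_fin_succ] at h
  simp only [Fin.cons_zero, Fin.cons_succ, Bh, add_zero] at h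
  obtain ⟨⟨h1, h2⟩, h3⟩ := h
  refine ⟨h1, fun i => ?_⟩
  obtain ⟨h4, h5⟩ := h3 i
  have e : ⌊u + t i⌋ = ⌊u⌋ + ⌊t i⌋ := by
    have h2' : (2 : ℕ) ≠ 0 := two_ne_zero
    rw [← Int.mul_natCast_floor_div_cancel h2' u, ← Int.mul_natCast_floor_div_cancel h2' (t i),
      ← Int.mul_natCast_floor_div_cancel h2' (u + t i)]
    rw [add_mul] at h5 ⊢
    have h := floor_add_cases (u * (2 : ℕ)) (t i * (2 : ℕ))
    omega
  rw [← e]; exact h4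

theorem Bh_shift (i : Fin (k + 1)) (x : X) (u : ℝ) (hu : ⌊u * (2 : ℕ)⌋ % ((2 : ℕ) : ℤ) = 0 ∨ True) :
    Bh A P k i.succ (x, u + 1 / 2) ↔ Bh A P k 0 (x, u) := by
  simp only [Bh, Fin.cons_succ, Fin.cons_zero]
  have e : ⌊(u + 1 / 2) * (2 : ℕ)⌋ = ⌊u * (2 : ℕ)⌋ + 1 := by
    have : (u + 1 / 2) * (2 : ℕ) = u * (2 : ℕ) + (1 : ℤ) := by push_cast; ring
    rw [this, Int.floor_add_intCast]
  have h2' : (2 : ℕ) ≠ 0 := two_ne_zero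
  have a1 := Int.mul_natCast_floor_div_cancel h2' u
  have a2 := Int.mul_natCast_floor_div_cancel h2' (u + 1 / 2)
  rw [e] at a2 ⊢
  constructor
  · rintro ⟨b1, b2⟩
    have : ⌊u + 1 / 2⌋ = ⌊u⌋ := by omega
    rw [this] at b1
    exact ⟨b1, by omega⟩
  · rintro ⟨b1, b2⟩
    have : ⌊u + 1 / 2⌋ = ⌊u⌋ := by omega
    rw [this]
    exact ⟨b1, by omega⟩

theorem half_pos (q : ℕ) {p : ℝ} (hp : ∀ a, φ0 (fun x => ind (A (P a x))) = p) (hp0 : 0 < p) {L : ℝ}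
    (hL : MU (Corr (susp h0 hM ht) (gam q k) (fun j ω => ind (Bh A P k j ω))) L) : 0 < L := by
  obtain ⟨m, hm, hmt⟩ := exists_invMean (PUnit.{1} × (Fin (q + 1) → ℝ))
  have hb : Bdd (Corr (susp h0 hM ht) (gam q k) (fun j ω => ind (Bh A P k j ω))) :=
    Corr_bdd fun j => Bh_good h0 hM ht A P j
  have hg0 := Bh_good h0 hM ht A P (k := k) 0
  obtain ⟨L', hL'⟩ := Corr_MU (Y := susp h0 hM ht) (γ := gam q k)
    (f := fun _ ω => ind (Bh A P k 0 ω)) fun _ => hg0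
  have hb' : Bdd (Corr (susp h0 hM ht) (gam q k) (fun _ ω => ind (Bh A P k 0 ω))) :=
    Corr_bdd fun _ => hg0
  have h1 := hL.mean hb hm (fun a => hmt _ hb a)
  have h2 := hL'.mean hb' hm (fun a => hmt _ hb' a)
  rw [← hmt _ hb (vs q (1 / 2))] at h1
  have e : (fun x => Corr (susp h0 hM ht) (gam q k) (fun j ω => ind (Bh A P k j ω))
      (x + vs q (1 / 2))) = Corr (susp h0 hM ht) (gam q k) (fun _ ω => ind (Bh A P k 0 ω)) := by
    funext y
    refine (KK_ind h0 hM ht (fun j => Bh A P k j) (fun i => gam q k i (y + vs q (1 / 2)))).trans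
      (Eq.trans ?_ (KK_ind h0 hM ht (fun _ => Bh A P k 0) (fun i => gam q k i y)).symm)
    congr 1; funext u; congr 1; funext x; congr 1
    apply propext
    refine forall_congr' fun j => Fin.cases Iff.rfl (fun i => ?_) j
    rw [map_add, gam_vs, ← add_assoc]
    exact Bh_shift i x _ (Or.inr trivial)
  rw [e, h2] at h1
  rw [← h1]
  refine corr_pos _ _ _ hg0 ?_ hL'
  have : (susp h0 hM ht).φ (fun ω => ind (Bh A P k 0 ω)) = p * (1 / (2 : ℕ)) := by
    show M (fun u => φ0 (fun x => ind (A (P ⌊u⌋ x) ∧ ⌊u * (2 : ℕ)⌋ % ((2 : ℕ) : ℤ) = 0))) = _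
    rw [← phase_mean hM ht (2 : ℕ) (by norm_num) 2 two_pos 0 le_rfl (by norm_num),
      ← hM.smul _ (ind_bdd _)]
    congr 1; funext u
    by_cases hu : ⌊u * (2 : ℕ)⌋ % ((2 : ℕ) : ℤ) = 0
    · simp only [hu, and_true, ind_true, mul_one, hp]
    · simp only [hu, and_false, ind_false, not_false_eq_true, mul_zero, h0.const]
  rw [this]; push_cast; linarith

theorem main_abs (h0 : IsMean φ0)
    (hν : ∀ a m, φ0 (fun x => ind (A (P a x) ∧ ∀ i, A (P (a + m i) x))) = ν m)
    {p : ℝ} (hp : ∀ a, φ0 (fun x => ind (A (P a x))) = p) (hp0 : 0 < p)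
    {q : ℕ} {d : ℕ → Fin (q + 1) → ℝ} (hd : Path q d) {f : ℕ → ℝ}
    (hf : ∀ n, 1 ≤ n → d n (Fin.last q) = f n) :
    ∃ c : ℝ, 0 < c ∧
      Tendsto (ces fun n => ν (fun i : Fin (k + 1) => ⌊f (n + (i : ℕ))⌋)) atTop (nhds c) := by
  obtain ⟨M, hM, ht⟩ := exists_invMean ℝ
  set a : ℕ → ℝ := fun n => ν (fun i : Fin (k + 1) => ⌊f (n + (i : ℕ))⌋) with ha
  have hab : Bdd a := ⟨1, fun n => by
    rw [abs_of_nonneg (ν_nonneg h0 hν _)]; exact ν_le h0 hν _⟩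
  have hcb := ces_bdd hab
  -- the uniform estimate
  have key : ∀ J : ℕ, 0 < J → ∃ LJ : ℝ, ∀ U : Ultrafilter ℕ, (U : Filter ℕ) ≤ atTop →
      |ulim U (ces a) - LJ| ≤ (k + 1) * (2 / J) := by
    intro J hJ
    have hJ0 : (0 : ℝ) < J := by exact_mod_cast hJ
    obtain ⟨L, hL⟩ := Corr_MU (Y := susp h0 hM ht) (γ := gam q k)
      (f := fun j ω => ind (Bs A P k J j ω)) fun j => Bs_good h0 hM ht A P J hJ j
    have hE : ∀ i : Fin (k + 1), ∃ L, MU (Corr (susp h0 hM ht) (gam q k)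
        (fun j ω => ind (Be X k J i j ω))) L := fun i =>
      Corr_MU fun j => Be_good h0 hM ht J hJ i j
    choose E hE using hE
    refine ⟨J * L, fun U hU => ?_⟩
    have t1 := path_ces hd hf (susp h0 hM ht) (fun j => Bs_good h0 hM ht A P J hJ j) hL
    have t2 := fun i => path_ces hd hf (susp h0 hM ht) (fun j => Be_good h0 hM ht J hJ i j) (hE i)
    have t3 : Tendsto (fun N => |ces a N - J * ces (fun n => KK (susp h0 hM ht)
        (fun j ω => ind (Bs A P k J j ω)) (tim f k n)) N|) U
        (nhds |ulim U (ces a) - J * L|) :=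
      (((ulim_tendsto U hcb).sub ((t1.mono_left hU).const_mul (J : ℝ))).abs)
    have t4 : Tendsto (fun N => ∑ i : Fin (k + 1), J * ces (fun n => KK (susp h0 hM ht)
        (fun j ω => ind (Be X k J i j ω)) (tim f k n)) N) U (nhds (∑ i : Fin (k + 1), J * E i)) :=
      tendsto_finsetSum _ fun i _ => ((t2 i).mono_left hU).const_mul (J : ℝ)
    have t5 : |ulim U (ces a) - J * L| ≤ ∑ i : Fin (k + 1), J * E i := by
      refine le_of_tendsto_of_tendsto' t3 t4 fun N => ?_
      rw [← ces_smul, ← ces_sub]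
      refine (ces_abs _ N).trans ?_
      have : ∑ i : Fin (k + 1), J * ces (fun n => KK (susp h0 hM ht)
        (fun j ω => ind (Be X k J i j ω)) (tim f k n)) N
        = ces (fun n => ∑ i : Fin (k + 1), J * KK (susp h0 hM ht)
        (fun j ω => ind (Be X k J i j ω)) (tim f k n)) N := by
        unfold ces
        rw [Finset.sum_comm, Finset.mul_sum]
        refine Finset.sum_congr rfl fun i _ => ?_
        rw [← Finset.mul_sum]; ring
      rw [this]
      refine ces_mono (fun n => ?_) N
      refine (sandwich h0 hM ht J hJ (fun i : Fin (k + 1) => f (n + (i : ℕ))) hν).trans ?_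
      exact Finset.sum_le_sum fun i _ => err_le h0 hM ht J hJ i (fun i : Fin (k + 1) => f (n + (i : ℕ)))
    refine t5.trans ?_
    calc ∑ i : Fin (k + 1), J * E i ≤ ∑ i : Fin (k + 1), (2 : ℝ) / J :=
          Finset.sum_le_sum fun i _ => err_lim h0 hM ht q J hJ i (hE i)
      _ = _ := by simp
  set U0 : Ultrafilter ℕ := Ultrafilter.of atTop with hU0
  have hU0l : (U0 : Filter ℕ) ≤ atTop := Ultrafilter.of_le _
  refine ⟨ulim U0 (ces a), ?_, tendsto_of_ulim hcb fun U hU => ?_⟩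
  · obtain ⟨L, hL⟩ := Corr_MU (Y := susp h0 hM ht) (γ := gam q k)
      (f := fun j ω => ind (Bh A P k j ω)) fun j => Bh_good h0 hM ht A P j
    have hpos := half_pos h0 hM ht q hp hp0 hL
    have t1 := path_ces hd hf (susp h0 hM ht) (fun j => Bh_good h0 hM ht A P j) hL
    refine hpos.trans_le (le_of_tendsto_of_tendsto' (t1.mono_left hU0l) (ulim_tendsto U0 hcb)
      fun N => ces_mono (fun n => ?_) N)
    exact KK_Bh_le h0 hM ht (fun i : Fin (k + 1) => f (n + (i : ℕ))) hν
  · refine eq_of_forall_dist_le fun ε hε => ?_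
    obtain ⟨J, hJ⟩ := exists_nat_gt (4 * ((k : ℝ) + 1) / ε)
    have hJ0 : (0 : ℝ) < J := lt_trans (by positivity) hJ
    obtain ⟨L, h⟩ := key J (by exact_mod_cast hJ0)
    have h1 := h U hU
    have h2 := h U0 hU0l
    rw [abs_sub_comm] at h2
    rw [Real.dist_eq]
    refine (abs_sub_le _ L _).trans ((add_le_add h1 h2).trans ?_)
    rw [div_lt_iff₀ hε] at hJ
    have : ((k : ℝ) + 1) * (2 / J) + (k + 1) * (2 / J) = 4 * (k + 1) / J := by ring
    rw [this, div_le_iff₀ hJ0]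
    linarith [mul_comm (J : ℝ) ε]

end
end P13

set_option linter.unusedVariables false
set_option linter.unusedSectionVars false

namespace P13
section
variable {X : Type*} (T e : X → X) (hTe : ∀ x, e (T x) = x) (heT : ∀ x, T (e x) = x)

/-- the permutation -/
def perm : Equiv.Perm X := ⟨T, e, hTe, heT⟩

theorem iter_perm (σ : Equiv.Perm X) (n : ℕ) : (σ : X → X)^[n] = ((σ ^ n : Equiv.Perm X) : X → X) := by
  rw [Equiv.Perm.coe_pow]

theorem zpow_perm (m : ℤ) : zpowIter T e m = ((perm T e hTe heT) ^ m : Equiv.Perm X) := by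
  unfold zpowIter
  split_ifs with h
  · obtain ⟨n, rfl⟩ := Int.eq_ofNat_of_zero_le h
    rw [zpow_natCast, Int.toNat_natCast]
    exact iter_perm (perm T e hTe heT) n
  · obtain ⟨n, hn⟩ := Int.eq_ofNat_of_zero_le (show 0 ≤ -m by omega)
    obtain rfl : m = -(n : ℤ) := by omega
    rw [zpow_neg, zpow_natCast, neg_neg, Int.toNat_natCast, ← inv_pow]
    exact iter_perm (perm T e hTe heT)⁻¹ n

theorem zpow_add (a b : ℤ) (x : X) (hTe : ∀ x, e (T x) = x) (heT : ∀ x, T (e x) = x) :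
    zpowIter T e (a + b) x = zpowIter T e b (zpowIter T e a x) := by
  rw [zpow_perm T e hTe heT, zpow_perm T e hTe heT, zpow_perm T e hTe heT, add_comm,
    _root_.zpow_add, Equiv.Perm.mul_apply]

theorem zpow_mp [MeasurableSpace X] (μ : Measure X) (he : Measurable e)
    (hTe : ∀ x, e (T x) = x) (heT : ∀ x, T (e x) = x) (hpres : MeasurePreserving T μ μ) (m : ℤ) :
    MeasurePreserving (zpowIter T e m) μ μ := by
  have hpe : MeasurePreserving e μ μ := by
    refine ⟨he, ?_⟩
    conv_lhs => rw [← hpres.map_eq]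
    rw [Measure.map_map he hpres.measurable]
    have : e ∘ T = id := funext hTe
    rw [this, Measure.map_id]
  unfold zpowIter
  split_ifs
  · exact hpres.iterate _
  · exact hpe.iterate _

end
end P13

/-- existence and positivity of the limit of the Cesàro averages of
`μ(A ∩ T^{−⌊f(n)⌋}A ∩ T^{−⌊f(n+1)⌋}A ∩ ⋯ ∩ T^{−⌊f(n+k)⌋}A)`. -/
theorem stmt13 {X : Type*} [MeasurableSpace X] (μ : Measure X) [IsProbabilityMeasure μ]
    (T e : X → X) (hT : Measurable T) (he : Measurable e)
    (hTe : ∀ x, e (T x) = x) (heT : ∀ x, T (e x) = x)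
    (hpres : MeasurePreserving T μ μ)
    (ℓ k : ℕ) (hk : 1 ≤ k)
    (f : ℕ → ℝ) (hf : memF ℓ f)
    (hf2 : Tendsto (fun n : ℕ => (n : ℝ) * ddIter f (ℓ + 1) n) atTop atTop)
    (A : Set X) (hA : MeasurableSet A) (hApos : 0 < μ A) :
    ∃ c : ℝ, 0 < c ∧
      Tendsto (fun N : ℕ => (N : ℝ)⁻¹ *
          ∑ n ∈ Finset.Icc 1 N,
            (μ (A ∩ ⋂ i : Fin (k + 1), zpowIter T e ⌊f (n + (i : ℕ))⌋ ⁻¹' A)).toReal)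
        atTop (nhds c) := by
  have hmp := fun m => P13.zpow_mp T e μ he hTe heT hpres m
  obtain ⟨φ0, h0, hφ⟩ := P13.exists_ext μ
  refine P13.main_abs (A := fun x => x ∈ A) (P := zpowIter T e)
    (ν := fun m : Fin (k + 1) → ℤ => (μ (A ∩ ⋂ i : Fin (k + 1), zpowIter T e (m i) ⁻¹' A)).toReal)
    (p := (μ A).toReal) h0 ?_ ?_ ?_ (P13.dpath_Path f ℓ hf hf2) fun n _ => P13.dpath_last f ℓ n
  · intro a m
    have hS : MeasurableSet (A ∩ ⋂ i : Fin (k + 1), zpowIter T e (m i) ⁻¹' A) :=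
      hA.inter (MeasurableSet.iInter fun i => (hmp (m i)).measurable hA)
    rw [← (hmp a).measure_preimage hS.nullMeasurableSet,
      ← hφ _ ((hmp a).measurable hS)]
    congr 1; funext x; congr 1
    simp only [P13.zpow_add T e a _ x hTe heT, Set.mem_preimage, Set.mem_inter_iff, Set.mem_iInter]
  · intro a
    rw [← (hmp a).measure_preimage hA.nullMeasurableSet, ← hφ _ ((hmp a).measurable hA)]
    rfl
  · exact ENNReal.toReal_pos hApos.ne' (measure_ne_top μ A)
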